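/- Let G be a finite group and let L, M ⊴ G be normal subgroups with L < M such that M/L ≅ S₁ × ... × Sₙ is a direct product of non-abelian simple groups all isomorphic to PSL₂(3^f) for some odd integer f ≥ 3. If there exists a non-trivial element xL ∈ M/L of odd order that is rational in G/L, then G has a rational irreducible complex character of even degree. -/

import Mathlib

open CategoryTheory

/-- An element `x` of a finite group is *rational* if it is conjugate to every
generator of the cyclic group `⟨x⟩`. -/
def IsRationalElement {G : Type*} [Group G] (x : G) : Prop :=
  ∀ y : G, Subgroup.zpowers y = Subgroup.zpowers x → IsConj x y

instance : Fact (Nat.Prime 3) := ⟨by norm_num⟩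

/-- `SL₂(F)`. -/
abbrev SL2 (F : Type*) [CommRing F] := Matrix.SpecialLinearGroup (Fin 2) F

/-- `PSL₂(F) = SL₂(F)/Z(SL₂(F))`. -/
abbrev PSL2 (F : Type*) [CommRing F] := SL2 F ⧸ Subgroup.center (SL2 F)

/-- `PGL₂(F) = GL₂(F)/Z(GL₂(F))`. -/
abbrev PGL2 (F : Type*) [CommRing F] :=
  Matrix.GeneralLinearGroup (Fin 2) F ⧸
    Subgroup.center (Matrix.GeneralLinearGroup (Fin 2) F)

/-- The subgroup of inner automorphisms of `S` inside `Aut(S)`. -/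
def innAut (S : Type*) [Group S] : Subgroup (MulAut S) :=
  (MulAut.conj : S →* MulAut S).range

instance innAut_normal (S : Type*) [Group S] : (innAut S).Normal := by
  constructor
  rintro α ⟨s, rfl⟩ β
  refine ⟨β s, ?_⟩
  ext x
  simp [MulAut.conj]


section
set_option linter.unusedSectionVars false

namespace RC

open Finset

section Basic

variable {G : Type} [Group G]

/-- A function on `G` that is the character of a finite dimensional complex representation. -/
def IsChar (χ : G → ℂ) : Prop :=
  ∃ (V : Type) (_ : AddCommGroup V) (_ : Module ℂ V) (_ : FiniteDimensional ℂ V)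
    (ρ : Representation ℂ G V), χ = ρ.character

/-- The (bilinear) inner product of class functions. -/
noncomputable def ip [Fintype G] (χ ψ : G → ℂ) : ℂ :=
  (Nat.card G : ℂ)⁻¹ * ∑ g : G, χ g * ψ g⁻¹

lemma ip_comm [Fintype G] (χ ψ : G → ℂ) : ip χ ψ = ip ψ χ := by
  unfold ip
  congr 1
  rw [← Equiv.sum_comp (Equiv.inv G)]
  simp [mul_comm]

lemma ip_add_left [Fintype G] (χ χ' ψ : G → ℂ) : ip (χ + χ') ψ = ip χ ψ + ip χ' ψ := by
  simp [ip, add_mul, sum_add_distrib, mul_add]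

lemma ip_sub_left [Fintype G] (χ χ' ψ : G → ℂ) : ip (χ - χ') ψ = ip χ ψ - ip χ' ψ := by
  simp [ip, sub_mul, sum_sub_distrib, mul_sub]

lemma ip_add_right [Fintype G] (χ χ' ψ : G → ℂ) : ip ψ (χ + χ') = ip ψ χ + ip ψ χ' := by
  rw [ip_comm, ip_add_left, ip_comm χ, ip_comm χ']

lemma ip_sub_right [Fintype G] (χ χ' ψ : G → ℂ) : ip ψ (χ - χ') = ip ψ χ - ip ψ χ' := by
  rw [ip_comm, ip_sub_left, ip_comm χ, ip_comm χ']

lemma card_ne [Fintype G] : (Nat.card G : ℂ) ≠ 0 := by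
  have : 0 < Nat.card G := Nat.card_pos
  exact_mod_cast this.ne'

variable {V : Type} [AddCommGroup V] [Module ℂ V] [FiniteDimensional ℂ V]
  (ρ : Representation ℂ G V)

lemma ip_char [Fintype G] {W : Type} [AddCommGroup W] [Module ℂ W] [FiniteDimensional ℂ W]
    (σ : Representation ℂ G W) :
    ip σ.character ρ.character = Module.finrank ℂ (ρ.IntertwiningMap σ) := by
  have := invertibleOfNonzero (card_ne (G := G))
  exact Representation.card_inv_mul_sum_char_mul_char_eq_finrank ρ σ

lemma exists_nat_ip [Fintype G] {χ ψ : G → ℂ} (h : IsChar χ) (h' : IsChar ψ) :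
    ∃ n : ℕ, ip χ ψ = n := by
  obtain ⟨V, _, _, _, ρ, rfl⟩ := h
  obtain ⟨W, _, _, _, σ, rfl⟩ := h'
  exact ⟨_, ip_char σ ρ⟩

lemma IsChar.conj {χ : G → ℂ} (h : IsChar χ) (g s : G) : χ (s * g * s⁻¹) = χ g := by
  obtain ⟨V, _, _, _, ρ, rfl⟩ := h
  exact ρ.char_conj g s

lemma IsChar.comp {H : Type} [Group H] {χ : G → ℂ} (h : IsChar χ) (f : H →* G) :
    IsChar (fun x => χ (f x)) := by
  obtain ⟨V, _, _, _, ρ, rfl⟩ := h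
  exact ⟨V, _, _, inferInstance, ρ.comp f, rfl⟩

lemma IsChar.mul {χ ψ : G → ℂ} (h : IsChar χ) (h' : IsChar ψ) : IsChar (χ * ψ) := by
  obtain ⟨V, _, _, _, ρ, rfl⟩ := h
  obtain ⟨W, _, _, _, σ, rfl⟩ := h'
  exact ⟨_, _, _, inferInstance, ρ.tprod σ, (Representation.char_tensor ρ σ).symm⟩

lemma IsChar.dual {χ : G → ℂ} (h : IsChar χ) : IsChar (fun g => χ g⁻¹) := by
  obtain ⟨V, _, _, _, ρ, rfl⟩ := h
  refine ⟨_, _, _, inferInstance, ρ.dual, ?_⟩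
  funext g
  rw [Representation.char_dual]

lemma IsChar.one : IsChar (1 : G → ℂ) :=
  ⟨ℂ, _, _, inferInstance, 1, by funext g; simp [Representation.character]⟩

lemma IsChar.add {χ ψ : G → ℂ} (h : IsChar χ) (h' : IsChar ψ) : IsChar (χ + ψ) := by
  obtain ⟨V, _, _, _, ρ, rfl⟩ := h
  obtain ⟨W, _, _, _, σ, rfl⟩ := h'
  refine ⟨_, _, _, inferInstance, ρ.prod σ, ?_⟩
  funext g
  exact (LinearMap.trace_prodMap' (ρ g) (σ g)).symm

lemma IsChar.prod {ι : Type} (s : Finset ι) {χ : ι → G → ℂ} (h : ∀ i, IsChar (χ i)) :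
    IsChar (∏ i ∈ s, χ i) := by
  classical
  induction s using Finset.induction_on with
  | empty => simpa using IsChar.one
  | insert a s ha ih => rw [prod_insert ha]; exact (h a).mul ih

lemma IsChar.one_nat {χ : G → ℂ} (h : IsChar χ) : ∃ n : ℕ, χ 1 = n := by
  obtain ⟨V, _, _, _, ρ, rfl⟩ := h
  exact ⟨_, ρ.char_one⟩

/-- The representation on the range of an equivariant idempotent. -/
noncomputable def cut (E : Module.End ℂ V) (hc : ∀ g, ρ g * E = E * ρ g) :
    Representation ℂ G (LinearMap.range E) where
  toFun g := (ρ g).restrict (p := LinearMap.range E) (q := LinearMap.range E) (by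
    rintro _ ⟨x, rfl⟩
    exact ⟨ρ g x, (LinearMap.congr_fun (hc g) x).symm⟩)
  map_one' := by ext x; simp
  map_mul' g h := by ext x; simp

lemma cut_apply (E : Module.End ℂ V) (hc : ∀ g, ρ g * E = E * ρ g) (g : G)
    (x : LinearMap.range E) : ((cut ρ E hc g x : LinearMap.range E) : V) = ρ g x := rfl

lemma cut_character (E : Module.End ℂ V) (hE : E * E = E) (hc : ∀ g, ρ g * E = E * ρ g)
    (g : G) : (cut ρ E hc).character g = LinearMap.trace ℂ V (ρ g * E) := by
  have h : ∀ x, (ρ g * E) x ∈ LinearMap.range E := fun x => by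
    rw [hc g]; exact ⟨ρ g x, rfl⟩
  rw [← LinearMap.trace_restrict_eq_of_forall_mem (LinearMap.range E) (ρ g * E) h]
  unfold Representation.character
  congr 1
  ext ⟨x, y, rfl⟩
  have : E (E y) = E y := LinearMap.congr_fun hE y
  simp [cut_apply, this]

lemma isChar_cut (E : Module.End ℂ V) (hE : E * E = E) (hc : ∀ g, ρ g * E = E * ρ g) :
    IsChar (fun g => LinearMap.trace ℂ V (ρ g * E)) :=
  ⟨_, _, _, inferInstance, cut ρ E hc, by funext g; rw [cut_character ρ E hE hc]⟩

/-- Maschke. -/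
lemma exists_proj [Fintype G] (p : Submodule ℂ V) (hp : ∀ g, ∀ x ∈ p, ρ g x ∈ p) :
    ∃ E : Module.End ℂ V, (∀ x, E x ∈ p) ∧ (∀ x ∈ p, E x = x) ∧ (∀ g, ρ g * E = E * ρ g) ∧
      E * E = E := by
  obtain ⟨f, hf⟩ := LinearMap.exists_leftInverse_of_injective p.subtype (by simp)
  let π : Module.End ℂ V := p.subtype ∘ₗ f
  have hπ1 : ∀ x, π x ∈ p := fun x => (f x).2
  have hπ2 : ∀ x ∈ p, π x = x := fun x hx => by
    have := LinearMap.congr_fun hf ⟨x, hx⟩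
    simp [π] at this ⊢
    rw [this]
  let E : Module.End ℂ V := (Nat.card G : ℂ)⁻¹ • ∑ g, ρ g * π * ρ g⁻¹
  have h1 : ∀ x, E x ∈ p := fun x => by
    simp only [E, LinearMap.smul_apply, LinearMap.sum_apply]
    exact p.smul_mem _ (p.sum_mem fun g _ => hp g _ (hπ1 _))
  have h2 : ∀ x ∈ p, E x = x := fun x hx => by
    simp only [E, LinearMap.smul_apply, LinearMap.sum_apply]
    have : ∀ g ∈ (univ : Finset G), (ρ g * π * ρ g⁻¹) x = x := fun g _ => by
      simp only [Module.End.mul_apply]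
      rw [hπ2 _ (hp _ _ hx)]
      simp
    rw [sum_congr rfl this]
    simp only [sum_const, card_univ, ← Nat.card_eq_fintype_card]
    rw [← Nat.cast_smul_eq_nsmul ℂ, smul_smul, inv_mul_cancel₀ card_ne, one_smul]
  refine ⟨E, h1, h2, fun g => ?_, ?_⟩
  · simp only [E, mul_smul_comm, smul_mul_assoc, mul_sum, sum_mul]
    congr 1
    rw [← Equiv.sum_comp (Equiv.mulLeft g) (fun h => ρ h * π * ρ h⁻¹ * ρ g)]
    refine sum_congr rfl fun h _ => ?_
    simp only [Equiv.coe_mulLeft, mul_inv_rev, map_mul, mul_assoc]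
    rw [← map_mul ρ g⁻¹ g]; simp
  · ext x; exact h2 _ (h1 x)

end Basic

end RC

end


section
set_option linter.unusedSectionVars false
namespace RC

open Finset

section Two

variable {G : Type} [Group G] [Fintype G]
variable {V : Type} [AddCommGroup V] [Module ℂ V] [FiniteDimensional ℂ V]
  (ρ : Representation ℂ G V)
variable {W : Type} [AddCommGroup W] [Module ℂ W] [FiniteDimensional ℂ W]
  (σ : Representation ℂ G W)

lemma exists_reg_inv (f : V →ₗ[ℂ] W) (hf : ∀ g, f ∘ₗ ρ g = σ g ∘ₗ f) :
    ∃ h : W →ₗ[ℂ] V, (∀ g, h ∘ₗ σ g = ρ g ∘ₗ h) ∧ f ∘ₗ h ∘ₗ f = f := by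
  have hf' : ∀ g x, f (ρ g x) = σ g (f x) := fun g x => LinearMap.congr_fun (hf g) x
  obtain ⟨P, hP1, hP2, hP3, -⟩ := exists_proj ρ (LinearMap.ker f) (fun g x hx => by
    rw [LinearMap.mem_ker] at hx ⊢; rw [hf', hx, map_zero])
  obtain ⟨Q, hQ1, hQ2, hQ3, -⟩ := exists_proj σ (LinearMap.range f) (by
    rintro g _ ⟨x, rfl⟩; exact ⟨ρ g x, hf' g x⟩)
  have hP3' : ∀ g x, ρ g (P x) = P (ρ g x) := fun g x => LinearMap.congr_fun (hP3 g) x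
  have hQ3' : ∀ g x, σ g (Q x) = Q (σ g x) := fun g x => LinearMap.congr_fun (hQ3 g) x
  obtain ⟨s, hs⟩ := LinearMap.exists_rightInverse_of_surjective f.rangeRestrict (by simp)
  have hs' : ∀ y : LinearMap.range f, f (s y) = y := fun y => by
    have := LinearMap.congr_fun hs y
    simpa using congrArg Subtype.val this
  let Q' : W →ₗ[ℂ] LinearMap.range f := Q.codRestrict _ hQ1
  let h : W →ₗ[ℂ] V := (LinearMap.id - P) ∘ₗ s ∘ₗ Q'
  have key : ∀ w v, f v = Q w → h w = v - P v := fun w v hv => by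
    have h1 : f (s (Q' w)) = f v := by rw [hs', hv]; rfl
    have h2 : s (Q' w) - v ∈ LinearMap.ker f := by rw [LinearMap.mem_ker, map_sub, h1, sub_self]
    have h3 := hP2 _ h2
    rw [map_sub] at h3
    simp only [h, LinearMap.comp_apply, LinearMap.sub_apply, LinearMap.id_apply]
    rw [sub_eq_sub_iff_sub_eq_sub]; exact h3.symm
  refine ⟨h, fun g => ?_, ?_⟩
  · ext w
    obtain ⟨v, hv⟩ := hQ1 w
    simp only [LinearMap.comp_apply]
    rw [key w v hv, key (σ g w) (ρ g v) (by rw [hf', hv, hQ3']), map_sub, hP3']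
  · ext v
    simp only [LinearMap.comp_apply]
    rw [key (f v) v (hQ2 _ ⟨v, rfl⟩).symm, map_sub, LinearMap.mem_ker.1 (hP1 v), sub_zero]

lemma trace_idem_nat (E : Module.End ℂ V) (hE : E * E = E) :
    ∃ n : ℕ, LinearMap.trace ℂ V E = n ∧ (n = 0 → E = 0) := by
  have : LinearMap.IsProj (LinearMap.range E) E :=
    ⟨fun x => ⟨x, rfl⟩, by rintro _ ⟨x, rfl⟩; exact LinearMap.congr_fun hE x⟩
  refine ⟨_, this.trace, fun h => ?_⟩
  rw [Submodule.finrank_eq_zero] at h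
  exact LinearMap.range_eq_bot.1 h

lemma exists_intertwiner (h : ip σ.character ρ.character ≠ 0) :
    ∃ f : V →ₗ[ℂ] W, f ≠ 0 ∧ ∀ g, f ∘ₗ ρ g = σ g ∘ₗ f := by
  rw [ip_char] at h
  have h' : Module.finrank ℂ (ρ.IntertwiningMap σ) ≠ 0 := by exact_mod_cast h
  have : Nontrivial (ρ.IntertwiningMap σ) := Module.nontrivial_of_finrank_pos (R := ℂ) (Nat.pos_of_ne_zero h')
  obtain ⟨f, hf⟩ := exists_ne (0 : ρ.IntertwiningMap σ)
  refine ⟨f.toLinearMap, fun h0 => hf ?_, fun g => ?_⟩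
  · apply Representation.IntertwiningMap.ext; rw [h0]; rfl
  · ext x; exact Representation.IntertwiningMap.isIntertwining _ _ f g x

lemma scalar_of_norm_one (h : ip ρ.character ρ.character = 1) (f : V →ₗ[ℂ] V)
    (hf : ∀ g, f ∘ₗ ρ g = ρ g ∘ₗ f) : ∃ c : ℂ, f = c • LinearMap.id := by
  rw [ip_char] at h
  have h' : Module.finrank ℂ (ρ.IntertwiningMap ρ) = 1 := by exact_mod_cast h
  have hV : Nontrivial V := by
    by_contra hV
    rw [not_nontrivial_iff_subsingleton] at hV
    have : Subsingleton (ρ.IntertwiningMap ρ) := ⟨fun a b => by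
      apply Representation.IntertwiningMap.ext
      ext x; exact Subsingleton.elim _ _⟩
    rw [Module.finrank_zero_of_subsingleton] at h'
    omega
  have hne : Representation.IntertwiningMap.id ρ ≠ 0 := fun h0 => by
    obtain ⟨x, hx⟩ := exists_ne (0 : V)
    apply hx
    have := congrArg (fun F : ρ.IntertwiningMap ρ => F x) h0
    simpa using this
  obtain ⟨c, hc⟩ := (finrank_eq_one_iff_of_nonzero' _ hne).1 h' ⟨f, hf⟩
  refine ⟨c, ?_⟩
  ext x
  have := congrArg (fun F : ρ.IntertwiningMap ρ => F x) hc
  simpa using this.symm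

lemma norm_one_of_idem [Nontrivial V]
    (h : ∀ T : Module.End ℂ V, T * T = T → (∀ g, ρ g * T = T * ρ g) → T = 0 ∨ T = 1) :
    ip ρ.character ρ.character = 1 := by
  rw [ip_char]
  have hne : Representation.IntertwiningMap.id ρ ≠ 0 := fun h0 => by
    obtain ⟨x, hx⟩ := exists_ne (0 : V)
    apply hx
    have := congrArg (fun F : ρ.IntertwiningMap ρ => F x) h0
    simpa using this
  have : Module.finrank ℂ (ρ.IntertwiningMap ρ) = 1 := by
    rw [finrank_eq_one_iff_of_nonzero' _ hne]
    intro f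
    obtain ⟨c, hc⟩ := Module.End.exists_eigenvalue (K := ℂ) f.toLinearMap
    obtain ⟨E, h1, h2, h3, h4⟩ := exists_proj ρ (Module.End.eigenspace f.toLinearMap c) (by
      intro g x hx
      rw [Module.End.mem_eigenspace_iff] at hx ⊢
      have := Representation.IntertwiningMap.isIntertwining _ _ f g x
      change f.toLinearMap (ρ g x) = ρ g (f.toLinearMap x) at this
      rw [this, hx, map_smul])
    obtain hE | hE := h E h4 h3
    · exfalso
      obtain ⟨x, hx, hx0⟩ := hc.exists_hasEigenvector
      apply hx0
      rw [← h2 x hx, hE]; rfl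
    · refine ⟨c, ?_⟩
      apply Representation.IntertwiningMap.ext
      ext x
      have := h1 x
      rw [hE, Module.End.mem_eigenspace_iff] at this
      exact this.symm
  rw [this]; simp

end Two

section Chars

variable {G : Type} [Group G] [Fintype G]

/-- distinct irreducible characters are orthogonal. -/
lemma ip_eq_zero {χ ψ : G → ℂ} (h : IsChar χ) (h' : IsChar ψ) (h1 : ip χ χ = 1)
    (h1' : ip ψ ψ = 1) (hne : χ ≠ ψ) : ip χ ψ = 0 := by
  by_contra hcon
  apply hne
  obtain ⟨V, _, _, _, ρ, rfl⟩ := h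
  obtain ⟨W, _, _, _, σ, rfl⟩ := h'
  obtain ⟨f, hf0, hf⟩ := exists_intertwiner σ ρ hcon
  obtain ⟨h, hh, hfhf⟩ := exists_reg_inv σ ρ f hf
  obtain ⟨c, hc⟩ := scalar_of_norm_one ρ h1 (f ∘ₗ h) (fun g => by
    rw [LinearMap.comp_assoc, hh, ← LinearMap.comp_assoc, hf, LinearMap.comp_assoc])
  obtain ⟨d, hd⟩ := scalar_of_norm_one σ h1' (h ∘ₗ f) (fun g => by
    rw [LinearMap.comp_assoc, hf, ← LinearMap.comp_assoc, hh, LinearMap.comp_assoc])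
  have hc1 : c = 1 := by
    rw [← LinearMap.comp_assoc, hc] at hfhf
    have : (c - 1) • f = 0 := by
      rw [sub_smul, one_smul, sub_eq_zero]; simpa [LinearMap.smul_comp, LinearMap.comp_smul] using hfhf
    rcases smul_eq_zero.1 this with h | h
    · exact sub_eq_zero.1 h
    · exact absurd h hf0
  have hd1 : d = 1 := by
    rw [hd] at hfhf
    have : (d - 1) • f = 0 := by
      rw [sub_smul, one_smul, sub_eq_zero]; simpa [LinearMap.smul_comp, LinearMap.comp_smul] using hfhf
    rcases smul_eq_zero.1 this with h | h
    · exact sub_eq_zero.1 h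
    · exact absurd h hf0
  rw [hc1, one_smul] at hc
  rw [hd1, one_smul] at hd
  funext g
  unfold Representation.character
  have e1 : ρ g = (ρ g ∘ₗ f) ∘ₗ h := by rw [LinearMap.comp_assoc, hc]; rfl
  have e2 : σ g = h ∘ₗ (ρ g ∘ₗ f) := by rw [← hf, ← LinearMap.comp_assoc, hd]; rfl
  rw [e1, e2, LinearMap.trace_comp_comm']

lemma isChar_zero_of_norm {χ : G → ℂ} (h : IsChar χ) (h0 : ip χ χ = 0) : χ = 0 := by
  obtain ⟨V, _, _, _, ρ, rfl⟩ := h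
  have hV : Subsingleton V := by
    rw [ip_char] at h0
    have h' : Module.finrank ℂ (ρ.IntertwiningMap ρ) = 0 := by exact_mod_cast h0
    by_contra hV
    rw [not_subsingleton_iff_nontrivial] at hV
    obtain ⟨x, hx⟩ := exists_ne (0 : V)
    have hs := Module.finrank_zero_iff.1 h'
    have := congrArg (fun F : ρ.IntertwiningMap ρ => F x)
      (hs.elim (Representation.IntertwiningMap.id ρ) 0)
    apply hx
    simpa using this
  funext g
  have : ρ g = 0 := by ext x; exact Subsingleton.elim _ _
  simp [Representation.character, this]

/-- A virtual character of norm one and positive degree is a character. -/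
lemma isChar_sub (n : ℕ) : ∀ {χ ψ : G → ℂ}, χ 1 = n → IsChar χ → IsChar ψ → (ip (χ - ψ) (χ - ψ) = 1) →
    (∃ m : ℕ, 0 < m ∧ (χ - ψ) 1 = m) → IsChar (χ - ψ) := by
  induction n using Nat.strong_induction_on with
  | _ n ih =>
  intro χ ψ hn hχ hψ h1 hm
  by_cases h0 : ip χ ψ = 0
  · have e : ip (χ - ψ) (χ - ψ) = ip χ χ + ip ψ ψ := by
      rw [ip_sub_left, ip_sub_right, ip_sub_right, ip_comm ψ χ, h0]; ring
    obtain ⟨a, ha⟩ := exists_nat_ip hχ hχ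
    obtain ⟨b, hb⟩ := exists_nat_ip hψ hψ
    rw [e, ha, hb] at h1
    have hab : a + b = 1 := by exact_mod_cast h1
    rcases Nat.eq_zero_or_pos b with hb0 | hb0
    · rw [hb0, Nat.cast_zero] at hb
      rw [isChar_zero_of_norm hψ hb, sub_zero]; exact hχ
    · have ha0 : a = 0 := by omega
      rw [ha0, Nat.cast_zero] at ha
      exfalso
      obtain ⟨m, hm, hm'⟩ := hm
      rw [isChar_zero_of_norm hχ ha] at hm'
      obtain ⟨k, hk⟩ := hψ.one_nat
      simp only [Pi.sub_apply, Pi.zero_apply, hk] at hm'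
      have : (k + m : ℂ) = 0 := by rw [← hm']; ring
      have : k + m = 0 := by exact_mod_cast this
      omega
  · obtain ⟨V, _, _, _, ρ, rfl⟩ := hχ
    obtain ⟨W, _, _, _, σ, rfl⟩ := hψ
    obtain ⟨f, hf0, hf⟩ := exists_intertwiner σ ρ h0
    obtain ⟨h, hh, hfhf⟩ := exists_reg_inv σ ρ f hf
    let P : Module.End ℂ V := f ∘ₗ h
    let Q : Module.End ℂ W := h ∘ₗ f
    have hP : P * P = P := by
      change (f ∘ₗ h) ∘ₗ (f ∘ₗ h) = f ∘ₗ h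
      rw [← LinearMap.comp_assoc, LinearMap.comp_assoc f, hfhf]
    have hQ : Q * Q = Q := by
      change (h ∘ₗ f) ∘ₗ (h ∘ₗ f) = h ∘ₗ f
      rw [LinearMap.comp_assoc, hfhf]
    have hPc : ∀ g, ρ g * P = P * ρ g := fun g => by
      change ρ g ∘ₗ (f ∘ₗ h) = (f ∘ₗ h) ∘ₗ ρ g
      rw [← LinearMap.comp_assoc, ← hf, LinearMap.comp_assoc, ← hh, LinearMap.comp_assoc]
    have hQc : ∀ g, σ g * Q = Q * σ g := fun g => by
      change σ g ∘ₗ (h ∘ₗ f) = (h ∘ₗ f) ∘ₗ σ g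
      rw [← LinearMap.comp_assoc, ← hh, LinearMap.comp_assoc, ← hf, LinearMap.comp_assoc]
    have hPQ : ∀ g, LinearMap.trace ℂ V (ρ g * P) = LinearMap.trace ℂ W (σ g * Q) := fun g => by
      change LinearMap.trace ℂ V (ρ g ∘ₗ (f ∘ₗ h)) = LinearMap.trace ℂ W (σ g ∘ₗ (h ∘ₗ f))
      rw [← LinearMap.comp_assoc, LinearMap.trace_comp_comm', ← hf, ← LinearMap.comp_assoc]
      exact congrArg _ (hQc g).symm
    obtain ⟨r, hr, hr0⟩ := trace_idem_nat P hP
    have hrpos : r ≠ 0 := fun h00 => hf0 (by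
      have : f ∘ₗ h = 0 := hr0 h00
      rw [← hfhf, ← LinearMap.comp_assoc, this, LinearMap.zero_comp])
    have k1 := isChar_cut ρ (1 - P) (by simp [mul_sub, sub_mul, hP])
      (fun g => by simp [mul_sub, sub_mul, hPc])
    have k2 := isChar_cut σ (1 - Q) (by simp [mul_sub, sub_mul, hQ])
      (fun g => by simp [mul_sub, sub_mul, hQc])
    have e : ρ.character - σ.character =
        (fun g => LinearMap.trace ℂ V (ρ g * (1 - P))) -
          (fun g => LinearMap.trace ℂ W (σ g * (1 - Q))) := by
      funext g
      simp only [Pi.sub_apply, mul_sub, mul_one, map_sub, hPQ, Representation.character]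
      ring
    have e1 : LinearMap.trace ℂ V (ρ 1 * (1 - P)) + r = n := by
      rw [← hn, map_one, one_mul, map_sub, hr, ← map_one ρ]
      simp [Representation.character]
    obtain ⟨k, hk⟩ := k1.one_nat
    have hk' : k + r = n := by
      have : (k + r : ℂ) = n := by rw [← e1, ← hk]
      exact_mod_cast this
    rw [e]
    refine ih k (by omega) hk k1 k2 (by rw [← e]; exact h1) (by rw [← e]; exact hm)

end Chars

end RC

end


section
set_option linter.unusedSectionVars false
namespace RC

open Finset

section Conv

variable {N : Type} [Group N] [Fintype N]

open Classical in
lemma conv_irr {a b : N → ℂ} (ha : IsChar a) (hb : IsChar b) (ha1 : ip a a = 1)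
    (hb1 : ip b b = 1) (hd : b 1 ≠ 0) (u : N) :
    ∑ s, a s⁻¹ * b (s * u) = if a = b then (Nat.card N : ℂ) / b 1 * b u else 0 := by
  have hab : ip b a = if a = b then 1 else 0 := by
    split_ifs with h
    · rw [h, hb1]
    · rw [ip_comm]; exact ip_eq_zero ha hb ha1 hb1 h
  obtain ⟨V, _, _, _, ρ, rfl⟩ := hb
  let A : Module.End ℂ V := ∑ s, a s⁻¹ • ρ s
  obtain ⟨c, hc⟩ := scalar_of_norm_one ρ hb1 A (fun g => by
    change A * ρ g = ρ g * A
    simp only [A, sum_mul, mul_sum, smul_mul_assoc, mul_smul_comm, ← map_mul]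
    rw [← Function.Bijective.sum_comp (MulAut.conj g).bijective]
    refine sum_congr rfl fun s _ => ?_
    simp only [MulAut.conj_apply, inv_mul_cancel_right]
    rw [show (g * s * g⁻¹)⁻¹ = g * s⁻¹ * g⁻¹ by group, ha.conj])
  have key : ∀ u, ∑ s, a s⁻¹ * ρ.character (s * u) = c * ρ.character u := fun u => by
    have : LinearMap.trace ℂ V (A * ρ u) = c * ρ.character u := by
      rw [hc, smul_mul_assoc, ← Module.End.one_eq_id, one_mul, map_smul]; rfl
    rw [← this]
    simp only [A, sum_mul, map_sum, smul_mul_assoc, map_smul, ← map_mul, smul_eq_mul,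
      Representation.character]
  have k1 := key 1
  have k2 : ∑ s, a s⁻¹ * ρ.character (s * 1) = Nat.card N * ip ρ.character a := by
    rw [ip, mul_inv_cancel_left₀ card_ne]
    simp [mul_comm]
  rw [k2, hab] at k1
  rw [key u]
  have : c = (Nat.card N * if a = ρ.character then 1 else 0) / ρ.character 1 := by
    rw [k1]; field_simp
  rw [this]
  split_ifs <;> ring

/-- If `e` is a multiple of an idempotent of the group algebra then the corresponding
induced function is a character. -/
lemma isChar_ind (e : N → ℂ) (c : ℂ) (hc : c ≠ 0)
    (he : ∀ g, ∑ k, e k * e (k⁻¹ * g) = c * e g) :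
    IsChar (fun g => c⁻¹ * ∑ s, e (s⁻¹ * g * s)) := by
  classical
  let ρ : Representation ℂ N (N → ℂ) :=
    { toFun := fun g => LinearMap.funLeft ℂ ℂ (fun h => g⁻¹ * h)
      map_one' := by ext; simp [LinearMap.funLeft]
      map_mul' := fun g h => by
        apply LinearMap.ext; intro f; funext x
        simp [LinearMap.funLeft, mul_assoc] }
  have hρ : ∀ g f x, ρ g f x = f (g⁻¹ * x) := fun g f x => rfl
  let E : Module.End ℂ (N → ℂ) := c⁻¹ • ∑ k, e k • LinearMap.funLeft ℂ ℂ (fun h => h * k)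
  have hE : ∀ f x, E f x = c⁻¹ * ∑ k, e k * f (x * k) := fun f x => by
    simp [E, LinearMap.funLeft, LinearMap.sum_apply]
  have h1 : E * E = E := by
    apply LinearMap.ext; intro f; funext x
    simp only [Module.End.mul_apply, hE]
    have : ∀ g, e g = c⁻¹ * ∑ k, e k * e (k⁻¹ * g) := fun g => by rw [he]; field_simp
    congr 1
    conv_rhs => rw [sum_congr rfl fun g _ => by rw [this g]]
    simp only [mul_sum, sum_mul]
    conv_rhs => rw [sum_comm]
    refine sum_congr rfl fun k _ => ?_
    conv_rhs => rw [← Equiv.sum_comp (Equiv.mulLeft k)]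
    refine sum_congr rfl fun l _ => ?_
    simp only [Equiv.coe_mulLeft, inv_mul_cancel_left, mul_assoc]
    ring
  have h2 : ∀ g, ρ g * E = E * ρ g := fun g => by
    apply LinearMap.ext; intro f; funext x
    simp only [Module.End.mul_apply, hE, hρ, mul_assoc]
  convert isChar_cut ρ E h1 h2 using 2 with g
  rw [LinearMap.trace_eq_matrix_trace ℂ (Pi.basisFun ℂ N)]
  simp only [Matrix.trace, Matrix.diag, LinearMap.toMatrix_apply, Pi.basisFun_repr,
    Module.End.mul_apply, hρ, hE, Pi.basisFun_apply]
  rw [mul_sum]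
  refine sum_congr rfl fun s _ => ?_
  congr 1
  rw [sum_eq_single (s⁻¹ * g * s)]
  · simp [mul_assoc]
  · intro b _ hb
    rw [Pi.single_apply, if_neg, mul_zero]
    intro h
    apply hb
    have := congrArg (fun z => s⁻¹ * g * z) h
    simpa [mul_assoc] using this
  · simp

end Conv

section LemmaA

variable {N G : Type} [Group N] [Fintype N] [Group G] [Fintype G]

open Classical in
theorem lemmaA (ι : N →* G) (α : G →* MulAut N) (hα : ∀ g s, ι (α g s) = g * ι s * g⁻¹)
    (Θ : N → ℂ) (hΘ : IsChar Θ) (hΘ1 : ip Θ Θ = 1) (d : ℕ) (hd : 0 < d) (hd' : Θ 1 = d)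
    (χV : G → ℂ) (hV : IsChar χV) (hVq : ∀ g, ∃ q : ℚ, χV g = q)
    (hmult : ip (fun s => χV (ι s)) Θ = 1)
    (hrat : ∀ s, ∃ q : ℚ, ∑ g, Θ (α g s) = q) :
    ∃ χ : G → ℂ, IsChar χ ∧ ip χ χ = 1 ∧ (∀ g, ∃ q : ℚ, χ g = q) ∧
      χ 1 = d * (univ.image (fun g : G => fun s => Θ (α g s))).card := by
  obtain ⟨V, _, _, _, τ, rfl⟩ := hV
  set O : Finset (N → ℂ) := univ.image (fun g : G => fun s => Θ (α g s)) with hO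
  have hOc : ∀ a ∈ O, IsChar a := fun a ha => by
    obtain ⟨g, -, rfl⟩ := mem_image.1 ha
    exact hΘ.comp (α g).toMonoidHom
  have hO1 : ∀ a ∈ O, ip a a = 1 := fun a ha => by
    obtain ⟨g, -, rfl⟩ := mem_image.1 ha
    rw [← hΘ1]
    unfold ip
    congr 1
    rw [← Function.Bijective.sum_comp (α g).bijective (fun s => Θ s * Θ s⁻¹)]
    simp
  have hOd : ∀ a ∈ O, a 1 = d := fun a ha => by
    obtain ⟨g, -, rfl⟩ := mem_image.1 ha
    simp [hd']
  have hdc : (d : ℂ) ≠ 0 := by exact_mod_cast hd.ne'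
  have hNc : (Nat.card N : ℂ) ≠ 0 := card_ne
  have hGc : (Nat.card G : ℂ) ≠ 0 := card_ne
  have hOstab : ∀ g, ∀ a ∈ O, (fun s => a (α g s)) ∈ O := fun g a ha => by
    obtain ⟨h, -, rfl⟩ := mem_image.1 ha
    refine mem_image.2 ⟨h * g, mem_univ _, ?_⟩
    funext s; simp
  have hΘO : Θ ∈ O := mem_image.2 ⟨1, mem_univ _, by funext s; simp⟩
  -- rationality of the sum over the orbit
  have hOrat : ∀ s, ∃ q : ℚ, ∑ a ∈ O, a s = q := fun s => by
    obtain ⟨q, hq⟩ := hrat s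
    have h1 := Finset.sum_comp (s := (univ : Finset G)) (fun a : N → ℂ => a s)
      (fun g : G => fun s => Θ (α g s))
    rw [hq] at h1
    have h2 : ∀ a ∈ O, #{g ∈ (univ : Finset G) | (fun s => Θ (α g s)) = a} =
        #{g ∈ (univ : Finset G) | (fun s => Θ (α g s)) = Θ} := fun a ha => by
      obtain ⟨h, -, rfl⟩ := mem_image.1 ha
      apply card_bij' (fun g _ => g * h⁻¹) (fun g _ => g * h)
      · intro g hg
        rw [mem_filter] at hg ⊢
        refine ⟨mem_univ _, ?_⟩
        funext s
        have := congrFun hg.2 (α h⁻¹ s)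
        simpa using this
      · intro g hg
        rw [mem_filter] at hg ⊢
        refine ⟨mem_univ _, ?_⟩
        funext s
        have := congrFun hg.2 (α h s)
        simpa using this
      · intro g _; simp
      · intro g _; simp
    rw [sum_congr rfl fun a ha => by rw [h2 a ha]] at h1
    set c := #{g ∈ (univ : Finset G) | (fun s => Θ (α g s)) = Θ} with hc
    have hc0 : c ≠ 0 := by
      rw [hc, ← Nat.pos_iff_ne_zero, card_pos]
      exact ⟨1, by simp⟩
    rw [← smul_sum, nsmul_eq_mul] at h1
    refine ⟨q / c, ?_⟩
    push_cast
    rw [h1]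
    have : (c : ℂ) ≠ 0 := by exact_mod_cast hc0
    field_simp
    rfl
  -- idempotents
  let e : (N → ℂ) → Module.End ℂ V := fun a => ((d : ℂ) / Nat.card N) • ∑ s, a s⁻¹ • τ (ι s)
  have hee : ∀ a ∈ O, ∀ b ∈ O, e a * e b = if a = b then e b else 0 := fun a ha b hb => by
    have hcv := conv_irr (hOc a ha) (hOc b hb) (hO1 a ha) (hO1 b hb) (by rw [hOd b hb]; exact hdc)
    have h0 : e a * e b = ((d : ℂ) / Nat.card N * (d / Nat.card N)) •
        ∑ s : N, ∑ t : N, (a s⁻¹ * b t⁻¹) • τ (ι (s * t)) := by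
      simp only [e]
      rw [smul_mul_smul_comm, Finset.sum_mul_sum]
      simp only [smul_mul_smul_comm, ← map_mul]
    have : ∑ s : N, ∑ t : N, (a s⁻¹ * b t⁻¹) • τ (ι (s * t)) =
        ∑ u, (∑ s, a s⁻¹ * b (s * u⁻¹)) • τ (ι u) := by
      simp only [sum_smul]
      conv_rhs => rw [sum_comm]
      refine sum_congr rfl fun s _ => ?_
      rw [← Equiv.sum_comp (Equiv.mulLeft s) (fun u => (a s⁻¹ * b (s * u⁻¹)) • τ (ι u))]
      refine sum_congr rfl fun t _ => ?_
      simp only [Equiv.coe_mulLeft, mul_inv_rev]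
      rw [← mul_assoc s t⁻¹, (hOc b hb).conj]
    rw [h0, this]
    simp only [e, hcv, hOd b hb]
    split_ifs with hab
    · simp only [smul_sum, smul_smul]
      refine sum_congr rfl fun u _ => ?_
      congr 1
      field_simp
    · simp
  have htr : ∀ a, ∀ X : Module.End ℂ V, LinearMap.trace ℂ V (e a * X) =
      d * ip (fun s => LinearMap.trace ℂ V (τ (ι s) * X)) a := fun a X => by
    simp only [e, smul_mul_assoc, map_smul, sum_mul, map_sum, ip, smul_eq_mul, mul_sum]
    refine sum_congr rfl fun s _ => ?_
    ring
  -- invariance of multiplicities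
  have hinv : ∀ X : Module.End ℂ V, (∀ g, τ g * X = X * τ g) → ∀ a ∈ O,
      ip (fun s => LinearMap.trace ℂ V (τ (ι s) * X)) a =
      ip (fun s => LinearMap.trace ℂ V (τ (ι s) * X)) Θ := fun X hX a ha => by
    obtain ⟨g, -, rfl⟩ := mem_image.1 ha
    unfold ip
    congr 1
    rw [← Function.Bijective.sum_comp (α g).bijective
      (fun s => LinearMap.trace ℂ V (τ (ι s) * X) * Θ s⁻¹)]
    refine sum_congr rfl fun s _ => ?_
    simp only [map_inv]
    congr 1
    have h5 : τ (ι (α g s)) * X = τ g * (τ (ι s) * X * τ g⁻¹) := by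
      rw [hα, map_mul τ, map_mul τ, mul_assoc, hX]
      simp only [mul_assoc]
    rw [h5, LinearMap.trace_mul_comm ℂ (τ g), mul_assoc _ (τ g⁻¹), ← map_mul τ, inv_mul_cancel, map_one, mul_one]
  let E : Module.End ℂ V := ∑ a ∈ O, e a
  have heE : ∀ a ∈ O, e a * E = e a := fun a ha => by
    simp only [E, mul_sum]
    rw [sum_congr rfl fun b hb => hee a ha b hb]
    simp [ha]
  have hE : E * E = E := by
    conv_lhs => enter [1]; rw [show E = ∑ a ∈ O, e a from rfl]
    rw [sum_mul, sum_congr rfl fun a ha => heE a ha]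
  have hconj : ∀ g a, τ g * e a = e (fun s => a (α g⁻¹ s)) * τ g := fun g a => by
    simp only [e, mul_smul_comm, smul_mul_assoc, mul_sum, sum_mul]
    congr 1
    rw [← Function.Bijective.sum_comp (α g).bijective (fun s => a (α g⁻¹ s⁻¹) • (τ (ι s) * τ g))]
    refine sum_congr rfl fun s _ => ?_
    simp only [← map_inv (α g) s, hα, ← map_mul τ]
    congr 2
    · simp
    · simp
  have hEc : ∀ g, τ g * E = E * τ g := fun g => by
    simp only [E, mul_sum, sum_mul, hconj]
    refine sum_bij' (fun a _ => fun s => a (α g⁻¹ s)) (fun a _ => fun s => a (α g s))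
      (fun a ha => hOstab _ a ha) (fun a ha => hOstab _ a ha) ?_ ?_ ?_
    · intro a _; funext s; simp
    · intro a _; funext s; simp
    · intro a _; rfl
  have heXc : ∀ X : Module.End ℂ V, (∀ g, τ g * X = X * τ g) → ∀ a, e a * X = X * e a := by
    intro X hX a
    simp only [e, smul_mul_assoc, mul_smul_comm, sum_mul, mul_sum, hX]
  have hkill : ∀ X : Module.End ℂ V, X * X = X → (∀ g, τ g * X = X * τ g) →
      ip (fun s => LinearMap.trace ℂ V (τ (ι s) * X)) Θ = 0 → E * X = 0 := by
    intro X hXX hX h0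
    simp only [E, sum_mul]
    refine sum_eq_zero fun a ha => ?_
    obtain ⟨n, hn, hn0⟩ := trace_idem_nat (e a * X) (by
      rw [mul_assoc, ← mul_assoc X, ← heXc X hX, mul_assoc, hXX, ← mul_assoc, hee a ha a ha,
        if_pos rfl])
    apply hn0
    rw [htr, hinv X hX a ha, h0, mul_zero] at hn
    exact_mod_cast hn.symm
  have hip1 : ip (fun s => LinearMap.trace ℂ V (τ (ι s) * 1)) Θ = 1 := by
    simpa [Representation.character] using hmult
  have hipnat : ∀ X : Module.End ℂ V, X * X = X → (∀ g, τ g * X = X * τ g) →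
      ∃ n : ℕ, ip (fun s => LinearMap.trace ℂ V (τ (ι s) * X)) Θ = n := fun X hXX hX =>
    exists_nat_ip (isChar_cut (τ.comp ι) X hXX (fun s => hX (ι s))) hΘ
  have hdich : ∀ X : Module.End ℂ V, X * X = X → (∀ g, τ g * X = X * τ g) →
      E * X = 0 ∨ E * X = E := by
    intro X hXX hX
    have hY : (1 - X) * (1 - X) = 1 - X := by simp [mul_sub, sub_mul, hXX]
    have hYc : ∀ g, τ g * (1 - X) = (1 - X) * τ g := fun g => by simp [mul_sub, sub_mul, hX]
    obtain ⟨m, hm⟩ := hipnat X hXX hX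
    obtain ⟨k, hk⟩ := hipnat _ hY hYc
    have : (m + k : ℂ) = 1 := by
      rw [← hm, ← hk, ← hip1, ← ip_add_left]
      congr 1
      funext s
      simp [mul_sub]
    have hmk : m + k = 1 := by exact_mod_cast this
    rcases Nat.eq_zero_or_pos m with h0 | h0
    · left; apply hkill X hXX hX; rw [hm, h0]; simp
    · right
      have : k = 0 := by omega
      have h := hkill _ hY hYc (by rw [hk, this]; simp)
      rw [mul_sub, mul_one, sub_eq_zero] at h
      exact h.symm
  have htrE : LinearMap.trace ℂ V E = d * O.card := by
    simp only [E, map_sum]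
    rw [sum_congr rfl fun a ha => by
      rw [← mul_one (e a), htr, hinv 1 (by simp) a ha, hip1, mul_one]]
    simp [mul_comm]
  have hE0 : E ≠ 0 := fun h => by
    rw [h, map_zero] at htrE
    have h1 : (O.card : ℂ) ≠ 0 := by
      have : 0 < O.card := card_pos.2 ⟨_, hΘO⟩
      exact_mod_cast this.ne'
    exact mul_ne_zero hdc h1 htrE.symm
  refine ⟨(cut τ E hEc).character, ⟨_, _, _, inferInstance, cut τ E hEc, rfl⟩, ?_, ?_, ?_⟩
  · have : Nontrivial (LinearMap.range E) := by
      rw [Submodule.nontrivial_iff_ne_bot]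
      intro h
      exact hE0 (LinearMap.range_eq_bot.1 h)
    apply norm_one_of_idem
    intro T hT hTc
    have hEr : ∀ x : LinearMap.range E, E x = x := by
      rintro ⟨_, y, rfl⟩; exact LinearMap.congr_fun hE y
    let X : Module.End ℂ V := (LinearMap.range E).subtype ∘ₗ T ∘ₗ E.rangeRestrict
    have hXa : ∀ x, X x = T ⟨E x, x, rfl⟩ := fun x => rfl
    have hXr : ∀ x : LinearMap.range E, X x = T x := fun x => by
      rw [hXa]; congr 2; exact Subtype.ext (hEr x)
    have hXX : X * X = X := by
      ext x
      rw [Module.End.mul_apply, hXa x, hXr]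
      exact congrArg Subtype.val (LinearMap.congr_fun hT _)
    have hXc : ∀ g, τ g * X = X * τ g := fun g => by
      ext x
      simp only [Module.End.mul_apply]
      rw [hXa, hXa]
      have := congrArg Subtype.val (LinearMap.congr_fun (hTc g) ⟨E x, x, rfl⟩)
      simp only [Module.End.mul_apply, cut_apply] at this
      rw [this]
      congr 2
      apply Subtype.ext
      rw [cut_apply]
      exact LinearMap.congr_fun (hEc g) x
    have hEX : E * X = X := by
      ext x
      rw [Module.End.mul_apply, hXa, hEr]
    rcases hdich X hXX hXc with h | h
    · left
      ext x
      rw [hEX] at h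
      rw [← hXr, h]; rfl
    · right
      ext x
      rw [hEX] at h
      rw [← hXr, h, hEr]; rfl
  · intro g
    rw [cut_character τ E hE hEc]
    have : LinearMap.trace ℂ V (τ g * E) =
        ((d : ℂ) / Nat.card N) * ∑ s, (∑ a ∈ O, a s⁻¹) * τ.character (g * ι s) := by
      simp only [E, e, mul_sum, map_sum, mul_smul_comm, map_smul, smul_eq_mul, sum_mul,
        Representation.character, map_mul]
      rw [sum_comm]
    rw [this]
    choose q1 hq1 using hOrat
    choose q2 hq2 using hVq
    refine ⟨((d : ℚ) / Nat.card N) * ∑ s, q1 s⁻¹ * q2 (g * ι s), ?_⟩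
    push_cast
    simp only [hq1, hq2]
  · rw [cut_character τ E hE hEc, map_one, one_mul, htrE]

end LemmaA

section Prod

variable {S : Type} [Group S] [Fintype S] {n : ℕ}

lemma isChar_pi (χ : Fin n → S → ℂ) (h : ∀ k, IsChar (χ k)) :
    IsChar (fun s : Fin n → S => ∏ k, χ k (s k)) := by
  have := IsChar.prod univ (χ := fun k => fun s : Fin n → S => χ k (s k))
    (fun k => (h k).comp (Pi.evalMonoidHom (fun _ : Fin n => S) k))
  convert this using 1
  funext s
  simp

lemma ip_pi (χ ψ : Fin n → S → ℂ) :
    ip (fun s : Fin n → S => ∏ k, χ k (s k)) (fun s : Fin n → S => ∏ k, ψ k (s k)) =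
      ∏ k, ip (χ k) (ψ k) := by
  simp only [ip, prod_mul_distrib, ← prod_mul_distrib, Finset.prod_univ_sum, Pi.inv_apply,
    Fintype.piFinset_univ]
  rw [prod_mul_distrib]
  congr 1
  · simp [Nat.card_pi]
  · rw [Finset.prod_univ_sum]; simp

end Prod

section Final

open CategoryTheory

lemma fdrep_of {G : Type} [Group G] [Fintype G] (χ : G → ℂ) (h : IsChar χ) (h1 : ip χ χ = 1)
    (hq : ∀ g, ∃ q : ℚ, χ g = q) (m : ℕ) (hm : χ 1 = m) (hev : Even m) :
    ∃ V : FDRep ℂ G, Simple V ∧ (∀ g : G, ∃ q : ℚ, V.character g = (q : ℂ)) ∧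
      Even (Module.finrank ℂ V) := by
  obtain ⟨V, _, _, _, ρ, rfl⟩ := h
  have hc : (FDRep.of ρ).character = ρ.character := rfl
  refine ⟨FDRep.of ρ, ?_, fun g => ?_, ?_⟩
  · rw [FDRep.simple_iff_char_is_norm_one, hc]
    rw [ip, inv_mul_eq_one₀ card_ne] at h1
    exact h1.symm
  · rw [hc]; exact hq g
  · have := FDRep.char_one (FDRep.of ρ)
    rw [hc, hm] at this
    have h2 : m = Module.finrank ℂ (FDRep.of ρ) := by exact_mod_cast this
    rw [← h2]; exact hev

lemma ip_comp_surj {G H : Type} [Group G] [Fintype G] [Group H] [Fintype H] (f : G →* H)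
    (hf : Function.Surjective f) (χ ψ : H → ℂ) :
    ip (fun g => χ (f g)) (fun g => ψ (f g)) = ip χ ψ := by
  classical
  unfold ip
  have hfib : ∀ h : H, #{g : G | f g = h} = Nat.card f.ker := fun h => by
    obtain ⟨g0, rfl⟩ := hf h
    rw [← Fintype.card_subtype, ← Nat.card_eq_fintype_card]
    refine Nat.card_congr ⟨fun g => ⟨g0⁻¹ * g.1, ?_⟩, fun k => ⟨g0 * k.1, ?_⟩, ?_, ?_⟩
    · rw [MonoidHom.mem_ker, map_mul, g.2, map_inv, inv_mul_cancel]
    · have := k.2; rw [MonoidHom.mem_ker] at this; rw [map_mul, this, mul_one]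
    · intro g; simp
    · intro k; simp
  have h1 : ∑ g : G, χ (f g) * ψ (f g⁻¹) = Nat.card f.ker * ∑ h, χ h * ψ h⁻¹ := by
    have := Finset.sum_comp (s := (univ : Finset G)) (fun h : H => χ h * ψ h⁻¹) f
    simp only [← map_inv] at this ⊢
    rw [this, image_univ_of_surjective hf, mul_sum]
    refine sum_congr rfl fun h _ => ?_
    rw [hfib]; simp
  have h2 : (Nat.card G : ℂ) = Nat.card H * Nat.card f.ker := by
    rw [← Nat.cast_mul, ← Nat.card_congr (QuotientGroup.quotientKerEquivOfSurjective f hf).toEquiv,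
      ← Subgroup.card_eq_card_quotient_mul_card_subgroup]
  have h3 : (Nat.card f.ker : ℂ) ≠ 0 := by
    have : 0 < Nat.card f.ker := Nat.card_pos
    exact_mod_cast this.ne'
  rw [h1, h2, mul_inv, mul_assoc, inv_mul_cancel_left₀ h3]

end Final

end RC

end


section
set_option linter.unusedSectionVars false
namespace RC

open Finset

section Dec

variable {S : Type} [Group S] [Finite S] [IsSimpleGroup S] {n : ℕ}

lemma pi_aut (hna : ∃ a b : S, a * b ≠ b * a) (φ : MulAut (Fin n → S)) :
    ∃ (π : Equiv.Perm (Fin n)) (a : Fin n → MulAut S), ∀ s j, φ s j = a j (s (π j)) := by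
  classical
  -- component homomorphisms
  let h : Fin n → Fin n → S →* S := fun j k =>
    ((Pi.evalMonoidHom (fun _ : Fin n => S) j).comp φ.toMonoidHom).comp
      (MonoidHom.mulSingle (fun _ : Fin n => S) k)
  have hh : ∀ j k s, h j k s = φ (Pi.mulSingle k s) j := fun j k s => rfl
  have hcen : ∀ c : S, (∀ s, c * s = s * c) → c = 1 := by
    intro c hc
    have hc' : c ∈ Subgroup.center S := Subgroup.mem_center_iff.2 fun g => (hc g).symm
    rcases (inferInstance : (Subgroup.center S).Normal).eq_bot_or_eq_top with h | h
    · rw [h] at hc'; exact Subgroup.mem_bot.1 hc'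
    · obtain ⟨a, b, hab⟩ := hna
      exact absurd ((Subgroup.mem_center_iff.1 (h ▸ Subgroup.mem_top b : b ∈ Subgroup.center S)) a)
        hab
  have hrange : ∀ j k, (h j k).range = ⊥ ∨ (h j k).range = ⊤ := by
    intro j k
    apply Subgroup.Normal.eq_bot_or_eq_top
    constructor
    rintro _ ⟨s, rfl⟩ g
    let p : Fin n → S := φ.symm (Pi.mulSingle j g)
    refine ⟨p k * s * (p k)⁻¹, ?_⟩
    have e1 : Pi.mulSingle k (p k * s * (p k)⁻¹) = p * Pi.mulSingle k s * p⁻¹ := by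
      funext i
      by_cases hi : i = k
      · subst hi; simp
      · simp [hi]
    rw [hh, e1, map_mul, map_mul, map_inv]
    simp [p, hh]
  have hex : ∀ j, ∃ k, (h j k).range = ⊤ := by
    intro j
    by_contra hcon
    push Not at hcon
    have hbot : ∀ k s, h j k s = 1 := fun k s => by
      have := (hrange j k).resolve_right (hcon k)
      have h2 : h j k s ∈ (h j k).range := ⟨s, rfl⟩
      rw [this] at h2
      exact Subgroup.mem_bot.1 h2
    let K : Subgroup (Fin n → S) :=
      ((Pi.evalMonoidHom (fun _ : Fin n => S) j).comp φ.toMonoidHom).ker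
    have hK : ∀ p, p ∈ K := fun p =>
      Subgroup.pi_mem_of_mulSingle_mem p fun i => hbot i (p i)
    obtain ⟨a, b, hab⟩ := hna
    have ha : ∀ a : S, a = 1 := fun a => by
      have : φ (φ.symm (Pi.mulSingle j a)) j = 1 := hK (φ.symm (Pi.mulSingle j a))
      simpa using this
    exact hab (by rw [ha a, ha b])
  choose σ hσ using hex
  have hsurj : ∀ j, Function.Surjective (h j (σ j)) := fun j =>
    MonoidHom.range_eq_top.1 (hσ j)
  have hker : ∀ j t, t (σ j) = 1 → φ t j = 1 := by
    intro j t ht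
    apply hcen
    intro s
    obtain ⟨s', rfl⟩ := hsurj j s
    have : t * Pi.mulSingle (σ j) s' = Pi.mulSingle (σ j) s' * t := by
      funext i
      by_cases hi : i = σ j
      · subst hi; simp [ht]
      · simp [hi]
    have := congrFun (congrArg φ this) j
    simpa [hh] using this
  have hform : ∀ s j, φ s j = h j (σ j) (s (σ j)) := by
    intro s j
    have := hker j (s * (Pi.mulSingle (σ j) (s (σ j)))⁻¹) (by simp)
    rw [map_mul, map_inv] at this
    simp only [Pi.mul_apply, Pi.inv_apply] at this
    rw [hh]
    exact mul_inv_eq_one.1 this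
  have hσs : Function.Surjective σ := by
    intro k
    by_contra hcon
    push Not at hcon
    obtain ⟨a, b, hab⟩ := hna
    have ha : ∀ a : S, a = 1 := fun a => by
      have h1 : φ (Pi.mulSingle k a) = 1 := by
        funext j
        rw [hform, Pi.mulSingle_eq_of_ne (hcon j), map_one]; rfl
      have h2 : Pi.mulSingle k a = (1 : Fin n → S) := by
        rw [← map_one φ] at h1; exact φ.injective h1
      have := congrFun h2 k
      simpa using this
    exact hab (by rw [ha a, ha b])
  have hσb : Function.Bijective σ := Finite.surjective_iff_bijective.1 hσs
  exact ⟨Equiv.ofBijective σ hσb, fun j => MulEquiv.ofBijective (h j (σ j))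
    (Finite.surjective_iff_bijective.1 (hsurj j)), fun s j => hform s j⟩

end Dec

end RC

end


section
set_option linter.unusedSectionVars false
namespace RC

open Finset

section Ind

variable {G : Type} [Group G] [Fintype G]

/-- the induced function. -/
noncomputable def ind (c : ℂ) (e : G → ℂ) (g : G) : ℂ := c⁻¹ * ∑ s, e (s⁻¹ * g * s)

lemma ind_conj (c : ℂ) (e : G → ℂ) (s g : G) : ind c e (s * g * s⁻¹) = ind c e g := by
  unfold ind
  congr 1
  rw [← Equiv.sum_comp (Equiv.mulLeft s)]
  refine sum_congr rfl fun t _ => ?_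
  simp [mul_assoc]

lemma ip_ind (c : ℂ) (e χ : G → ℂ) (hχ : ∀ s g, χ (s * g * s⁻¹) = χ g) :
    ip (ind c e) χ = c⁻¹ * ∑ g, e g * χ g⁻¹ := by
  have h : ∀ s : G, ∑ g, e (s⁻¹ * g * s) * χ g⁻¹ = ∑ g, e g * χ g⁻¹ := fun s => by
    rw [← Function.Bijective.sum_comp (MulAut.conj s).bijective]
    refine sum_congr rfl fun g _ => ?_
    rw [MulAut.conj_apply, show s⁻¹ * (s * g * s⁻¹) * s = g by group,
      show (s * g * s⁻¹)⁻¹ = s * g⁻¹ * s⁻¹ by group, hχ]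
  have h2 : ∑ g, ind c e g * χ g⁻¹ = c⁻¹ * ∑ s : G, ∑ g, e (s⁻¹ * g * s) * χ g⁻¹ := by
    rw [sum_comm, mul_sum]
    refine sum_congr rfl fun g _ => ?_
    rw [ind, mul_assoc, sum_mul]
  unfold ip
  rw [h2]
  simp only [h, sum_const, card_univ]
  rw [← Nat.card_eq_fintype_card, nsmul_eq_mul]
  have := card_ne (G := G)
  field_simp

open Classical in
lemma card_filter_mem (K : Subgroup G) : #{g : G | g ∈ K} = Nat.card K := by
  rw [← Fintype.card_subtype, ← Nat.card_eq_fintype_card]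

open Classical in
lemma isChar_ind_sub (K : Subgroup G) (f : G → ℂ) (hf : ∀ a ∈ K, ∀ b ∈ K, f (a * b) = f a * f b) :
    IsChar (ind (Nat.card K) (fun g => if g ∈ K then f g else 0)) := by
  have hc : (Nat.card K : ℂ) ≠ 0 := by
    have : 0 < Nat.card K := Nat.card_pos
    exact_mod_cast this.ne'
  refine isChar_ind (fun g => if g ∈ K then f g else 0) _ hc fun g => ?_
  have : ∀ k, (if k ∈ K then f k else 0) * (if k⁻¹ * g ∈ K then f (k⁻¹ * g) else 0) =
      if k ∈ K then (if g ∈ K then f g else 0) else 0 := by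
    intro k
    by_cases hk : k ∈ K
    · simp only [hk, if_true]
      rw [Subgroup.mul_mem_cancel_left K (K.inv_mem hk)]
      split_ifs with hg
      · rw [← hf _ hk _ (K.mul_mem (K.inv_mem hk) hg), mul_inv_cancel_left]
      · simp
    · simp [hk]
  simp only [this]
  rw [← sum_filter, sum_const, nsmul_eq_mul, card_filter_mem]

open Classical in
/-- permutation character on the cosets of `K`. -/
noncomputable def pc (K : Subgroup G) : G → ℂ := ind (Nat.card K) (fun g => if g ∈ K then 1 else 0)

lemma isChar_pc (K : Subgroup G) : IsChar (pc K) :=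
  isChar_ind_sub K (fun _ => 1) (by simp)

lemma pc_rat (K : Subgroup G) (g : G) : ∃ q : ℚ, pc K g = q := by
  classical
  refine ⟨(Nat.card K : ℚ)⁻¹ * ∑ s, if s⁻¹ * g * s ∈ K then 1 else 0, ?_⟩
  simp only [pc, ind]
  push_cast
  simp only [apply_ite (fun q : ℚ => (q : ℂ)), Rat.cast_one, Rat.cast_zero]

lemma pc_restrict {N : Type} [Group N] [Fintype N] (ι : N →* G) (K0 : Subgroup G)
    (hG : ∀ g, ∃ p, ∃ k ∈ K0, g = ι p * k) (s : N) :
    pc K0 (ι s) = pc (K0.comap ι) s := by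
  classical
  let _ : Fintype K0 := Fintype.ofFinite _
  have hK0 : (Nat.card K0 : ℂ) ≠ 0 := by
    have : 0 < Nat.card K0 := Nat.card_pos
    exact_mod_cast this.ne'
  have hK1 : (Nat.card (K0.comap ι) : ℂ) ≠ 0 := by
    have : 0 < Nat.card (K0.comap ι) := Nat.card_pos
    exact_mod_cast this.ne'
  have hfib : ∀ x : G, #{a : N × K0 | ι a.1 * a.2 = x} = Nat.card (K0.comap ι) := fun x => by
    obtain ⟨p0, k0, hk0, rfl⟩ := hG x
    rw [← Fintype.card_subtype, ← Nat.card_eq_fintype_card]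
    refine Nat.card_congr ⟨fun a => ⟨p0⁻¹ * a.1.1, ?_⟩,
      fun c => ⟨(p0 * c.1, ⟨(ι c.1)⁻¹ * k0, K0.mul_mem (K0.inv_mem c.2) hk0⟩), ?_⟩, ?_, ?_⟩
    · obtain ⟨⟨p, k⟩, h⟩ := a
      rw [Subgroup.mem_comap, map_mul, map_inv]
      have : (ι p0)⁻¹ * ι p = k0 * (k : G)⁻¹ := by
        rw [inv_mul_eq_iff_eq_mul, ← mul_assoc, eq_mul_inv_iff_mul_eq]; exact h
      rw [this]
      exact K0.mul_mem hk0 (K0.inv_mem k.2)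
    · simp [mul_assoc]
    · rintro ⟨⟨p, k⟩, h⟩
      simp only at h
      apply Subtype.ext
      simp only [mul_inv_cancel_left, Prod.mk.injEq, true_and]
      apply Subtype.ext
      simp only [map_mul, map_inv, mul_inv_rev, inv_inv]
      rw [mul_assoc, ← h]; group
    · intro c; simp
  let f : G → ℂ := fun x => if x⁻¹ * ι s * x ∈ K0 then 1 else 0
  have h1 : ∑ a : N × K0, f (ι a.1 * a.2) = Nat.card (K0.comap ι) * ∑ x, f x := by
    rw [Finset.sum_comp f (fun a : N × K0 => ι a.1 * (a.2 : G)), image_univ_of_surjective, mul_sum]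
    · refine sum_congr rfl fun x _ => ?_
      rw [hfib]; simp
    · intro x
      obtain ⟨p, k, hk, rfl⟩ := hG x
      exact ⟨(p, ⟨k, hk⟩), rfl⟩
  have h2 : ∀ a : N × K0, f (ι a.1 * a.2) = if a.1⁻¹ * s * a.1 ∈ K0.comap ι then 1 else 0 := by
    rintro ⟨p, k⟩
    simp only [f]
    have : (ι p * k : G)⁻¹ * ι s * (ι p * k) = (k : G)⁻¹ * ι (p⁻¹ * s * p) * k := by
      simp only [map_mul, map_inv]; group
    rw [this, Subgroup.mem_comap, Subgroup.mul_mem_cancel_right K0 k.2,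
      Subgroup.mul_mem_cancel_left K0 (K0.inv_mem k.2)]
  simp only [h2] at h1
  have h3 : ∀ v : ℂ, ∑ _x : K0, v = Nat.card K0 * v := fun v => by
    rw [sum_const, card_univ, nsmul_eq_mul, ← Nat.card_eq_fintype_card]
  have h4 : ∑ a : N × K0, (if a.1⁻¹ * s * a.1 ∈ K0.comap ι then (1 : ℂ) else 0) =
      Nat.card K0 * ∑ p, if p⁻¹ * s * p ∈ K0.comap ι then (1 : ℂ) else 0 := by
    rw [Fintype.sum_prod_type, mul_sum]
    refine sum_congr rfl fun x _ => ?_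
    rw [← h3]
  rw [h4] at h1
  simp only [pc, ind]
  change (Nat.card K0 : ℂ)⁻¹ * ∑ x, f x = _
  field_simp
  rw [h1, mul_comm]

lemma pc_pi {S : Type} [Group S] [Fintype S] {n : ℕ} (K : Subgroup S) (K1 : Subgroup (Fin n → S))
    (hK : ∀ p, p ∈ K1 ↔ ∀ k, p k ∈ K) (s : Fin n → S) : pc K1 s = ∏ k, pc K (s k) := by
  classical
  have hcard : Nat.card K1 = Nat.card K ^ n := by
    have e : K1 ≃ (Fin n → K) :=
      ⟨fun p k => ⟨p.1 k, (hK _).1 p.2 k⟩, fun q => ⟨fun k => q k, (hK _).2 fun k => (q k).2⟩,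
        fun p => rfl, fun q => rfl⟩
    rw [Nat.card_congr e]; simp
  simp only [pc, ind, prod_mul_distrib, prod_const, card_univ, Fintype.card_fin,
    Finset.prod_univ_sum, Fintype.piFinset_univ]
  rw [hcard, Nat.cast_pow, inv_pow]
  congr 1
  refine sum_congr rfl fun t _ => ?_
  rw [Finset.prod_ite_zero]
  simp [hK]

end Ind

section Asm

open Polynomial

variable {S G : Type} [Group S] [Fintype S] [IsSimpleGroup S] [Group G] [Fintype G] {n : ℕ}

lemma rat_crit {I : Type} [Fintype I] [Nonempty I] (z : I → ℂ)
    (hz : ∀ j : ℕ, ∃ q : ℚ, ∑ i, z i ^ j = q) (p : ℚ[X]) (v : ℂ) (hv : ∀ i, aeval (z i) p = v) :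
    ∃ q : ℚ, v = q := by
  choose q hq using hz
  have h1 : ∑ i, aeval (z i) p = Fintype.card I * v := by simp [hv]
  have h2 : ∑ i, aeval (z i) p = ∑ j ∈ range (p.natDegree + 1), (p.coeff j : ℂ) * q j := by
    simp only [aeval_eq_sum_range, ← hq, mul_sum]
    rw [sum_comm]
    refine sum_congr rfl fun j _ => sum_congr rfl fun i _ => ?_
    rw [Algebra.smul_def]; rfl
  have h3 : (Fintype.card I : ℂ) ≠ 0 := by exact_mod_cast Fintype.card_ne_zero
  refine ⟨(∑ j ∈ range (p.natDegree + 1), p.coeff j * q j) / Fintype.card I, ?_⟩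
  push_cast
  rw [← h2, h1]
  field_simp

theorem assemble (hna : ∃ a b : S, a * b ≠ b * a) (ι : (Fin n → S) →* G)
    (α : G →* MulAut (Fin n → S)) (hα : ∀ g s, ι (α g s) = g * ι s * g⁻¹)
    (B : S → S → ℚ[X]) (hB : ∀ (φ : MulAut S) c s, B (φ c) (φ s) = B c s)
    (y : Fin n → S) (z0 : ℂ) (d : Fin n → ℕ) (hd : ∀ k, 0 < d k)
    (hchar : ∀ k, IsChar (fun s => aeval z0 (B (y k) s)))
    (hnorm : ∀ k, ip (fun s => aeval z0 (B (y k) s)) (fun s => aeval z0 (B (y k) s)) = 1)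
    (hdeg : ∀ k, aeval z0 (B (y k) 1) = (d k : ℂ))
    {I : Type} [Fintype I] [Nonempty I] (z : I → ℂ)
    (hz : ∀ j : ℕ, ∃ q : ℚ, ∑ i, z i ^ j = q)
    (hgal : ∀ i, ∃ m : ℕ, (∃ h, α h y = y ^ m) ∧
      ∀ k s, aeval (z i) (B (y k) s) = aeval z0 (B (y k ^ m) s))
    (K : Subgroup S) (K0 : Subgroup G) (hK : ∀ p, ι p ∈ K0 ↔ ∀ k, p k ∈ K)
    (hG : ∀ g, ∃ p, ∃ k ∈ K0, g = ι p * k)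
    (hmult : ∀ k, ip (pc K) (fun s => aeval z0 (B (y k) s)) = 1)
    (hpar : (∃ k, Even (d k)) ∨
      ((∃ h, α h y = y⁻¹) ∧ (∀ k s, aeval z0 (B (y k) s⁻¹) = aeval z0 (B (y k)⁻¹ s)) ∧
        ∃ s : Fin n → S, ∏ k, aeval z0 (B (y k) (s k)) ≠ ∏ k, aeval z0 (B (y k) (s k)⁻¹))) :
    ∃ χ : G → ℂ, ∃ m : ℕ, IsChar χ ∧ ip χ χ = 1 ∧ (∀ g, ∃ q : ℚ, χ g = q) ∧
      χ 1 = m ∧ Even m := by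
  classical
  let Θ : (Fin n → S) → ℂ := fun s => ∏ k, aeval z0 (B (y k) (s k))
  have hnat : ∀ (w : ℂ) (g : G) (c s : Fin n → S),
      ∏ k, aeval w (B (α g c k) (α g s k)) = ∏ k, aeval w (B (c k) (s k)) := by
    intro w g c s
    obtain ⟨π, a, ha⟩ := pi_aut hna (α g)
    simp only [ha, hB]
    exact Equiv.prod_comp π (fun k => aeval w (B (c k) (s k)))
  have hΘ : IsChar Θ := isChar_pi _ hchar
  have hΘ1 : ip Θ Θ = 1 := by
    have := ip_pi (fun k s => aeval z0 (B (y k) s)) (fun k s => aeval z0 (B (y k) s))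
    rw [show ip Θ Θ = _ from this]
    simp [hnorm]
  have hshift : ∀ h s, ∏ k, aeval z0 (B (α h y k) (s k)) = Θ (α h⁻¹ s) := fun h s => by
    have := hnat z0 h y (α h⁻¹ s)
    simp only [← MulAut.mul_apply, ← map_mul, mul_inv_cancel, map_one, MulAut.one_apply] at this
    exact this
  obtain ⟨χ, h1, h2, h3, h4⟩ := lemmaA ι α hα Θ hΘ hΘ1 (∏ k, d k) (Finset.prod_pos fun k _ => hd k)
    (by simp [Θ, hdeg]) (pc K0) (isChar_pc K0) (pc_rat K0) (by
      have e : (fun s => pc K0 (ι s)) = fun s => ∏ k, pc K (s k) := by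
        funext s
        rw [pc_restrict ι K0 hG, pc_pi K]
        exact hK
      rw [e, show ip (fun s : Fin n → S => ∏ k, pc K (s k)) Θ = _ from
        ip_pi (fun _ => pc K) (fun k s => aeval z0 (B (y k) s))]
      simp [hmult]) (by
      intro s
      refine rat_crit z hz (∑ g, ∏ k, B (y k) (α g s k)) _ fun i => ?_
      obtain ⟨m, ⟨h, hh⟩, hi⟩ := hgal i
      simp only [map_sum, map_prod, hi]
      rw [← Equiv.sum_comp (Equiv.mulLeft h)]
      refine sum_congr rfl fun g _ => ?_
      have := hshift h (α (h * g) s)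
      rw [hh] at this
      simp only [Pi.pow_apply] at this
      simp only [Equiv.coe_mulLeft]
      rw [this, ← MulAut.mul_apply, ← map_mul, inv_mul_cancel_left])
  refine ⟨χ, (∏ k, d k) * (univ.image (fun g : G => fun s => Θ (α g s))).card, h1, h2, h3, ?_, ?_⟩
  · rw [h4]; push_cast; rfl
  · rcases hpar with ⟨k, hk⟩ | ⟨⟨h, hh⟩, hinv, s0, hs0⟩
    · apply Even.mul_right
      exact (even_iff_two_dvd.1 hk).trans (Finset.dvd_prod_of_mem d (mem_univ k)) |> even_iff_two_dvd.2
    · apply Even.mul_left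
      have hΘinv : ∀ s, Θ s⁻¹ = Θ (α h⁻¹ s) := fun s => by
        rw [← hshift, hh]
        simp [Θ, hinv]
      have : ((univ.image (fun g : G => fun s => Θ (α g s))).card : ZMod 2) = 0 := by
        rw [card_eq_sum_ones, Nat.cast_sum]
        refine Finset.sum_involution (fun a _ => fun s => a s⁻¹) ?_ ?_ ?_ ?_
        · intro a _; decide
        · intro a ha _ heq
          obtain ⟨g, -, rfl⟩ := mem_image.1 ha
          have := congrFun heq (α g⁻¹ s0)
          simp only [map_inv α, map_inv (α g), MulAut.apply_inv_self] at this
          exact hs0 this.symm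
        · intro a ha
          obtain ⟨g, -, rfl⟩ := mem_image.1 ha
          refine mem_image.2 ⟨h⁻¹ * g, mem_univ _, ?_⟩
          funext s
          change Θ ((α (h⁻¹ * g)) s) = Θ (α g s⁻¹)
          rw [map_inv (α g), hΘinv, map_mul, MulAut.mul_apply]
        · intro a _; funext s; simp
      exact (ZMod.natCast_eq_zero_iff_even).1 this

end Asm

end RC

end


section
set_option linter.unusedSectionVars false
namespace RC

open Finset

/-- The facts about `PSL₂(q)`, `q = 24 * k+3`, that are used. -/
structure Good (S : Type) [Group S] (k : ℕ) (v w : S) : Prop where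
  card : Nat.card S = (24 * k + 3) * ((12 * k + 1) * (24 * k + 4))
  w2 : w * w = 1
  w1 : w ≠ 1
  inv : ∀ t : S, t * t = 1 → t ≠ 1 → IsConj w t
  cw : Nat.card (Subgroup.centralizer {w}) = 24 * k + 4
  tw : ∃ T : Subgroup S, IsCyclic T ∧ Nat.card T = 12 * k + 2 ∧ w ∈ T ∧
    (∀ t ∈ T, t * w = w * t) ∧ ∀ d, d * w = w * d → d ∉ T → d * d = 1
  cyc : ∀ t : S, t ^ 2 ≠ 1 → t ^ 3 ≠ 1 → IsCyclic (Subgroup.centralizer {t}) ∧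
    (Nat.card (Subgroup.centralizer {t}) = 12 * k + 1 ∨
      Nat.card (Subgroup.centralizer {t}) = 12 * k + 2)
  cinv : ∀ t : S, t ^ 2 ≠ 1 → t ^ 3 ≠ 1 → (∃ j, j * t * j⁻¹ = t⁻¹) ∧
    ∀ g, (g * t * g⁻¹) * t = t * (g * t * g⁻¹) → g * t * g⁻¹ = t ∨ g * t * g⁻¹ = t⁻¹
  v3 : v ^ 3 = 1
  v1 : v ≠ 1
  vnc : ¬ IsConj v v⁻¹
  ord3 : ∀ s : S, s ^ 3 = 1 → s = 1 ∨ IsConj v s ∨ IsConj v⁻¹ s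
  cv : Nat.card (Subgroup.centralizer {v}) = 24 * k + 3
  vw : w * (v * w * v⁻¹) = (v * w * v⁻¹) * w
  wv : (w * v) ^ 3 = 1
  torsor : ∀ j u : S, j * j = 1 → j ≠ 1 → IsConj v u → (j * u) ^ 3 = 1 →
    ∃ g, j = g * w * g⁻¹ ∧ u = g * v * g⁻¹
  delta : ∃ φ : MulAut S, φ v = v⁻¹
  gamma : ∃ (Γ : S → ℂ) (z : ℂ), IsChar Γ ∧ z ^ 2 + z + (6 * k + 1) = 0 ∧
    Γ 1 = (12 * k + 1) * (24 * k + 4) ∧ (∀ s, IsConj v s → Γ s = z) ∧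
    (∀ s, IsConj v⁻¹ s → Γ s = -1 - z) ∧ ∀ s, s ^ 3 ≠ 1 → Γ s = 0

section Count

variable {S : Type} [Group S] [Fintype S]

lemma memC {t g : S} : g ∈ Subgroup.centralizer {t} ↔ g * t = t * g := by
  rw [Subgroup.mem_centralizer_singleton_iff]

open Classical in
lemma card_conj_eq {a b : S} (h : IsConj a b) :
    #{g : S | g * a * g⁻¹ = b} = Nat.card (Subgroup.centralizer {a}) := by
  obtain ⟨c, hc⟩ := isConj_iff.1 h
  rw [← Fintype.card_subtype, ← Nat.card_eq_fintype_card]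
  refine Nat.card_congr ⟨fun g => ⟨c⁻¹ * g.1, ?_⟩, fun g => ⟨c * g.1, ?_⟩, ?_, ?_⟩
  · rw [memC]
    have h1 : g.1 * a * g.1⁻¹ = c * a * c⁻¹ := by rw [hc, g.2]
    have h2 : g.1 * a = c * a * c⁻¹ * g.1 := by rw [← h1]; group
    rw [mul_assoc, h2]; group
  · have := memC.1 g.2
    rw [mul_assoc c, this, ← hc]; group
  · intro g; simp
  · intro g; simp

open Classical in
lemma card_conj_eq' {a b : S} (h : IsConj a b) :
    #{g : S | g⁻¹ * a * g = b} = Nat.card (Subgroup.centralizer {a}) := by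
  rw [← card_conj_eq h]
  refine card_bij' (fun g _ => g⁻¹) (fun g _ => g⁻¹) ?_ ?_ ?_ ?_ <;> simp

lemma card_cent_conj {a b : S} (h : IsConj a b) :
    Nat.card (Subgroup.centralizer {b}) = Nat.card (Subgroup.centralizer {a}) := by
  classical
  rw [← card_conj_eq h, ← card_conj_eq' h.symm]
  congr 1
  ext g
  simp only [mem_filter, mem_univ, true_and]
  constructor
  · intro h; rw [← h]; group
  · intro h; rw [← h]; group

open Classical in
lemma sum_conj (F : S → ℂ) (a : S) :
    ∑ g, F (g⁻¹ * a * g) = Nat.card (Subgroup.centralizer {a}) * ∑ x with IsConj a x, F x := by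
  rw [Finset.sum_comp F (fun g => g⁻¹ * a * g), mul_sum]
  refine sum_congr ?_ ?_
  · ext x
    simp only [mem_image, mem_univ, true_and, mem_filter, isConj_iff]
    constructor
    · rintro ⟨g, rfl⟩; exact ⟨g⁻¹, by simp⟩
    · rintro ⟨g, rfl⟩; exact ⟨g⁻¹, by simp⟩
  · intro x hx
    rw [card_conj_eq' (mem_filter.1 hx).2, nsmul_eq_mul]

open Classical in
lemma class_card (a : S) :
    (Nat.card S : ℂ) = Nat.card (Subgroup.centralizer {a}) * #{x | IsConj a x} := by
  have := sum_conj (fun _ => 1) a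
  simpa using this

lemma cf_isConj {χ : S → ℂ} (hχ : ∀ s g, χ (s * g * s⁻¹) = χ g) {a b : S} (h : IsConj a b) :
    χ b = χ a := by
  obtain ⟨c, rfl⟩ := isConj_iff.1 h
  exact hχ c a

end Count

section Basic

variable {S : Type} [Group S] [Fintype S] {k : ℕ} {v w : S} (H : Good S k v w)
include H

lemma Good.card' : (Nat.card S : ℂ) = (24 * k + 3) * ((12 * k + 1) * (24 * k + 4)) := by
  rw [H.card]; push_cast; ring

lemma Good.not_inv_ord3 {s : S} (h : IsConj v s) (h' : IsConj v⁻¹ s) : False :=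
  H.vnc (h.trans h'.symm)

/-- inner product with the Gelfand-Graev character -/
lemma Good.ip_gamma {Γ : S → ℂ} {z : ℂ}
    (h1 : Γ 1 = (12 * k + 1) * (24 * k + 4)) (hv : ∀ s, IsConj v s → Γ s = z)
    (hv' : ∀ s, IsConj v⁻¹ s → Γ s = -1 - z) (h0 : ∀ s, s ^ 3 ≠ 1 → Γ s = 0)
    (χ : S → ℂ) (hχ : ∀ s g, χ (s * g * s⁻¹) = χ g) :
    ip Γ χ = (24 * k + 3 : ℂ)⁻¹ * (χ 1 + z * χ v⁻¹ + (-1 - z) * χ v) := by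
  classical
  have hvi : Nat.card (Subgroup.centralizer {v⁻¹}) = 24 * k + 3 := by
    rw [← H.cv]
    congr 2
    ext g
    simp only [memC]
    constructor
    · intro h; have := congrArg (fun x => v * x * v) h; simpa [mul_assoc] using this.symm
    · intro h; have := congrArg (fun x => v⁻¹ * x * v⁻¹) h; simpa [mul_assoc] using this.symm
  have hq : (24 * k + 3 : ℂ) ≠ 0 := by
    have : (24 * k + 3 : ℕ) ≠ 0 := by omega
    exact_mod_cast this
  have hc : (#{x : S | IsConj v x} : ℂ) = (12 * k + 1) * (24 * k + 4) := by
    have := class_card v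
    rw [H.card', H.cv] at this
    push_cast at this
    exact (mul_left_cancel₀ hq this).symm
  have hc' : (#{x : S | IsConj v⁻¹ x} : ℂ) = (12 * k + 1) * (24 * k + 4) := by
    have := class_card v⁻¹
    rw [H.card', hvi] at this
    push_cast at this
    exact (mul_left_cancel₀ hq this).symm
  have hsum : ∑ g, Γ g * χ g⁻¹ = ∑ g ∈ ({1} : Finset S), Γ g * χ g⁻¹ +
      ∑ g with IsConj v g, Γ g * χ g⁻¹ + ∑ g with IsConj v⁻¹ g, Γ g * χ g⁻¹ := by
    rw [← sum_union, ← sum_union]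
    · symm
      apply sum_subset (subset_univ _)
      intro s _ hs
      rw [h0, zero_mul]
      intro h3
      apply hs
      simp only [mem_union, mem_singleton, mem_filter, mem_univ, true_and, or_assoc]
      exact H.ord3 s h3
    · rw [disjoint_left]
      intro s hs hs'
      simp only [mem_union, mem_singleton, mem_filter, mem_univ, true_and] at hs hs'
      rcases hs with rfl | hs
      · rw [isConj_one_left] at hs'; exact H.v1 (inv_eq_one.1 hs')
      · exact H.not_inv_ord3 hs hs'
    · rw [disjoint_left]
      intro s hs hs'
      simp only [mem_singleton, mem_filter, mem_univ, true_and] at hs hs'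
      subst hs
      rw [isConj_one_left] at hs'; exact H.v1 hs'
  have e1 : ∑ g with IsConj v g, Γ g * χ g⁻¹ = (12 * k + 1) * (24 * k + 4) * (z * χ v⁻¹) := by
    rw [← hc, ← nsmul_eq_mul, ← sum_const]
    refine sum_congr rfl fun s hs => ?_
    have hs := (mem_filter.1 hs).2
    rw [hv s hs]
    obtain ⟨c, rfl⟩ := isConj_iff.1 hs
    rw [show (c * v * c⁻¹)⁻¹ = c * v⁻¹ * c⁻¹ by group, hχ]
  have e2 : ∑ g with IsConj v⁻¹ g, Γ g * χ g⁻¹ =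
      (12 * k + 1) * (24 * k + 4) * ((-1 - z) * χ v) := by
    rw [← hc', ← nsmul_eq_mul, ← sum_const]
    refine sum_congr rfl fun s hs => ?_
    have hs := (mem_filter.1 hs).2
    rw [hv' s hs]
    obtain ⟨c, rfl⟩ := isConj_iff.1 hs
    rw [show (c * v⁻¹ * c⁻¹)⁻¹ = c * v * c⁻¹ by group, hχ]
  rw [ip, hsum, e1, e2, sum_singleton, h1, inv_one, H.card']
  have h4 : (12 * k + 1 : ℂ) ≠ 0 := by
    have : (12 * k + 1 : ℕ) ≠ 0 := by omega
    exact_mod_cast this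
  have h5 : (24 * k + 4 : ℂ) ≠ 0 := by
    have : (24 * k + 4 : ℕ) ≠ 0 := by omega
    exact_mod_cast this
  generalize (12 * k + 1 : ℂ) = a at *
  generalize (24 * k + 4 : ℂ) = b at *
  generalize (24 * k + 3 : ℂ) = c at *
  field_simp

end Basic

end RC

end


section
set_option linter.unusedSectionVars false
namespace RC

open Finset

section Torus

variable {S : Type} [Group S] [Fintype S] {k : ℕ} {v w : S} (H : Good S k v w)
include H

lemma Good.cent_comm {y : S} (hy2 : y ^ 2 ≠ 1) (hy3 : y ^ 3 ≠ 1) {a b : S}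
    (ha : a ∈ Subgroup.centralizer {y}) (hb : b ∈ Subgroup.centralizer {y}) : a * b = b * a := by
  obtain ⟨g, hg⟩ := (H.cyc y hy2 hy3).1
  obtain ⟨i, hi⟩ := hg ⟨a, ha⟩
  obtain ⟨j, hj⟩ := hg ⟨b, hb⟩
  have hi' : (g : S) ^ i = a := congrArg Subtype.val hi
  have hj' : (g : S) ^ j = b := congrArg Subtype.val hj
  rw [← hi', ← hj', ← zpow_add, ← zpow_add, add_comm]

lemma Good.three_not {y : S} (hy2 : y ^ 2 ≠ 1) (hy3 : y ^ 3 ≠ 1) {t : S}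
    (ht : t ∈ Subgroup.centralizer {y}) (h3 : t ^ 3 = 1) : t = 1 := by
  have h1 := Subgroup.orderOf_dvd_natCard _ ht
  have h2 := orderOf_dvd_of_pow_eq_one h3
  have : orderOf t ∣ 1 := by
    rcases (H.cyc y hy2 hy3).2 with h | h <;> rw [h] at h1
    · rw [show 12 * k + 1 = 3 * (4 * k) + 1 by ring] at h1
      exact (Nat.dvd_add_right (h2.mul_right _)).1 h1
    · rw [show 12 * k + 2 = 3 * (4 * k) + 2 by ring] at h1
      have h3 := (Nat.dvd_add_right (h2.mul_right _)).1 h1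
      have := Nat.dvd_sub h2 h3
      simpa using this
  exact orderOf_eq_one_iff.1 (Nat.dvd_one.1 this)

lemma Good.cent_eq {y : S} (hy2 : y ^ 2 ≠ 1) (hy3 : y ^ 3 ≠ 1) {t : S}
    (ht : t ∈ Subgroup.centralizer {y}) (ht2 : t ^ 2 ≠ 1) :
    Subgroup.centralizer {t} = Subgroup.centralizer {y} := by
  have ht3 : t ^ 3 ≠ 1 := fun h => ht2 (by rw [H.three_not hy2 hy3 ht h, one_pow])
  ext g
  constructor
  · intro hg
    rw [memC]
    exact H.cent_comm ht2 ht3 hg (memC.2 (memC.1 ht).symm)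
  · intro hg
    rw [memC]
    exact H.cent_comm hy2 hy3 hg ht

omit H in
lemma inv_unique {T : Subgroup S} (hT : IsCyclic T) {s t : S}
    (ht : t ∈ T) (ht2 : t ^ 2 = 1) (ht1 : t ≠ 1)
    (hs : s ∈ T) (hs2 : s ^ 2 = 1) (hs1 : s ≠ 1) : s = t := by
  classical
  by_contra hst
  have h := IsCyclic.card_pow_eq_one_le (α := T) (n := 2) two_pos
  have h3 : ({1, ⟨s, hs⟩, ⟨t, ht⟩} : Finset T) ⊆ univ.filter fun a => a ^ 2 = 1 := by
    intro a ha
    simp only [mem_insert, mem_singleton] at ha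
    rw [mem_filter]
    refine ⟨mem_univ _, ?_⟩
    rcases ha with rfl | rfl | rfl
    · simp
    · exact Subtype.ext hs2
    · exact Subtype.ext ht2
  have h4 := card_le_card h3
  rw [card_eq_three.2 ⟨1, ⟨s, hs⟩, ⟨t, ht⟩, fun e => hs1 (congrArg Subtype.val e).symm,
    fun e => ht1 (congrArg Subtype.val e).symm, fun e => hst (congrArg Subtype.val e), rfl⟩] at h4
  omega

open Classical in
lemma Good.ind_tor {y : S} (hy2 : y ^ 2 ≠ 1) (hy3 : y ^ 3 ≠ 1) (l : S → ℂ) {t : S}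
    (ht : t ∈ Subgroup.centralizer {y}) (ht1 : t ≠ 1) (hl : t ^ 2 = 1 → l t = 1) :
    ind (Nat.card (Subgroup.centralizer {y}))
      (fun g => if g ∈ Subgroup.centralizer {y} then l g else 0) t = l t + l t⁻¹ := by
  set T := Subgroup.centralizer {y} with hT
  have hc : (Nat.card T : ℂ) ≠ 0 := by
    have : 0 < Nat.card T := Nat.card_pos
    exact_mod_cast this.ne'
  rw [ind, inv_mul_eq_iff_eq_mul₀ hc]
  by_cases ht2 : t ^ 2 = 1
  · have e : ∀ s : S, (if s⁻¹ * t * s ∈ T then l (s⁻¹ * t * s) else 0) =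
        if s⁻¹ * t * s = t then 1 else 0 := by
      intro s
      by_cases h : s⁻¹ * t * s = t
      · rw [h]; simp [ht, hl ht2]
      · rw [if_neg h, if_neg]
        intro h'
        apply h
        refine inv_unique (H.cyc y hy2 hy3).1 ht ht2 ht1 h' ?_ ?_
        · have : (s⁻¹ * t * s) ^ 2 = s⁻¹ * t ^ 2 * s := by simp [pow_two, mul_assoc]
          rw [this, ht2]; simp
        · intro h1
          apply ht1
          have := congrArg (fun x => s * x * s⁻¹) h1
          simpa [mul_assoc] using this
    simp only [e]
    rw [← sum_filter, sum_const, card_conj_eq' (IsConj.refl t),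
      card_cent_conj (H.inv t (by rw [← pow_two, ht2]) ht1), H.cw]
    have hi : t⁻¹ = t := by
      rw [inv_eq_iff_mul_eq_one, ← pow_two, ht2]
    have h2 : 2 ∣ Nat.card T := by
      rw [← orderOf_eq_prime ht2 ht1]
      exact Subgroup.orderOf_dvd_natCard _ ht
    have : Nat.card T = 12 * k + 2 := by
      rcases (H.cyc y hy2 hy3).2 with h | h
      · rw [hT] at h2; omega
      · exact h
    rw [this, hi, hl ht2]
    simp; ring
  · have hCt := H.cent_eq hy2 hy3 ht ht2
    have ht3 : t ^ 3 ≠ 1 := fun h => ht2 (by rw [H.three_not hy2 hy3 ht h, one_pow])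
    have hne : t ≠ t⁻¹ := fun h => ht2 (by rw [pow_two]; nth_rw 2 [h]; simp)
    have e : ∀ s : S, (if s⁻¹ * t * s ∈ T then l (s⁻¹ * t * s) else 0) =
        (if s⁻¹ * t * s = t then l t else 0) + (if s⁻¹ * t * s = t⁻¹ then l t⁻¹ else 0) := by
      intro s
      by_cases h : s⁻¹ * t * s = t
      · simp [h, ht, hne]
      · by_cases h' : s⁻¹ * t * s = t⁻¹
        · simp [h', hne.symm, ht, T.inv_mem ht]
        · rw [if_neg h, if_neg h', if_neg, add_zero]
          intro hm
          rw [hT, ← hCt, memC] at hm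
          have := (H.cinv t ht2 ht3).2 s⁻¹ (by simpa using hm)
          simp only [inv_inv] at this
          tauto
    simp only [e]
    rw [sum_add_distrib, ← sum_filter, ← sum_filter, sum_const, sum_const,
      card_conj_eq' (IsConj.refl t), card_conj_eq', hCt]
    · simp; ring
    · exact isConj_iff.2 (H.cinv t ht2 ht3).1

lemma Good.q0 : (24 * k + 3 : ℂ) ≠ 0 := by
  have : (24 * k + 3 : ℕ) ≠ 0 := by omega
  exact_mod_cast this

open Classical in
/-- the sum of the two Gelfand-Graev characters -/
noncomputable def G2 (S : Type) [Group S] (k : ℕ) (s : S) : ℚ :=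
  if s = 1 then 2 * ((12 * k + 1) * (24 * k + 4)) else if s ^ 3 = 1 then -1 else 0

lemma Good.G2_spec : IsChar (fun s : S => (G2 S k s : ℂ)) ∧
    ∀ χ : S → ℂ, (∀ s g, χ (s * g * s⁻¹) = χ g) →
      ip (fun s : S => (G2 S k s : ℂ)) χ = (24 * k + 3 : ℂ)⁻¹ * (2 * χ 1 - χ v⁻¹ - χ v) := by
  obtain ⟨Γ, z, hΓ, -, h1, hv, hv', h0⟩ := H.gamma
  have e : (fun s : S => (G2 S k s : ℂ)) = Γ + fun s => Γ s⁻¹ := by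
    funext s
    simp only [G2, Pi.add_apply]
    by_cases hs : s = 1
    · subst hs; simp [h1]; ring
    · rw [if_neg hs]
      by_cases h3 : s ^ 3 = 1
      · rw [if_pos h3]
        rcases (H.ord3 s h3).resolve_left hs with h | h
        · rw [hv s h, hv']
          · simp
          · obtain ⟨c, rfl⟩ := isConj_iff.1 h
            exact isConj_iff.2 ⟨c, by group⟩
        · rw [hv' s h, hv]
          · simp
          · obtain ⟨c, rfl⟩ := isConj_iff.1 h
            exact isConj_iff.2 ⟨c, by group⟩
      · rw [if_neg h3, h0 s h3, h0]
        · simp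
        · simpa using h3
  rw [e]
  refine ⟨hΓ.add hΓ.dual, fun χ hχ => ?_⟩
  rw [ip_add_left, H.ip_gamma h1 hv hv' h0 χ hχ,
    H.ip_gamma (Γ := fun s => Γ s⁻¹) (z := -1 - z) (by simpa using h1) ?_ ?_ ?_ χ hχ]
  · ring
  · intro s h
    apply hv'
    obtain ⟨c, rfl⟩ := isConj_iff.1 h
    exact isConj_iff.2 ⟨c, by group⟩
  · intro s h
    rw [hv]
    · ring
    · obtain ⟨c, rfl⟩ := isConj_iff.1 h
      exact isConj_iff.2 ⟨c, by group⟩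
  · intro s h
    apply h0
    simpa using h

end Torus

end RC

end


section
set_option linter.unusedSectionVars false
namespace RC

open Finset

section Dih

variable {S : Type} [Group S] [Fintype S] {k : ℕ} {v w : S} (H : Good S k v w)
include H

omit H in
open Classical in
lemma card_torsion {T : Subgroup S} (hT : IsCyclic T) {d : ℕ} (hd : d ∣ Nat.card T) (hd0 : 0 < d) :
    #{g : S | g ∈ T ∧ g ^ d = 1} = d := by
  obtain ⟨g, hg⟩ := IsCyclic.exists_zpow_surjective (G := T)
  obtain ⟨e, he⟩ := hd
  have hpos : 0 < Nat.card T := Nat.card_pos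
  have he0 : 0 < e := by
    rcases Nat.eq_zero_or_pos e with h | h
    · rw [h] at he; omega
    · exact h
  have hog : orderOf g = Nat.card T := orderOf_eq_card_of_forall_mem_zpowers hg
  have hog' : orderOf (g : S) = Nat.card T := by rw [← hog]; exact orderOf_injective T.subtype T.subtype_injective g
  have : (univ.filter fun x : S => x ∈ T ∧ x ^ d = 1) = (range d).image fun i => (g : S) ^ (e * i) := by
    ext x
    simp only [mem_filter, mem_univ, true_and, mem_image, mem_range]
    constructor
    · rintro ⟨hx, hx1⟩
      have : (x : S) ∈ Submonoid.powers (g : S) := by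
        rw [mem_powers_iff_mem_zpowers]
        obtain ⟨i, hi⟩ := hg ⟨x, hx⟩
        exact ⟨i, congrArg Subtype.val hi⟩
      obtain ⟨i, rfl⟩ := this
      simp only at hx1 ⊢
      rw [← pow_mul] at hx1
      have h2 := orderOf_dvd_of_pow_eq_one hx1
      rw [hog', he, mul_comm i d] at h2
      obtain ⟨j, rfl⟩ := Nat.dvd_of_mul_dvd_mul_left hd0 h2
      refine ⟨j % d, Nat.mod_lt _ hd0, ?_⟩
      rw [pow_eq_pow_iff_modEq, hog', he, mul_comm d e]
      exact (Nat.mod_modEq j d).mul_left' e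
    · rintro ⟨i, hi, rfl⟩
      refine ⟨T.pow_mem g.2 _, ?_⟩
      rw [← pow_mul, mul_right_comm, mul_comm e d, ← he, pow_mul, ← hog', pow_orderOf_eq_one, one_pow]
  rw [this, card_image_of_injOn, card_range]
  intro i hi j hj hij
  simp only [coe_range, Set.mem_Iio] at hi hj
  simp only at hij
  rw [pow_eq_pow_iff_modEq, hog', he, mul_comm d e] at hij
  have := Nat.ModEq.mul_left_cancel' he0.ne' hij
  exact Nat.ModEq.eq_of_lt_of_lt this hi hj

lemma Good.vw_ne : v * w * v⁻¹ ≠ w := by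
  intro h
  have h1 : v ∈ Subgroup.centralizer {w} := by
    rw [memC]; nth_rw 2 [← h]; group
  have h2 := Subgroup.orderOf_dvd_natCard _ h1
  rw [H.cw, orderOf_eq_prime H.v3 H.v1] at h2
  omega

open Classical in
lemma Good.dih : ∃ T K : Subgroup S, IsCyclic T ∧ Nat.card T = 12 * k + 2 ∧ w ∈ T ∧
    (∀ t ∈ T, t * w = w * t) ∧ (∀ d, d * w = w * d → d ∉ T → d * d = 1) ∧
    (∀ g, g ∈ K ↔ g * w = w * g ∧ (g ^ (6 * k + 1) = 1 ∨ (g * (v * w * v⁻¹)) ^ (6 * k + 1) = 1)) ∧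
    Nat.card K = 12 * k + 2 ∧
    #{g | g ∈ T ∧ g ^ (6 * k + 1) = 1} = 6 * k + 1 ∧
    (∀ χ : S → ℂ, (∀ s g, χ (s * g * s⁻¹) = χ g) →
      ∑ g with g ∈ Subgroup.centralizer {w}, χ g = ∑ g with g ∈ T, χ g + (12 * k + 2) * χ w) ∧
    (∀ χ : S → ℂ, (∀ s g, χ (s * g * s⁻¹) = χ g) →
      ∑ g with g ∈ K, χ g = ∑ g with g ∈ T ∧ g ^ (6 * k + 1) = 1, χ g + (6 * k + 1) * χ w) := by
  obtain ⟨T, hTc, hT, hwT, hTw, hd⟩ := H.tw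
  set J := v * w * v⁻¹ with hJ
  have hJw : J * w = w * J := H.vw.symm
  have hJ2 : J * J = 1 := by
    have := H.w2
    rw [hJ, show v * w * v⁻¹ * (v * w * v⁻¹) = v * (w * w) * v⁻¹ by group, this]; group
  have hJ1 : J ≠ 1 := by
    intro h
    exact H.w1 (by simpa [hJ, mul_assoc] using congrArg (fun x => v⁻¹ * x * v) h)
  have hJT : J ∉ T := fun h => H.vw_ne
    (inv_unique hTc hwT (by rw [pow_two, H.w2]) H.w1 h (by rw [pow_two, hJ2]) hJ1)
  have hcomm : ∀ a ∈ T, ∀ b ∈ T, a * b = b * a := by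
    intro a ha b hb
    obtain ⟨g, hg⟩ := hTc
    obtain ⟨i, hi⟩ := hg ⟨a, ha⟩
    obtain ⟨j, hj⟩ := hg ⟨b, hb⟩
    have hi' : (g : S) ^ i = a := congrArg Subtype.val hi
    have hj' : (g : S) ^ j = b := congrArg Subtype.val hj
    rw [← hi', ← hj', ← zpow_add, ← zpow_add, add_comm]
  have hTle : T ≤ Subgroup.centralizer {w} := fun t ht => memC.2 (hTw t ht)
  -- index two
  have hidx : T.relIndex (Subgroup.centralizer {w}) = 2 := by
    have h2 : T.relIndex (Subgroup.centralizer {w}) * Nat.card T = Nat.card (Subgroup.centralizer {w}) := by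
      have := (T.subgroupOf (Subgroup.centralizer {w})).index_mul_card
      rwa [Nat.card_congr (Subgroup.subgroupOfEquivOfLe hTle).toEquiv] at this
    rw [H.cw, hT] at h2
    nlinarith
  have hmul : ∀ a b, a * w = w * a → b * w = w * b → (a * b ∈ T ↔ (a ∈ T ↔ b ∈ T)) := by
    intro a b ha hb
    have := Subgroup.mul_mem_iff_of_index_two hidx (a := ⟨a, memC.2 ha⟩) (b := ⟨b, memC.2 hb⟩)
    simpa [Subgroup.mem_subgroupOf] using this
  have hodd : ∀ g, g * w = w * g → g ^ (6 * k + 1) = 1 → g ∈ T := by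
    intro g hg h1
    by_contra hn
    have h2 := hd g hg hn
    rw [pow_succ, show 6 * k = 2 * (3 * k) by ring, pow_mul, pow_two, h2, one_pow, one_mul] at h1
    exact hn (h1 ▸ T.one_mem)
  have hJinv : ∀ t ∈ T, J * t = t⁻¹ * J := by
    intro t ht
    have h1 : (t * J) * (t * J) = 1 := by
      apply hd
      · rw [mul_assoc, hJw, ← mul_assoc, hTw t ht, mul_assoc]
      · intro h; exact hJT ((T.mul_mem_cancel_left ht).1 h)
    have h2 : J * t = t⁻¹ * (t * J * (t * J)) * J⁻¹ := by group
    have hJi : J⁻¹ = J := inv_eq_of_mul_eq_one_left hJ2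
    rw [h2, h1, hJi, mul_one]
  have hmemJ : ∀ g, g * w = w * g → (g * J) * w = w * (g * J) := by
    intro g hg
    rw [mul_assoc, hJw, ← mul_assoc, hg, mul_assoc]
  have hTpow : ∀ a ∈ T, ∀ b ∈ T, a ^ (6 * k + 1) = 1 → b ^ (6 * k + 1) = 1 → (a * b) ^ (6 * k + 1) = 1 := by
    intro a ha b hb h1 h2
    rw [(show Commute a b from hcomm a ha b hb).mul_pow, h1, h2, one_mul]
  let K : Subgroup S :=
    { carrier := {g | g * w = w * g ∧ (g ^ (6 * k + 1) = 1 ∨ (g * J) ^ (6 * k + 1) = 1)}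
      one_mem' := by simp
      mul_mem' := by
        rintro a b ⟨ha, ha'⟩ ⟨hb, hb'⟩
        refine ⟨by rw [mul_assoc, hb, ← mul_assoc, ha, mul_assoc], ?_⟩
        rcases ha' with h1 | h1 <;> rcases hb' with h2 | h2
        · left
          exact hTpow a (hodd a ha h1) b (hodd b hb h2) h1 h2
        · right
          rw [mul_assoc]
          exact hTpow a (hodd a ha h1) _ (hodd _ (hmemJ b hb) h2) h1 h2
        · right
          have hbT := hodd b hb h2
          have e : a * b * J = (a * J) * b⁻¹ := by
            rw [mul_assoc a J, show J * b⁻¹ = b * J by rw [hJinv _ (T.inv_mem hbT), inv_inv], mul_assoc]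
          rw [e]
          exact hTpow _ (hodd _ (hmemJ a ha) h1) _ (T.inv_mem hbT) h1 (by rw [inv_pow, h2, inv_one])
        · left
          have hbT := hodd _ (hmemJ b hb) h2
          have hb2 : b * b = 1 := hd b hb fun h => hJT ((T.mul_mem_cancel_left h).1 hbT)
          have hbi : b⁻¹ = b := inv_eq_of_mul_eq_one_left hb2
          have e : a * b = (a * J) * (b * J)⁻¹ := by
            rw [mul_inv_rev, hbi]; group
          rw [e]
          exact hTpow _ (hodd _ (hmemJ a ha) h1) _ (T.inv_mem hbT) h1 (by rw [inv_pow, h2, inv_one])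
      inv_mem' := by
        rintro a ⟨ha, ha'⟩
        refine ⟨?_, ?_⟩
        · have := congrArg (fun x => a⁻¹ * x * a⁻¹) ha
          simpa [mul_assoc] using this.symm
        · rcases ha' with h1 | h1
          · left; rw [inv_pow, h1, inv_one]
          · right
            have hT1 := hodd _ (hmemJ a ha) h1
            have e : a⁻¹ * J = a * J := by
              have : (a * J) * J = J * (a * J)⁻¹ := by
                rw [hJinv _ (T.inv_mem hT1), inv_inv]
              have hJi : J⁻¹ = J := inv_eq_of_mul_eq_one_left hJ2
              rw [mul_assoc, hJ2, mul_one, mul_inv_rev, ← mul_assoc, hJi, hJ2, one_mul] at this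
              rw [← this]
            rw [e, h1] }
  have hKmem : ∀ g, g ∈ K ↔ g * w = w * g ∧ (g ^ (6 * k + 1) = 1 ∨ (g * J) ^ (6 * k + 1) = 1) :=
    fun g => Iff.rfl
  have hconj : ∀ χ : S → ℂ, (∀ s g, χ (s * g * s⁻¹) = χ g) → ∀ g, g * w = w * g → g ∉ T → χ g = χ w := by
    intro χ hχ g hg hgT
    exact cf_isConj hχ (H.inv g (hd g hg hgT) (fun h => hgT (h ▸ T.one_mem)))
  have hR : #{g | g ∈ T ∧ g ^ (6 * k + 1) = 1} = 6 * k + 1 :=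
    card_torsion hTc ⟨2, by rw [hT]; ring⟩ (by omega)
  have hR' : #{g | g * w = w * g ∧ (g * J) ^ (6 * k + 1) = 1} = 6 * k + 1 := by
    refine Eq.trans ?_ hR
    refine card_bij' (fun g _ => g * J) (fun g _ => g * J) ?_ ?_ ?_ ?_
    · intro g hg
      simp only [mem_filter, mem_univ, true_and] at hg ⊢
      exact ⟨hodd _ (hmemJ g hg.1) hg.2, hg.2⟩
    · intro g hg
      simp only [mem_filter, mem_univ, true_and] at hg ⊢
      refine ⟨hmemJ g (hTw g hg.1), ?_⟩
      rw [mul_assoc, hJ2, mul_one]; exact hg.2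
    · intro g _; rw [mul_assoc, hJ2, mul_one]
    · intro g _; rw [mul_assoc, hJ2, mul_one]
  have hRn : ∀ g, (g * J) ∈ T → g ∉ T := fun g h hg => hJT ((T.mul_mem_cancel_left hg).1 h)
  have hKsplit : (univ.filter fun g => g ∈ K) = (univ.filter fun g => g ∈ T ∧ g ^ (6 * k + 1) = 1) ∪
      (univ.filter fun g => g * w = w * g ∧ (g * J) ^ (6 * k + 1) = 1) := by
    ext g
    simp only [mem_union, mem_filter, mem_univ, true_and, hKmem]
    constructor
    · rintro ⟨h, h1 | h1⟩
      · exact Or.inl ⟨hodd g h h1, h1⟩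
      · exact Or.inr ⟨h, h1⟩
    · rintro (⟨h, h1⟩ | ⟨h, h1⟩)
      · exact ⟨hTw g h, Or.inl h1⟩
      · exact ⟨h, Or.inr h1⟩
  have hKdisj : Disjoint (univ.filter fun g => g ∈ T ∧ g ^ (6 * k + 1) = 1)
      (univ.filter fun g => g * w = w * g ∧ (g * J) ^ (6 * k + 1) = 1) := by
    rw [disjoint_left]
    intro g hg hg'
    simp only [mem_filter, mem_univ, true_and] at hg hg'
    exact hRn g (hodd _ (hmemJ g hg'.1) hg'.2) hg.1
  refine ⟨T, K, hTc, hT, hwT, hTw, hd, hKmem, ?_, hR, ?_, ?_⟩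
  · rw [← card_filter_mem, hKsplit, card_union_of_disjoint hKdisj, hR, hR']; ring
  · intro χ hχ
    rw [← sum_filter_add_sum_filter_not _ (fun g => g ∈ T)]
    congr 1
    · rw [filter_filter]
      refine sum_congr ?_ fun _ _ => rfl
      ext g
      simp only [mem_filter, mem_univ, true_and]
      exact ⟨fun h => h.2, fun h => ⟨hTle h, h⟩⟩
    · rw [sum_congr rfl (g := fun _ => χ w), sum_const, nsmul_eq_mul]
      · congr 1
        have h1 := card_filter_add_card_filter_not (s := univ.filter fun g => g ∈ Subgroup.centralizer {w})
          (fun g => g ∈ T)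
        rw [card_filter_mem, H.cw] at h1
        have h2 : #{g ∈ univ.filter (fun g => g ∈ Subgroup.centralizer {w}) | g ∈ T} = 12 * k + 2 := by
          rw [← hT, ← card_filter_mem, filter_filter]
          congr 1
          ext g
          simp only [mem_filter, mem_univ, true_and]
          exact ⟨fun h => h.2, fun h => ⟨hTle h, h⟩⟩
        have h3 : #{g ∈ univ.filter (fun g => g ∈ Subgroup.centralizer {w}) | g ∉ T} = 12 * k + 2 := by omega
        rw [h3]; push_cast; ring
      · intro g hg
        simp only [mem_filter, mem_univ, true_and] at hg
        exact hconj χ hχ g (memC.1 hg.1) hg.2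
  · intro χ hχ
    rw [hKsplit, sum_union hKdisj]
    congr 1
    rw [sum_congr rfl (g := fun _ => χ w), sum_const, nsmul_eq_mul, hR']
    · push_cast; ring
    · intro g hg
      simp only [mem_filter, mem_univ, true_and] at hg
      exact hconj χ hχ g hg.1 (hRn g (hodd _ (hmemJ g hg.1) hg.2))

end Dih

end RC

end


section
set_option linter.unusedSectionVars false
namespace RC

open Finset

section Theta

variable {S : Type} [Group S] [Fintype S] {k : ℕ} {v w : S} (H : Good S k v w)
include H

lemma Good.G2_conj (s g : S) : G2 S k (s * g * s⁻¹) = G2 S k g := by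
  have h1 : s * g * s⁻¹ = 1 ↔ g = 1 := by
    constructor
    · intro h; simpa [mul_assoc] using congrArg (fun x => s⁻¹ * x * s) h
    · rintro rfl; simp
  have h3 : (s * g * s⁻¹) ^ 3 = 1 ↔ g ^ 3 = 1 := by
    rw [conj_pow]
    constructor
    · intro h; simpa [mul_assoc] using congrArg (fun x => s⁻¹ * x * s) h
    · intro h; simp [h]
  rw [G2, G2]
  by_cases a : g = 1
  · rw [if_pos (h1.2 a), if_pos a]
  · rw [if_neg (fun h => a (h1.1 h)), if_neg a]
    by_cases b : g ^ 3 = 1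
    · rw [if_pos (h3.2 b), if_pos b]
    · rw [if_neg (fun h => b (h3.1 h)), if_neg b]

open Classical in
/-- the induced character from the torus -/
noncomputable def iL (y : S) (l : S → ℂ) : S → ℂ :=
  ind (Nat.card (Subgroup.centralizer {y})) (fun g => if g ∈ Subgroup.centralizer {y} then l g else 0)

omit H in
lemma iL_conj (y : S) (l : S → ℂ) (s g : S) : iL y l (s * g * s⁻¹) = iL y l g := by
  classical
  exact ind_conj _ _ _ _

omit H in
lemma iL_one (y : S) (l : S → ℂ) (h1 : l 1 = 1) :
    iL y l 1 = (Nat.card (Subgroup.centralizer {y}) : ℂ)⁻¹ * Nat.card S := by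
  simp [iL, ind, Subgroup.one_mem, h1]

omit H in
lemma iL_zero (y : S) (l : S → ℂ) (t : S) (h : ∀ s, s * t * s⁻¹ ∉ Subgroup.centralizer {y}) :
    iL y l t = 0 := by
  classical
  rw [iL, ind]
  rw [sum_eq_zero, mul_zero]
  intro s _
  rw [if_neg]
  simpa using h s⁻¹

lemma Good.iL_three {y : S} (hy2 : y ^ 2 ≠ 1) (hy3 : y ^ 3 ≠ 1) (l : S → ℂ) {t : S} (h3 : t ^ 3 = 1)
    (h1 : t ≠ 1) : iL y l t = 0 := by
  apply iL_zero
  intro s hs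
  have := H.three_not hy2 hy3 hs (by rw [conj_pow, h3]; simp)
  apply h1
  simpa [mul_assoc] using congrArg (fun x => s⁻¹ * x * s) this

/-- standing assumptions on a torus character -/
structure TC (y : S) (l : S → ℂ) : Prop where
  y2 : y ^ 2 ≠ 1
  y3 : y ^ 3 ≠ 1
  mul : ∀ a ∈ Subgroup.centralizer {y}, ∀ b ∈ Subgroup.centralizer {y}, l (a * b) = l a * l b
  one : l 1 = 1
  two : ∀ t ∈ Subgroup.centralizer {y}, t ^ 2 = 1 → l t = 1
  ne : ∃ g ∈ Subgroup.centralizer {y}, l (g * g) ≠ 1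

omit H in
open Classical in
lemma TC.sum_zero {U : Subgroup S} {l : S → ℂ} (hm : ∀ a ∈ U, ∀ b ∈ U, l (a * b) = l a * l b)
    {g : S} (hg : g ∈ U) (h : l g ≠ 1) : ∑ t with t ∈ U, l t = 0 := by
  have h1 : ∑ t with t ∈ U, l (g * t) = ∑ t with t ∈ U, l t := by
    refine sum_bij' (fun t _ => g * t) (fun t _ => g⁻¹ * t) ?_ ?_ ?_ ?_ ?_
    · intro t ht; simp only [mem_filter, mem_univ, true_and] at ht ⊢; exact U.mul_mem hg ht
    · intro t ht; simp only [mem_filter, mem_univ, true_and] at ht ⊢; exact U.mul_mem (U.inv_mem hg) ht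
    · intro t _; simp
    · intro t _; simp
    · intro t _; rfl
  rw [sum_congr rfl (g := fun t => l g * l t) (fun t ht => hm g hg t (mem_filter.1 ht).2), ← mul_sum] at h1
  have : (l g - 1) * ∑ t with t ∈ U, l t = 0 := by rw [sub_mul, h1]; ring
  exact (mul_eq_zero.1 this).resolve_left (sub_ne_zero.2 h)

omit H in
lemma TC.inv {y : S} {l : S → ℂ} (h : TC y l) {t : S} (ht : t ∈ Subgroup.centralizer {y}) :
    l t * l t⁻¹ = 1 := by
  rw [← h.mul t ht _ (Subgroup.inv_mem _ ht), mul_inv_cancel, h.one]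

omit H in
lemma TC.isChar {y : S} {l : S → ℂ} (h : TC y l) : IsChar (iL y l) := by
  classical
  exact isChar_ind_sub _ _ h.mul

lemma Good.iL_norm {y : S} {l : S → ℂ} (h : TC y l) :
    ip (iL y l) (iL y l) = (Nat.card (Subgroup.centralizer {y}) : ℂ)⁻¹ *
      ((Nat.card (Subgroup.centralizer {y}) : ℂ)⁻¹ * Nat.card S +
        Nat.card (Subgroup.centralizer {y}) - 2) := by
  classical
  set T := Subgroup.centralizer {y} with hT
  have e : ip (iL y l) (iL y l) = (Nat.card T : ℂ)⁻¹ *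
      ∑ g, (if g ∈ T then l g else 0) * iL y l g⁻¹ :=
    ip_ind _ _ _ (iL_conj y l)
  rw [e]
  congr 1
  have e2 : ∀ g, (if g ∈ T then l g else 0) * iL y l g⁻¹ = if g ∈ T then
      (l g * (l g⁻¹ + l g) + if g = 1 then iL y l 1 - 2 else 0) else 0 := by
    intro g
    by_cases hg : g ∈ T
    · rw [if_pos hg, if_pos hg]
      by_cases h1 : g = 1
      · subst h1; simp [h.one]; ring
      · rw [if_neg h1, add_zero]
        congr 1
        have hi : g⁻¹ ≠ 1 := by simpa using h1
        have := H.ind_tor h.y2 h.y3 l (T.inv_mem hg) hi (h.two _ (T.inv_mem hg))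
        rw [inv_inv] at this
        exact this
    · simp [hg]
  simp only [e2]
  rw [← sum_filter, sum_add_distrib, sum_ite_eq' _ (1 : S), if_pos (by simp [T.one_mem]), iL_one y l h.one]
  have e3 : ∑ g with g ∈ T, l g * (l g⁻¹ + l g) = ∑ g with g ∈ T, (1 : ℂ) + ∑ g with g ∈ T, l (g * g) := by
    rw [← sum_add_distrib]
    refine sum_congr rfl fun g hg => ?_
    have hg := (mem_filter.1 hg).2
    rw [mul_add, h.inv hg, h.mul g hg g hg]
  obtain ⟨g0, hg0, hg1⟩ := h.ne
  rw [e3, sum_const, card_filter_mem, TC.sum_zero (l := fun g => l (g * g)) ?_ hg0 hg1]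
  · simp; ring
  · intro a ha b hb
    rw [← h.mul _ (T.mul_mem ha ha) _ (T.mul_mem hb hb)]
    congr 1
    have := H.cent_comm h.y2 h.y3 ha hb
    rw [mul_assoc, ← mul_assoc b, ← this]; simp [mul_assoc]

lemma Good.G2_iL {y : S} {l : S → ℂ} (h : TC y l) :
    ip (fun s : S => (G2 S k s : ℂ)) (iL y l) = (24 * k + 3 : ℂ)⁻¹ *
      (2 * ((Nat.card (Subgroup.centralizer {y}) : ℂ)⁻¹ * Nat.card S)) := by
  rw [H.G2_spec.2 _ (iL_conj y l), H.iL_three h.y2 h.y3 l H.v3 H.v1,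
    H.iL_three (t := v⁻¹) h.y2 h.y3 l (by rw [inv_pow, H.v3, inv_one]) (by simpa using H.v1), iL_one y l h.one]
  ring

lemma Good.G2_norm :
    ip (fun s : S => (G2 S k s : ℂ)) (fun s : S => (G2 S k s : ℂ)) = 2 * (24 * k + 3 : ℂ) := by
  have h1 : v⁻¹ ≠ 1 := by simpa using H.v1
  rw [H.G2_spec.2 _ (fun s g => by rw [H.G2_conj]), inv_mul_eq_iff_eq_mul₀ H.q0]
  simp [G2, H.v1, H.v3]
  ring

omit H in
lemma nz (a b : ℕ) (hb : 0 < b) : ((a : ℂ) * k + b) ≠ 0 := by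
  have : a * k + b ≠ 0 := by omega
  exact_mod_cast this

lemma Good.theta_split {y : S} {l : S → ℂ} (h : TC y l)
    (hm : Nat.card (Subgroup.centralizer {y}) = 12 * k + 1) :
    IsChar (iL y l - fun s => (G2 S k s : ℂ)) ∧
    ip (iL y l - fun s => (G2 S k s : ℂ)) (iL y l - fun s => (G2 S k s : ℂ)) = 1 ∧
    (iL y l - fun s => (G2 S k s : ℂ)) 1 = (24 * k + 4 : ℕ) ∧
    ip (pc (Subgroup.centralizer {w})) (iL y l - fun s => (G2 S k s : ℂ)) = 1 := by
  classical
  have n1 : (12 * k + 1 : ℂ) ≠ 0 := by exact_mod_cast nz (k := k) 12 1 one_pos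
  have n2 : (24 * k + 4 : ℂ) ≠ 0 := by exact_mod_cast nz (k := k) 24 4 (by norm_num)
  have n3 := H.q0
  have hone : iL y l 1 = (24 * k + 3) * (24 * k + 4) := by
    rw [iL_one y l h.one, hm, H.card']; push_cast; field_simp
  have hnorm : ip (iL y l - fun s => (G2 S k s : ℂ)) (iL y l - fun s => (G2 S k s : ℂ)) = 1 := by
    rw [ip_sub_left, ip_sub_right, ip_sub_right, ip_comm (iL y l) (fun s => (G2 S k s : ℂ)), H.G2_norm,
      H.G2_iL h, H.iL_norm h, ← iL_one y l h.one, hone, hm]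
    push_cast
    rw [show (2 : ℂ) * ((24 * k + 3) * (24 * k + 4)) = (24 * k + 3) * (2 * (24 * k + 4)) by ring,
      inv_mul_cancel_left₀ n3,
      show (24 * k + 3 : ℂ) * (24 * k + 4) + (12 * k + 1) - 2 = (12 * k + 1) * (48 * k + 11) by ring,
      inv_mul_cancel_left₀ (by assumption)]
    ring
  have hdeg : (iL y l - fun s => (G2 S k s : ℂ)) 1 = (24 * k + 4 : ℕ) := by
    rw [Pi.sub_apply, hone]; simp [G2]; ring
  refine ⟨isChar_sub ((24 * k + 3) * (24 * k + 4)) (by rw [hone]; push_cast; ring) h.isChar H.G2_spec.1 hnorm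
    ⟨24 * k + 4, by omega, hdeg⟩, hnorm, hdeg, ?_⟩
  rw [pc, ip_ind _ _ _ (fun s g => by simp only [Pi.sub_apply, iL_conj, H.G2_conj]), H.cw,
    sum_eq_single_of_mem (1 : S) (mem_univ _), if_pos (Subgroup.one_mem _), inv_one, hdeg]
  · push_cast; field_simp
  · intro d _ hd
    by_cases hdC : d ∈ Subgroup.centralizer {w}
    · have ho := Subgroup.orderOf_dvd_natCard _ hdC
      rw [H.cw] at ho
      have z1 : iL y l d⁻¹ = 0 := by
        apply iL_zero
        intro s hs
        have h2 := Subgroup.orderOf_dvd_natCard _ hs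
        rw [hm] at h2
        have h3 : orderOf (s * d⁻¹ * s⁻¹) = orderOf d := by
          rw [← orderOf_inv d]; exact orderOf_injective (MulAut.conj s).toMonoidHom (MulAut.conj s).injective d⁻¹
        rw [h3] at h2
        have h4 : orderOf d ∣ 2 := by
          have := Nat.dvd_sub ho (h2.mul_left 2)
          rwa [show 24 * k + 4 - 2 * (12 * k + 1) = 2 by omega] at this
        have h5 : orderOf d ∣ 1 := by
          have := Nat.dvd_sub h2 (h4.mul_right (6 * k))
          rwa [show 12 * k + 1 - 2 * (6 * k) = 1 by omega] at this
        exact hd (orderOf_eq_one_iff.1 (Nat.dvd_one.1 h5))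
      have z2 : G2 S k d⁻¹ = 0 := by
        rw [G2, if_neg (by simpa using hd), if_neg]
        intro h3
        rw [inv_pow, inv_eq_one] at h3
        have h2 := orderOf_dvd_of_pow_eq_one h3
        have h5 : orderOf d ∣ 1 := by
          have := Nat.dvd_sub ho (h2.mul_right (8 * k + 1))
          rwa [show 24 * k + 4 - 3 * (8 * k + 1) = 1 by omega] at this
        exact hd (orderOf_eq_one_iff.1 (Nat.dvd_one.1 h5))
      rw [Pi.sub_apply, z1, z2]; simp
    · simp [hdC]

open Classical in
lemma Good.theta_nonsplit {y : S} {l : S → ℂ} (h : TC y l)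
    (hm : Nat.card (Subgroup.centralizer {y}) = 12 * k + 2) {K : Subgroup S}
    (hK : Nat.card K = 12 * k + 2)
    (hKs : ∀ χ : S → ℂ, (∀ s g, χ (s * g * s⁻¹) = χ g) → ∑ g with g ∈ K, χ g =
      ∑ g with g ∈ Subgroup.centralizer {y} ∧ g ^ (6 * k + 1) = 1, χ g + (6 * k + 1) * χ w) :
    IsChar ((fun s => (G2 S k s : ℂ)) - iL y l) ∧
    ip ((fun s => (G2 S k s : ℂ)) - iL y l) ((fun s => (G2 S k s : ℂ)) - iL y l) = 1 ∧
    ((fun s => (G2 S k s : ℂ)) - iL y l) 1 = (24 * k + 2 : ℕ) ∧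
    ip (pc K) ((fun s => (G2 S k s : ℂ)) - iL y l) = 1 := by
  have n1 : (6 * k + 1 : ℂ) ≠ 0 := by exact_mod_cast nz (k := k) 6 1 one_pos
  have n2 : (12 * k + 2 : ℂ) ≠ 0 := by exact_mod_cast nz (k := k) 12 2 (by norm_num)
  have n3 := H.q0
  have hone : iL y l 1 = (24 * k + 3) * (24 * k + 2) := by
    rw [iL_one y l h.one, hm, H.card', show (12 * k + 1 : ℂ) * (24 * k + 4) = (24 * k + 2) * (12 * k + 2) by ring]
    push_cast; field_simp
  have hnorm : ip ((fun s => (G2 S k s : ℂ)) - iL y l) ((fun s => (G2 S k s : ℂ)) - iL y l) = 1 := by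
    rw [ip_sub_left, ip_sub_right, ip_sub_right, ip_comm (iL y l) (fun s => (G2 S k s : ℂ)), H.G2_norm,
      H.G2_iL h, H.iL_norm h, ← iL_one y l h.one, hone, hm]
    push_cast
    rw [show (2 : ℂ) * ((24 * k + 3) * (24 * k + 2)) = (24 * k + 3) * (2 * (24 * k + 2)) by ring,
      inv_mul_cancel_left₀ n3,
      show (24 * k + 3 : ℂ) * (24 * k + 2) + (12 * k + 2) - 2 = (12 * k + 2) * (48 * k + 3) by ring,
      inv_mul_cancel_left₀ (by assumption)]
    ring
  have hdeg : ((fun s => (G2 S k s : ℂ)) - iL y l) 1 = (24 * k + 2 : ℕ) := by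
    rw [Pi.sub_apply, hone]; simp [G2]; ring
  refine ⟨isChar_sub (2 * ((12 * k + 1) * (24 * k + 4))) (by simp [G2]) H.G2_spec.1 h.isChar hnorm
    ⟨24 * k + 2, by omega, hdeg⟩, hnorm, hdeg, ?_⟩
  set θ := (fun s => (G2 S k s : ℂ)) - iL y l with hθ
  have hθc : ∀ s g, θ (s * g * s⁻¹) = θ g := fun s g => by simp only [hθ, Pi.sub_apply, iL_conj, H.G2_conj]
  set T := Subgroup.centralizer {y} with hT
  have hval : ∀ t ∈ T, t ≠ 1 → θ t = - (l t + l t⁻¹) := by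
    intro t ht ht1
    have h1 := H.ind_tor h.y2 h.y3 l ht ht1 (h.two t ht)
    have h2 : G2 S k t = 0 := by
      rw [G2, if_neg ht1, if_neg]
      intro h3
      exact ht1 (H.three_not h.y2 h.y3 ht h3)
    rw [hθ, Pi.sub_apply, h2, iL, h1]; simp
  -- the value at `w`
  have hw : θ w = -2 := by
    obtain ⟨t, ht2⟩ : ∃ t : T, orderOf t = 2 := by
      have : Fact (Nat.Prime 2) := ⟨Nat.prime_two⟩
      apply exists_prime_orderOf_dvd_card' 2
      rw [hm]; omega
    have hto : orderOf (t : S) = 2 := by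
      rw [← ht2]; exact orderOf_injective T.subtype T.subtype_injective t
    have ht1 : (t : S) ≠ 1 := by
      intro h; rw [h, orderOf_one] at hto; omega
    have htt : (t : S) ^ 2 = 1 := by rw [← hto, pow_orderOf_eq_one]
    rw [← cf_isConj hθc (H.inv t (by rw [← pow_two, htt]) ht1), hval t t.2 ht1, h.two t t.2 htt,
      h.two _ (T.inv_mem t.2) (by rw [inv_pow, htt, inv_one])]
    norm_num
  let R : Subgroup S :=
    { carrier := {g | g ∈ T ∧ g ^ (6 * k + 1) = 1}
      one_mem' := by simp [T.one_mem]
      mul_mem' := by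
        rintro a b ⟨ha, ha'⟩ ⟨hb, hb'⟩
        refine ⟨T.mul_mem ha hb, ?_⟩
        rw [(show Commute a b from H.cent_comm h.y2 h.y3 ha hb).mul_pow, ha', hb', one_mul]
      inv_mem' := by
        rintro a ⟨ha, ha'⟩
        exact ⟨T.inv_mem ha, by rw [inv_pow, ha', inv_one]⟩ }
  have hRm : ∀ g, g ∈ R ↔ g ∈ T ∧ g ^ (6 * k + 1) = 1 := fun g => Iff.rfl
  obtain ⟨g0, hg0, hg1⟩ := h.ne
  have hs0 : ∑ t with t ∈ R, l t = 0 := by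
    refine TC.sum_zero (fun a ha b hb => h.mul a ha.1 b hb.1) (g := g0 * g0) ⟨T.mul_mem hg0 hg0, ?_⟩ hg1
    rw [← pow_two, ← pow_mul, show 2 * (6 * k + 1) = Nat.card T by rw [hm]; ring]
    have := pow_card_eq_one' (x := (⟨g0, hg0⟩ : T))
    exact congrArg Subtype.val this
  have hs0' : ∑ t with t ∈ R, l t⁻¹ = 0 := by
    rw [← hs0]
    refine sum_bij' (fun t _ => t⁻¹) (fun t _ => t⁻¹) ?_ ?_ ?_ ?_ ?_ <;> simp
  have hsum : ∑ t with t ∈ R, θ t = 24 * k + 4 := by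
    have e : ∀ t ∈ (univ.filter fun t => t ∈ R), θ t = - (l t + l t⁻¹) + if t = 1 then θ 1 + 2 else 0 := by
      intro t ht
      by_cases h1 : t = 1
      · subst h1; simp [h.one]; ring
      · rw [if_neg h1, hval t (mem_filter.1 ht).2.1 h1, add_zero]
    rw [sum_congr rfl e, sum_add_distrib, sum_neg_distrib, sum_add_distrib, hs0, hs0', sum_ite_eq',
      if_pos (by simp [R.one_mem]), hdeg]
    push_cast; ring
  have hfin := hKs θ hθc
  simp only [← hRm] at hfin
  rw [hsum, hw] at hfin
  rw [pc, ip_ind _ _ _ hθc, hK]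
  have e : ∑ g, (if g ∈ K then (1 : ℂ) else 0) * θ g⁻¹ = ∑ g with g ∈ K, θ g := by
    rw [sum_filter]
    refine Fintype.sum_equiv (Equiv.inv S) _ _ fun g => ?_
    simp
  rw [e, hfin]
  push_cast
  field_simp
  ring

end Theta

end RC

end


section
set_option linter.unusedSectionVars false
namespace RC

open Finset Polynomial

section LamP

variable {S : Type} [Group S] [Fintype S]

open Classical in
noncomputable def lamP (y t : S) : ℚ[X] :=
  if t ∈ Subgroup.centralizer {y} then
    ∑ a ∈ range (orderOf y),
      if t ^ (Nat.card (Subgroup.centralizer {y}) / orderOf y) = y ^ a then X ^ a else 0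
  else 0

open Classical in
noncomputable def thP (k : ℕ) (y s : S) : ℚ[X] :=
  if y = 1 then 1 else
    C (if Nat.card (Subgroup.centralizer {y}) = 12 * k + 1 then 1 else -1) *
      (C ((Nat.card (Subgroup.centralizer {y}) : ℚ)⁻¹) * ∑ g, lamP y (g⁻¹ * s * g) - C (G2 S k s))

lemma mem_cent_aut (φ : MulAut S) (y t : S) :
    φ t ∈ Subgroup.centralizer {φ y} ↔ t ∈ Subgroup.centralizer {y} := by
  rw [memC, memC, ← map_mul, ← map_mul, φ.injective.eq_iff]

lemma card_cent_aut (φ : MulAut S) (y : S) :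
    Nat.card (Subgroup.centralizer {φ y}) = Nat.card (Subgroup.centralizer {y}) := by
  refine Nat.card_congr (Equiv.symm ⟨fun t => ⟨φ t, (mem_cent_aut φ y t).2 t.2⟩,
    fun t => ⟨φ.symm t, (mem_cent_aut φ y _).1 (by simpa using t.2)⟩, ?_, ?_⟩)
  · intro t; simp
  · intro t; simp

lemma orderOf_aut (φ : MulAut S) (y : S) : orderOf (φ y) = orderOf y :=
  orderOf_injective φ.toMonoidHom φ.injective y

lemma lamP_aut (φ : MulAut S) (y t : S) : lamP (φ y) (φ t) = lamP y t := by
  classical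
  simp only [lamP, mem_cent_aut, card_cent_aut, orderOf_aut, ← map_pow, φ.injective.eq_iff]

lemma G2_aut (k : ℕ) (φ : MulAut S) (s : S) : G2 S k (φ s) = G2 S k s := by
  classical
  simp only [G2, ← map_pow, map_eq_one_iff φ φ.injective]

lemma thP_aut (k : ℕ) (φ : MulAut S) (y s : S) : thP k (φ y) (φ s) = thP k y s := by
  classical
  have : ∑ g, lamP (φ y) (g⁻¹ * φ s * g) = ∑ g, lamP y (g⁻¹ * s * g) := by
    rw [← Equiv.sum_comp φ.toEquiv]
    refine sum_congr rfl fun g _ => ?_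
    rw [← lamP_aut φ y (g⁻¹ * s * g)]
    simp
  simp only [thP, card_cent_aut, map_eq_one_iff φ φ.injective, this, G2_aut]

variable {k : ℕ} {v w : S} (H : Good S k v w) {r : ℕ} (hr : r.Prime) (h5 : 5 ≤ r)
include H hr h5

omit H in
lemma ord_ne {y : S} (hy : orderOf y = r) : y ≠ 1 ∧ y ^ 2 ≠ 1 ∧ y ^ 3 ≠ 1 := by
  refine ⟨?_, ?_, ?_⟩
  · intro h; rw [h, orderOf_one] at hy; omega
  · intro h
    have := Nat.le_of_dvd (by norm_num) (orderOf_dvd_of_pow_eq_one h); omega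
  · intro h
    have := Nat.le_of_dvd (by norm_num) (orderOf_dvd_of_pow_eq_one h); omega

omit hr H h5 in
lemma r_dvd {y : S} (hy : orderOf y = r) : r ∣ Nat.card (Subgroup.centralizer {y}) := by
  rw [← hy]
  exact Subgroup.orderOf_dvd_natCard _ (memC.2 rfl)

lemma Good.exists_pow {y : S} (hy : orderOf y = r) {t : S} (ht : t ∈ Subgroup.centralizer {y}) :
    ∃ a, t ^ (Nat.card (Subgroup.centralizer {y}) / r) = y ^ a := by
  classical
  obtain ⟨h1, h2, h3⟩ := ord_ne hr h5 hy
  have hc := card_torsion (H.cyc y h2 h3).1 (r_dvd hy) hr.pos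
  have hsub : (range r).image (fun a => y ^ a) ⊆
      univ.filter fun g => g ∈ Subgroup.centralizer {y} ∧ g ^ r = 1 := by
    intro g hg
    obtain ⟨a, -, rfl⟩ := mem_image.1 hg
    simp only [mem_filter, mem_univ, true_and]
    refine ⟨Subgroup.pow_mem _ (memC.2 rfl) _, ?_⟩
    rw [← pow_mul, mul_comm, pow_mul, ← hy, pow_orderOf_eq_one, one_pow]
  have heq := eq_of_subset_of_card_le hsub (by
    rw [hc, card_image_of_injOn, card_range]
    intro a ha b hb hab
    rw [← hy] at ha hb
    exact pow_injOn_Iio_orderOf (by simpa using ha) (by simpa using hb) hab)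
  have : t ^ (Nat.card (Subgroup.centralizer {y}) / r) ∈
      univ.filter fun g => g ∈ Subgroup.centralizer {y} ∧ g ^ r = 1 := by
    simp only [mem_filter, mem_univ, true_and]
    refine ⟨Subgroup.pow_mem _ ht _, ?_⟩
    rw [← pow_mul, Nat.div_mul_cancel (r_dvd hy)]
    exact congrArg Subtype.val (pow_card_eq_one' (x := (⟨t, ht⟩ : Subgroup.centralizer {y})))
  rw [← heq] at this
  obtain ⟨a, -, ha⟩ := mem_image.1 this
  exact ⟨a, ha.symm⟩

omit H h5 in
lemma lamP_eval {y : S} (hy : orderOf y = r) {t : S} (ht : t ∈ Subgroup.centralizer {y}) {a : ℕ}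
    (ha : t ^ (Nat.card (Subgroup.centralizer {y}) / r) = y ^ a) {ζ : ℂ} (hζ : ζ ^ r = 1) :
    aeval ζ (lamP y t) = ζ ^ a := by
  classical
  rw [lamP, if_pos ht, map_sum, hy, sum_eq_single_of_mem (a % r) (mem_range.2 (Nat.mod_lt _ hr.pos))]
  · rw [if_pos, map_pow, aeval_X]
    · conv_rhs => rw [← Nat.mod_add_div a r, pow_add, pow_mul, hζ, one_pow, mul_one]
    · rw [ha]; conv_lhs => rw [← pow_mod_orderOf, hy]
  · intro b hb hne
    rw [if_neg, map_zero]
    rw [ha, pow_eq_pow_iff_modEq, hy]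
    intro h
    apply hne
    rw [h, Nat.mod_eq_of_lt (mem_range.1 hb)]

lemma Good.tc {y : S} (hy : orderOf y = r) {ζ : ℂ} (hζ : IsPrimitiveRoot ζ r) :
    TC y (fun t => aeval ζ (lamP y t)) := by
  obtain ⟨h1, h2, h3⟩ := ord_ne hr h5 hy
  have hodd : Odd r := hr.odd_of_ne_two (by omega)
  refine ⟨h2, h3, ?_, ?_, ?_, ?_⟩
  · intro a ha b hb
    obtain ⟨i, hi⟩ := H.exists_pow hr h5 hy ha
    obtain ⟨j, hj⟩ := H.exists_pow hr h5 hy hb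
    rw [lamP_eval hr hy ha hi hζ.pow_eq_one, lamP_eval hr hy hb hj hζ.pow_eq_one, ← pow_add,
      lamP_eval hr hy (Subgroup.mul_mem _ ha hb) _ hζ.pow_eq_one]
    rw [(show Commute a b from H.cent_comm h2 h3 ha hb).mul_pow, hi, hj, pow_add]
  · rw [lamP_eval hr hy (Subgroup.one_mem _) (a := 0) (by simp) hζ.pow_eq_one, pow_zero]
  · intro t ht ht2
    rw [lamP_eval hr hy ht (a := 0) _ hζ.pow_eq_one, pow_zero]
    rw [pow_zero]
    by_cases ht1 : t = 1
    · rw [ht1, one_pow]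
    · have h2 : 2 ∣ Nat.card (Subgroup.centralizer {y}) := by
        rw [← orderOf_eq_prime ht2 ht1]; exact Subgroup.orderOf_dvd_natCard _ ht
      obtain ⟨c, hc⟩ := r_dvd hy
      rw [hc, Nat.mul_div_cancel_left _ hr.pos]
      rw [hc] at h2
      obtain ⟨d, rfl⟩ := ((Nat.coprime_two_left.2 hodd).dvd_of_dvd_mul_left h2)
      rw [pow_mul, ht2, one_pow]
  · obtain ⟨g, hg⟩ := (H.cyc y h2 h3).1
    have hog : orderOf (g : S) = Nat.card (Subgroup.centralizer {y}) := by
      rw [← orderOf_eq_card_of_forall_mem_zpowers hg]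
      exact orderOf_injective (Subgroup.subtype _) (Subgroup.subtype_injective _) g
    obtain ⟨a, ha⟩ := H.exists_pow hr h5 hy g.2
    refine ⟨g, g.2, ?_⟩
    rw [lamP_eval hr hy (a := a + a) (Subgroup.mul_mem _ g.2 g.2) _ hζ.pow_eq_one]
    · intro h
      have h4 := (hζ.pow_eq_one_iff_dvd _).1 h
      rw [← two_mul] at h4
      obtain ⟨b, rfl⟩ := (Nat.coprime_two_right.2 hodd).dvd_of_dvd_mul_left h4
      rw [pow_mul, ← hy, pow_orderOf_eq_one, one_pow] at ha
      have h5 := orderOf_dvd_of_pow_eq_one ha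
      rw [hog, hy] at h5
      obtain ⟨c, hc⟩ := r_dvd hy
      have hcp : 0 < Nat.card (Subgroup.centralizer {y}) := Nat.card_pos
      have h6 := Nat.le_of_dvd (Nat.div_pos (Nat.le_of_dvd hcp (r_dvd hy)) hr.pos) h5
      have := Nat.div_lt_self hcp hr.one_lt
      omega
    · rw [(Commute.refl (g : S)).mul_pow, ha, pow_add]

omit hr H h5 in
lemma aeval_thP {y : S} (hy1 : y ≠ 1) (ζ : ℂ) (s : S) :
    aeval ζ (thP k y s) = (if Nat.card (Subgroup.centralizer {y}) = 12 * k + 1 then 1 else -1) *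
      (iL y (fun t => aeval ζ (lamP y t)) s - G2 S k s) := by
  classical
  rw [thP, if_neg hy1, map_mul, map_sub, map_mul, map_sum, aeval_C, aeval_C, aeval_C, iL, ind]
  have e : ∀ g : S, aeval ζ (lamP y g) = if g ∈ Subgroup.centralizer {y} then aeval ζ (lamP y g) else 0 := by
    intro g
    by_cases h : g ∈ Subgroup.centralizer {y}
    · rw [if_pos h]
    · rw [if_neg h, lamP, if_neg h, map_zero]
  simp only [← e]
  split_ifs <;> simp

lemma Good.thP_split {y : S} (hy : orderOf y = r) {ζ : ℂ} (hζ : IsPrimitiveRoot ζ r)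
    (hm : Nat.card (Subgroup.centralizer {y}) = 12 * k + 1) :
    IsChar (fun s => aeval ζ (thP k y s)) ∧
    ip (fun s => aeval ζ (thP k y s)) (fun s => aeval ζ (thP k y s)) = 1 ∧
    aeval ζ (thP k y 1) = (24 * k + 4 : ℕ) ∧
    ip (pc (Subgroup.centralizer {w})) (fun s => aeval ζ (thP k y s)) = 1 := by
  have e : ∀ s, aeval ζ (thP k y s) = (iL y (fun t => aeval ζ (lamP y t)) - fun s => (G2 S k s : ℂ)) s := by
    intro s
    rw [aeval_thP (ord_ne hr h5 hy).1, if_pos hm, one_mul, Pi.sub_apply]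
  simp only [e]
  exact H.theta_split (H.tc hr h5 hy hζ) hm

open Classical in
lemma Good.thP_nonsplit {y : S} (hy : orderOf y = r) {ζ : ℂ} (hζ : IsPrimitiveRoot ζ r)
    (hm : Nat.card (Subgroup.centralizer {y}) = 12 * k + 2) {K : Subgroup S}
    (hK : Nat.card K = 12 * k + 2)
    (hKs : ∀ χ : S → ℂ, (∀ s g, χ (s * g * s⁻¹) = χ g) → ∑ g with g ∈ K, χ g =
      ∑ g with g ∈ Subgroup.centralizer {y} ∧ g ^ (6 * k + 1) = 1, χ g + (6 * k + 1) * χ w) :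
    IsChar (fun s => aeval ζ (thP k y s)) ∧
    ip (fun s => aeval ζ (thP k y s)) (fun s => aeval ζ (thP k y s)) = 1 ∧
    aeval ζ (thP k y 1) = (24 * k + 2 : ℕ) ∧
    ip (pc K) (fun s => aeval ζ (thP k y s)) = 1 := by
  have e : ∀ s, aeval ζ (thP k y s) = ((fun s => (G2 S k s : ℂ)) - iL y (fun t => aeval ζ (lamP y t))) s := by
    intro s
    rw [aeval_thP (ord_ne hr h5 hy).1, if_neg (by omega), Pi.sub_apply]
    ring
  simp only [e]
  exact H.theta_nonsplit (H.tc hr h5 hy hζ) hm hK hKs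

omit hr H h5 in
lemma thP_one (ζ : ℂ) (s : S) : aeval ζ (thP k (1 : S) s) = 1 := by
  rw [thP, if_pos rfl, map_one]

lemma Good.thP_gal {y : S} (hy : orderOf y = r) {ζ : ℂ} (hζ : IsPrimitiveRoot ζ r) {u j : ℕ}
    (huj : u * j ≡ 1 [MOD r]) (s : S) :
    aeval (ζ ^ u) (thP k y s) = aeval ζ (thP k (y ^ j) s) := by
  have hyu : (y ^ j) ^ u = y := by
    conv_rhs => rw [← pow_one y]
    rw [← pow_mul, pow_eq_pow_iff_modEq, hy, mul_comm]
    exact huj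
  have hC : Subgroup.centralizer {y ^ j} = Subgroup.centralizer {y} := by
    ext g
    simp only [memC]
    constructor
    · intro h
      have : Commute g (y ^ j) := h
      have := this.pow_right u
      rw [hyu] at this
      exact this
    · intro h
      exact (show Commute g y from h).pow_right j
  have hy' : orderOf (y ^ j) = r := by
    apply Nat.dvd_antisymm
    · rw [← hy]; exact orderOf_pow_dvd j
    · rw [← hy]; nth_rw 1 [← hyu]; exact orderOf_pow_dvd u
  rw [aeval_thP (ord_ne hr h5 hy).1, aeval_thP (ord_ne hr h5 hy').1, hC, iL, iL, hC]
  congr 4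
  funext t
  by_cases ht : t ∈ Subgroup.centralizer {y}
  · rw [if_pos ht, if_pos ht]
    obtain ⟨a, ha⟩ := H.exists_pow hr h5 hy ht
    rw [lamP_eval hr hy ht ha, lamP_eval hr hy' (by rw [hC]; exact ht) (a := u * a) _ hζ.pow_eq_one, pow_mul]
    · rw [hC, ha, pow_mul, hyu]
    · rw [← pow_mul, mul_comm, pow_mul, hζ.pow_eq_one, one_pow]
  · rw [if_neg ht, if_neg ht]

omit [Fintype S] H in
lemma rat_powers {ζ : ℂ} (hζ : IsPrimitiveRoot ζ r) (j : ℕ) :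
    ∃ q : ℚ, ∑ i : Fin (r - 1), (ζ ^ (i.1 + 1)) ^ j = (q : ℂ) := by
  have e : ∑ i : Fin (r - 1), (ζ ^ (i.1 + 1)) ^ j = ∑ i ∈ range r, (ζ ^ j) ^ i - 1 := by
    rw [show r = (r - 1) + 1 by omega, sum_range_succ', Nat.add_sub_cancel, Fin.sum_univ_eq_sum_range (fun i => (ζ ^ (i + 1)) ^ j)]
    simp only [pow_zero, add_sub_cancel_right, ← pow_mul]
    exact sum_congr rfl fun i _ => by rw [mul_comm]
  rw [e]
  by_cases h : ζ ^ j = 1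
  · rw [h]; exact ⟨r - 1, by simp⟩
  · refine ⟨-1, ?_⟩
    have := mul_neg_geom_sum (ζ ^ j) r
    rw [← pow_mul, mul_comm j, pow_mul, hζ.pow_eq_one, one_pow, sub_self] at this
    rw [(mul_eq_zero.1 this).resolve_left (sub_ne_zero.2 (Ne.symm h))]
    simp

end LamP

end RC

end


section
set_option linter.unusedSectionVars false
namespace RC

open Finset Polynomial

section CaseU

variable {S : Type} [Group S] [Fintype S]

open Classical in
noncomputable def Ir (k : ℕ) (w s : S) : ℚ :=
  Nat.card (Subgroup.centralizer {s}) *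
    ((12 * k + 2 : ℚ)⁻¹ * (#{t : S | t * w = w * t ∧ t ^ (6 * k + 1) = 1 ∧ IsConj s t} +
      if IsConj s w then 6 * k + 1 else 0) -
    (24 * k + 4 : ℚ)⁻¹ * #{t : S | t * w = w * t ∧ IsConj s t})

open Classical in
noncomputable def uP (k : ℕ) (w c s : S) : ℚ[X] :=
  if c = 1 then 1 else if s = 1 then C (12 * k + 1 : ℚ) else
    if s ^ 3 = 1 then (if IsConj c s then X else -1 - X) else C (- Ir k w s)

lemma isConj_aut (φ : MulAut S) (a b : S) : IsConj (φ a) (φ b) ↔ IsConj a b := by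
  constructor
  · intro h
    have := φ.symm.toMonoidHom.map_isConj h
    simpa using this
  · intro h; exact φ.toMonoidHom.map_isConj h

lemma Ir_aut (k : ℕ) (φ : MulAut S) (w s : S) : Ir k (φ w) (φ s) = Ir k w s := by
  classical
  have e1 : #{t : S | t * φ w = φ w * t ∧ t ^ (6 * k + 1) = 1 ∧ IsConj (φ s) t} =
      #{t : S | t * w = w * t ∧ t ^ (6 * k + 1) = 1 ∧ IsConj s t} := by
    symm
    refine card_equiv φ.toEquiv fun t => ?_
    simp only [mem_filter, mem_univ, true_and, MulEquiv.toEquiv_eq_coe, EquivLike.coe_coe, isConj_aut,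
      ← map_mul, ← map_pow, map_eq_one_iff φ φ.injective, φ.injective.eq_iff]
  have e2 : #{t : S | t * φ w = φ w * t ∧ IsConj (φ s) t} =
      #{t : S | t * w = w * t ∧ IsConj s t} := by
    symm
    refine card_equiv φ.toEquiv fun t => ?_
    simp only [mem_filter, mem_univ, true_and, MulEquiv.toEquiv_eq_coe, EquivLike.coe_coe, isConj_aut,
      ← map_mul, ← map_pow, map_eq_one_iff φ φ.injective, φ.injective.eq_iff]
  simp only [Ir, e1, e2, card_cent_aut, isConj_aut]

lemma Ir_cl (k : ℕ) (w : S) {s s' : S} (h : IsConj s s') : Ir k w s' = Ir k w s := by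
  classical
  have e : ∀ t, IsConj s' t ↔ IsConj s t := fun t => ⟨fun h' => h.trans h', fun h' => h.symm.trans h'⟩
  simp only [Ir, card_cent_conj h, e]

variable {k : ℕ} {v w : S} (H : Good S k v w)
include H

lemma Good.Ir_aut' (φ : MulAut S) (s : S) : Ir k w (φ s) = Ir k w s := by
  obtain ⟨g, hg⟩ := isConj_iff.1 (H.inv (φ w) (by rw [← map_mul, H.w2, map_one])
    (by rw [Ne, map_eq_one_iff φ φ.injective]; exact H.w1))
  rw [← Ir_aut k φ w s, ← hg]
  have h := Ir_aut k (MulAut.conj g) w (g⁻¹ * φ s * g)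
  simp only [MulAut.conj_apply] at h
  rw [show g * (g⁻¹ * φ s * g) * g⁻¹ = φ s by group] at h
  rw [h]
  exact Ir_cl k w (isConj_iff.2 ⟨g, by group⟩)

lemma Good.uP_aut (φ : MulAut S) (c s : S) : uP k w (φ c) (φ s) = uP k w c s := by
  classical
  simp only [uP, isConj_aut, H.Ir_aut', ← map_pow, map_eq_one_iff φ φ.injective]

omit H in
open Classical in
lemma pc_eq (K : Subgroup S) (s : S) :
    pc K s = (Nat.card K : ℂ)⁻¹ * (Nat.card (Subgroup.centralizer {s}) *
      ∑ g with g ∈ K, if IsConj s g then 1 else 0) := by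
  rw [pc, ind, sum_conj (fun x => if x ∈ K then 1 else 0) s]
  congr 2
  rw [sum_filter, sum_filter]
  refine sum_congr rfl fun g _ => ?_
  split_ifs <;> rfl

omit H in
lemma pc_inv (K : Subgroup S) (s : S) : pc K s⁻¹ = pc K s := by
  classical
  simp only [pc, ind]
  congr 2
  funext g
  have : g⁻¹ * s⁻¹ * g = (g⁻¹ * s * g)⁻¹ := by group
  rw [this]; simp only [K.inv_mem_iff]

omit H in
lemma pc_conj (K : Subgroup S) (s g : S) : pc K (s * g * s⁻¹) = pc K g := by
  classical
  exact ind_conj _ _ _ _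

omit H in
lemma pc_one (K : Subgroup S) : pc K 1 = (Nat.card K : ℂ)⁻¹ * Nat.card S := by
  simp [pc, ind, K.one_mem]

/-- everything needed about the subgroups `D' ≤ D` -/
lemma Good.I_spec : ∃ (K : Subgroup S),
    (∀ s, (Ir k w s : ℂ) = pc K s - pc (Subgroup.centralizer {w}) s) ∧
    pc K 1 - pc (Subgroup.centralizer {w}) 1 = (24 * k + 3) * (12 * k + 1) ∧
    pc (Subgroup.centralizer {w}) v = 0 ∧ pc (Subgroup.centralizer {w}) v⁻¹ = 0 ∧
    pc K v = 0 ∧ pc K v⁻¹ = 0 ∧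
    ip (pc K - pc (Subgroup.centralizer {w})) (pc K - pc (Subgroup.centralizer {w})) = 12 * k + 1 ∧
    ∀ ψ : S → ℂ, (∀ s g, ψ (s * g * s⁻¹) = ψ g) → ψ 1 = 12 * k + 1 →
      (∀ s, s ^ 3 ≠ 1 → ψ s = pc (Subgroup.centralizer {w}) s - pc K s) →
      ip (pc (Subgroup.centralizer {w})) ψ = 1 := by
  classical
  obtain ⟨T, K, hTc, hT, hwT, hTw, hd, hKm, hK, hR, hDsum, hKsum⟩ := H.dih
  set D := Subgroup.centralizer {w} with hD
  have n1 : (6 * k + 1 : ℂ) ≠ 0 := by exact_mod_cast nz (k := k) 6 1 one_pos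
  have n2 : (12 * k + 2 : ℂ) ≠ 0 := by exact_mod_cast nz (k := k) 12 2 (by norm_num)
  have n4 : (24 * k + 4 : ℂ) ≠ 0 := by exact_mod_cast nz (k := k) 24 4 (by norm_num)
  have hcomm : ∀ a ∈ T, ∀ b ∈ T, a * b = b * a := by
    intro a ha b hb
    obtain ⟨g, hg⟩ := hTc
    obtain ⟨i, hi⟩ := hg ⟨a, ha⟩
    obtain ⟨j, hj⟩ := hg ⟨b, hb⟩
    have hi' : (g : S) ^ i = a := congrArg Subtype.val hi
    have hj' : (g : S) ^ j = b := congrArg Subtype.val hj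
    rw [← hi', ← hj', ← zpow_add, ← zpow_add, add_comm]
  have hodd : ∀ g, g * w = w * g → g ^ (6 * k + 1) = 1 → g ∈ T := by
    intro g hg h1
    by_contra hn
    have h2 := hd g hg hn
    rw [pow_succ, show 6 * k = 2 * (3 * k) by ring, pow_mul, pow_two, h2, one_pow, one_mul] at h1
    exact hn (h1 ▸ T.one_mem)
  have hind : ∀ s : S, ∀ a g : S, (if IsConj s (a * g * a⁻¹) then (1 : ℂ) else 0) = if IsConj s g then 1 else 0 := by
    intro s a g
    have h1 : IsConj g (a * g * a⁻¹) := isConj_iff.2 ⟨a, rfl⟩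
    have : IsConj s (a * g * a⁻¹) ↔ IsConj s g := ⟨fun h => h.trans h1.symm, fun h => h.trans h1⟩
    simp only [this]
  have hno3 : ∀ g ∈ D, g ^ 3 = 1 → g = 1 := by
    intro g hg h3
    have ho := Subgroup.orderOf_dvd_natCard _ hg
    rw [H.cw] at ho
    have h2 := orderOf_dvd_of_pow_eq_one h3
    have h5 : orderOf g ∣ 1 := by
      have := Nat.dvd_sub ho (h2.mul_right (8 * k + 1))
      rwa [show 24 * k + 4 - 3 * (8 * k + 1) = 1 by omega] at this
    exact orderOf_eq_one_iff.1 (Nat.dvd_one.1 h5)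
  have hKD : K ≤ D := fun g hg => memC.2 ((hKm g).1 hg).1
  have hz : ∀ L : Subgroup S, L ≤ D → ∀ s : S, s ≠ 1 → s ^ 3 = 1 → pc L s = 0 := by
    intro L hL s hs h3
    rw [pc, ind, sum_eq_zero, mul_zero]
    intro g _
    rw [if_neg]
    intro hm
    have h1 := hno3 _ (hL hm) (by
      have : (g⁻¹ * s * g) ^ 3 = g⁻¹ * s ^ 3 * g := by
        have := conj_pow (a := g⁻¹) (b := s) (i := 3)
        simpa using this
      rw [this, h3]; simp)
    exact hs (by simpa [mul_assoc] using congrArg (fun x => g * x * g⁻¹) h1)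
  have hvi : v⁻¹ ≠ 1 := by simpa using H.v1
  have hvi3 : v⁻¹ ^ 3 = 1 := by rw [inv_pow, H.v3, inv_one]
  -- values on T
  have hIT : ∀ t ∈ T, t ≠ 1 → pc K t - pc D t = if t ^ (6 * k + 1) = 1 then 1 else -1 := by
    intro t ht ht1
    rw [pc_eq, pc_eq, hDsum _ (hind t), hKsum _ (hind t), hK, H.cw]
    by_cases ht2 : t ^ 2 = 1
    · have htw : t = w := inv_unique hTc hwT (by rw [pow_two, H.w2]) H.w1 ht ht2 ht1
      subst htw
      have hne : t ^ (6 * k + 1) ≠ 1 := by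
        rw [pow_succ, show 6 * k = 2 * (3 * k) by ring, pow_mul, ht2, one_pow, one_mul]; exact ht1
      have hct : ∀ g, IsConj t g → g ^ 2 = 1 ∧ g ≠ 1 := by
        intro g hg
        obtain ⟨c, rfl⟩ := isConj_iff.1 hg
        refine ⟨by rw [conj_pow, ht2]; simp, fun h => ht1 ?_⟩
        simpa [mul_assoc] using congrArg (fun x => c⁻¹ * x * c) h
      have s1 : ∑ g with g ∈ T, (if IsConj t g then (1 : ℂ) else 0) = 1 := by
        rw [sum_eq_single_of_mem t (by simp [ht]), if_pos (IsConj.refl t)]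
        intro g hg hgt
        rw [if_neg]
        intro hc
        exact hgt (inv_unique hTc ht ht2 ht1 (mem_filter.1 hg).2 (hct g hc).1 (hct g hc).2)
      have s2 : ∑ g with g ∈ T ∧ g ^ (6 * k + 1) = 1, (if IsConj t g then (1 : ℂ) else 0) = 0 := by
        refine sum_eq_zero fun g hg => ?_
        rw [if_neg]
        intro hc
        have hg := (mem_filter.1 hg).2
        have := inv_unique hTc ht ht2 ht1 hg.1 (hct g hc).1 (hct g hc).2
        exact hne (this ▸ hg.2)
      rw [s1, s2, if_pos (IsConj.refl t), if_neg hne, H.cw]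
      push_cast
      rw [show (24 * k + 4 : ℂ) = 2 * (12 * k + 2) by ring]
      field_simp
      ring
    · have ht3 : t ^ 3 ≠ 1 := fun h3 => ht1 (hno3 t (memC.2 (hTw t ht)) h3)
      have hnw : ¬ IsConj t w := by
        intro h
        obtain ⟨c, hc⟩ := isConj_iff.1 h
        have h2 : w ^ 2 = 1 := by rw [pow_two, H.w2]
        rw [← hc, conj_pow] at h2
        exact ht2 (by simpa [mul_assoc] using congrArg (fun x => c⁻¹ * x * c) h2)
      have hcard : Nat.card (Subgroup.centralizer {t}) = 12 * k + 2 := by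
        have h2 : 2 ∣ Nat.card (Subgroup.centralizer {t}) := by
          rw [← orderOf_eq_prime (show w ^ 2 = 1 by rw [pow_two, H.w2]) H.w1]
          exact Subgroup.orderOf_dvd_natCard _ (memC.2 (hTw t ht).symm)
        rcases (H.cyc t ht2 ht3).2 with h | h
        · omega
        · exact h
      have hne : t ≠ t⁻¹ := fun h => ht2 (by rw [pow_two]; nth_rw 2 [h]; simp)
      have hiff : ∀ g ∈ T, IsConj t g ↔ g = t ∨ g = t⁻¹ := by
        intro g hg
        constructor
        · intro h
          obtain ⟨c, rfl⟩ := isConj_iff.1 h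
          exact (H.cinv t ht2 ht3).2 c (hcomm _ hg _ ht)
        · rintro (rfl | rfl)
          · exact IsConj.refl _
          · exact isConj_iff.2 (H.cinv t ht2 ht3).1
      have s1 : ∑ g with g ∈ T, (if IsConj t g then (1 : ℂ) else 0) = 2 := by
        rw [sum_congr rfl (fun g hg => if_congr (hiff g (mem_filter.1 hg).2) rfl rfl), ← sum_filter, sum_const]
        have : (filter (fun g => g = t ∨ g = t⁻¹) (filter (fun g => g ∈ T) univ)) = {t, t⁻¹} := by
          ext g
          simp only [mem_filter, mem_univ, true_and, mem_insert, mem_singleton]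
          constructor
          · exact fun h => h.2
          · rintro (rfl | rfl)
            · exact ⟨ht, Or.inl rfl⟩
            · exact ⟨T.inv_mem ht, Or.inr rfl⟩
        rw [this, card_pair hne]; simp
      have s2 : ∑ g with g ∈ T ∧ g ^ (6 * k + 1) = 1, (if IsConj t g then (1 : ℂ) else 0) =
          if t ^ (6 * k + 1) = 1 then 2 else 0 := by
        rw [← s1, ← filter_filter, sum_filter]
        by_cases hp : t ^ (6 * k + 1) = 1
        · rw [if_pos hp]
          refine sum_congr rfl fun g hg => ?_
          have hg := (mem_filter.1 hg).2
          by_cases hc : IsConj t g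
          · rw [if_pos]
            rcases (hiff g hg).1 hc with rfl | rfl
            · exact hp
            · rw [inv_pow, hp, inv_one]
          · rw [if_neg hc]; simp
        · rw [if_neg hp]
          refine sum_eq_zero fun g hg => ?_
          have hg := (mem_filter.1 hg).2
          by_cases hc : IsConj t g
          · rw [if_neg]
            rcases (hiff g hg).1 hc with rfl | rfl
            · exact hp
            · rw [inv_pow, inv_eq_one]; exact hp
          · rw [if_neg hc]; simp
      rw [s1, s2, if_neg hnw, hcard]
      push_cast
      rw [show (24 * k + 4 : ℂ) = 2 * (12 * k + 2) by ring]
      split_ifs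
      · field_simp; ring
      · field_simp; ring
  have hI1 : pc K 1 - pc D 1 = (24 * k + 3) * (12 * k + 1) := by
    rw [pc_one, pc_one, hK, H.cw, H.card']
    push_cast
    rw [show (24 * k + 4 : ℂ) = 2 * (12 * k + 2) by ring]
    field_simp
    ring
  have hTRcard : (#{g | g ∈ T} : ℂ) = 12 * k + 2 := by rw [card_filter_mem, hT]; push_cast; ring
  -- sum over T of a function times ε
  have hεsum : ∑ t with t ∈ T, (if t ^ (6 * k + 1) = 1 then (1 : ℂ) else -1) = 0 := by
    have e : ∀ t : S, (if t ^ (6 * k + 1) = 1 then (1 : ℂ) else -1) =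
        2 * (if t ^ (6 * k + 1) = 1 then 1 else 0) - 1 := by
      intro t; split_ifs <;> ring
    simp only [e]
    rw [sum_sub_distrib, ← mul_sum, ← sum_filter, filter_filter, sum_const, sum_const, hR]
    simp only [nsmul_eq_mul, mul_one, hTRcard]
    push_cast; ring
  have hinvsum : ∀ (L : Subgroup S) (χ : S → ℂ), ∑ g, (if g ∈ L then (1 : ℂ) else 0) * χ g⁻¹ = ∑ g with g ∈ L, χ g := by
    intro L χ
    rw [sum_filter]
    refine Fintype.sum_equiv (Equiv.inv S) _ _ fun g => ?_
    simp
  have hipD : ∀ χ : S → ℂ, (∀ s g, χ (s * g * s⁻¹) = χ g) →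
      ip (pc D) χ = (24 * k + 4 : ℂ)⁻¹ * (∑ g with g ∈ T, χ g + (12 * k + 2) * χ w) := by
    intro χ hχ
    rw [pc, ip_ind _ _ _ hχ, hinvsum, hDsum χ hχ, H.cw]; push_cast; ring
  have hipK : ∀ χ : S → ℂ, (∀ s g, χ (s * g * s⁻¹) = χ g) →
      ip (pc K) χ = (12 * k + 2 : ℂ)⁻¹ * (∑ g with g ∈ T ∧ g ^ (6 * k + 1) = 1, χ g + (6 * k + 1) * χ w) := by
    intro χ hχ
    rw [pc, ip_ind _ _ _ hχ, hinvsum, hKsum χ hχ, hK]; push_cast; ring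
  have hIc : ∀ s g, (pc K - pc D) (s * g * s⁻¹) = (pc K - pc D) g := fun s g => by
    simp only [Pi.sub_apply, pc_conj]
  refine ⟨K, ?_, hI1, hz D le_rfl v H.v1 H.v3, hz D le_rfl _ hvi hvi3, hz K hKD v H.v1 H.v3,
    hz K hKD _ hvi hvi3, ?_, ?_⟩
  · intro s
    rw [pc_eq, pc_eq, hKsum _ (hind s), hK, H.cw, Ir]
    have c1 : (#{t : S | t * w = w * t ∧ t ^ (6 * k + 1) = 1 ∧ IsConj s t} : ℂ) =
        ∑ g with g ∈ T ∧ g ^ (6 * k + 1) = 1, (if IsConj s g then (1 : ℂ) else 0) := by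
      rw [← sum_filter, filter_filter, sum_const, nsmul_eq_mul, mul_one]
      congr 2
      ext t
      simp only [mem_filter, mem_univ, true_and, and_assoc]
      exact ⟨fun h => ⟨hodd t h.1 h.2.1, h.2⟩, fun h => ⟨hTw t h.1, h.2⟩⟩
    have c2 : (#{t : S | t * w = w * t ∧ IsConj s t} : ℂ) =
        ∑ g with g ∈ D, (if IsConj s g then (1 : ℂ) else 0) := by
      rw [← sum_filter, filter_filter, sum_const, nsmul_eq_mul, mul_one]
      congr 2
      ext t
      simp only [mem_filter, mem_univ, true_and, hD, memC]
    push_cast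
    rw [c1, c2]
    split_ifs <;> push_cast <;> ring
  · rw [ip_sub_left, hipD _ hIc, hipK _ hIc]
    have e1 : ∑ g with g ∈ T ∧ g ^ (6 * k + 1) = 1, (pc K - pc D) g =
        ((24 * k + 3) * (12 * k + 1) - 1) + (6 * k + 1) := by
      have e : ∀ g ∈ (univ.filter fun g => g ∈ T ∧ g ^ (6 * k + 1) = 1), (pc K - pc D) g =
          1 + if g = 1 then (24 * k + 3 : ℂ) * (12 * k + 1) - 1 else 0 := by
        intro g hg
        have hg := (mem_filter.1 hg).2
        rw [Pi.sub_apply]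
        by_cases h1 : g = 1
        · rw [h1, hI1, if_pos rfl]; ring
        · rw [hIT g hg.1 h1, if_pos hg.2, if_neg h1, add_zero]
      rw [sum_congr rfl e, sum_add_distrib, sum_const, hR, sum_ite_eq', if_pos (by simp [T.one_mem])]
      simp only [nsmul_eq_mul, mul_one]; push_cast; ring
    have e2 : ∑ g with g ∈ T, (pc K - pc D) g = (24 * k + 3) * (12 * k + 1) - 1 := by
      have e : ∀ g ∈ (univ.filter fun g => g ∈ T), (pc K - pc D) g =
          (if g ^ (6 * k + 1) = 1 then 1 else -1) + if g = 1 then (24 * k + 3 : ℂ) * (12 * k + 1) - 1 else 0 := by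
        intro g hg
        have hg := (mem_filter.1 hg).2
        rw [Pi.sub_apply]
        by_cases h1 : g = 1
        · rw [h1, hI1, if_pos rfl, one_pow, if_pos rfl]; ring
        · rw [hIT g hg h1, if_neg h1, add_zero]
      rw [sum_congr rfl e, sum_add_distrib, hεsum, sum_ite_eq', if_pos (by simp [T.one_mem]), zero_add]
    rw [e1, e2, show (24 * k + 4 : ℂ) = 4 * (6 * k + 1) by ring, show (12 * k + 2 : ℂ) = 2 * (6 * k + 1) by ring]
    field_simp
    ring
  · intro ψ hψ h1_1 hψI
    have hval : ∀ t ∈ T, t ≠ 1 → ψ t = - if t ^ (6 * k + 1) = 1 then 1 else -1 := by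
      intro t ht ht1
      rw [hψI t (fun h3 => ht1 (hno3 t (memC.2 (hTw t ht)) h3)), ← hIT t ht ht1]; ring
    have hww : w ^ (6 * k + 1) ≠ 1 := by
      rw [pow_succ, show 6 * k = 2 * (3 * k) by ring, pow_mul, pow_two, H.w2, one_pow, one_mul]; exact H.w1
    have hw : ψ w = 1 := by rw [hval w hwT H.w1, if_neg hww]; ring
    have e2 : ∑ g with g ∈ T, ψ g = 12 * k + 2 := by
      have e : ∀ g ∈ (univ.filter fun g => g ∈ T), ψ g =
          - (if g ^ (6 * k + 1) = 1 then 1 else -1) + if g = 1 then (12 * k + 2 : ℂ) else 0 := by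
        intro g hg
        have hg := (mem_filter.1 hg).2
        by_cases h1 : g = 1
        · rw [h1, h1_1, if_pos rfl, one_pow, if_pos rfl]; ring
        · rw [hval g hg h1, if_neg h1, add_zero]
      rw [sum_congr rfl e, sum_add_distrib, sum_neg_distrib, hεsum, sum_ite_eq', if_pos (by simp [T.one_mem])]
      simp
    rw [hipD ψ hψ, e2, hw, show (24 * k + 4 : ℂ) = 4 * (6 * k + 1) by ring]
    field_simp
    ring

end CaseU

end RC

end


section
set_option linter.unusedSectionVars false
namespace RC

open Finset Polynomial

section CaseU2

variable {S : Type} [Group S] [Fintype S] {k : ℕ} {v w : S} (H : Good S k v w)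
include H

lemma Good.psi {Γ : S → ℂ} {z : ℂ} (hΓ : IsChar Γ) (hz : z ^ 2 + z + (6 * k + 1) = 0)
    (h1 : Γ 1 = (12 * k + 1) * (24 * k + 4)) (hv : ∀ s, IsConj v s → Γ s = z)
    (hv' : ∀ s, IsConj v⁻¹ s → Γ s = -1 - z) (h0 : ∀ s, s ^ 3 ≠ 1 → Γ s = 0) (ψ : S → ℂ)
    (hψ1 : ψ 1 = 12 * k + 1) (hψv : ∀ s, IsConj v s → ψ s = z)
    (hψv' : ∀ s, IsConj v⁻¹ s → ψ s = -1 - z) (hψ0 : ∀ s, s ^ 3 ≠ 1 → ψ s = - Ir k w s) :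
    IsChar ψ ∧ ip ψ ψ = 1 ∧ ip (pc (Subgroup.centralizer {w})) ψ = 1 := by
  obtain ⟨K, hI, hI1, hDv, hDv', hKv, hKv', hII, hmul⟩ := H.I_spec
  set D := Subgroup.centralizer {w} with hD
  have e : ψ = (Γ + pc D) - pc K := by
    funext s
    simp only [Pi.sub_apply, Pi.add_apply]
    by_cases h3 : s ^ 3 = 1
    · rcases H.ord3 s h3 with rfl | h | h
      · rw [hψ1, h1, add_sub_assoc, ← neg_sub, hI1]; ring
      · rw [hψv s h, hv s h, cf_isConj (pc_conj D) h, cf_isConj (pc_conj K) h, hDv, hKv]; ring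
      · rw [hψv' s h, hv' s h, cf_isConj (pc_conj D) h, cf_isConj (pc_conj K) h, hDv', hKv']; ring
    · rw [hψ0 s h3, h0 s h3, hI]; ring
  have e' : ψ = Γ - (pc K - pc D) := by rw [e]; ring
  have hΓc : ∀ s g, Γ (s * g * s⁻¹) = Γ g := fun s g => hΓ.conj g s
  have hΓΓ : ip Γ Γ = 12 * k + 2 := by
    rw [H.ip_gamma h1 hv hv' h0 Γ hΓc, h1, hv v (IsConj.refl v), hv' _ (IsConj.refl _),
      inv_mul_eq_iff_eq_mul₀ H.q0]
    linear_combination (-2) * hz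
  have hΓI : ip Γ (pc K - pc D) = 12 * k + 1 := by
    rw [H.ip_gamma h1 hv hv' h0 _ (fun s g => by simp only [Pi.sub_apply, pc_conj])]
    simp only [Pi.sub_apply, hI1, hDv, hDv', hKv, hKv']
    rw [inv_mul_eq_iff_eq_mul₀ H.q0]; ring
  have hn : ip ψ ψ = 1 := by
    have hgen : ∀ I : S → ℂ, ip (Γ - I) (Γ - I) = ip Γ Γ - 2 * ip Γ I + ip I I := by
      intro I
      rw [ip_sub_left, ip_sub_right, ip_sub_right, ip_comm I Γ]; ring
    rw [e', hgen, hΓΓ, hΓI, hII]; ring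
  obtain ⟨n1, hn1⟩ := (hΓ.add (isChar_pc D)).one_nat
  have hch : IsChar ψ := by
    rw [e]
    refine isChar_sub n1 hn1 (hΓ.add (isChar_pc D)) (isChar_pc K) ?_ ⟨12 * k + 1, by omega, ?_⟩
    · rw [← e]; exact hn
    · rw [← e, hψ1]; push_cast; ring
  refine ⟨hch, hn, hmul ψ (fun s g => hch.conj g s) hψ1 ?_⟩
  intro s h3
  rw [hψ0 s h3, hI]; ring

lemma Good.Ir_inv (s : S) : Ir k w s⁻¹ = Ir k w s := by
  obtain ⟨K, hI, -⟩ := H.I_spec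
  have : (Ir k w s⁻¹ : ℂ) = Ir k w s := by rw [hI, hI, pc_inv, pc_inv]
  exact_mod_cast this

lemma Good.c_cases {c : S} (hc : c ^ 3 = 1) (hc1 : c ≠ 1) {s : S} (hs : s ^ 3 = 1) (hs1 : s ≠ 1) :
    (IsConj c s ∧ ¬ IsConj c⁻¹ s ∧ ¬ IsConj c s⁻¹) ∨ (IsConj c⁻¹ s ∧ IsConj c s⁻¹ ∧ ¬ IsConj c s) := by
  have key : ∀ a b : S, IsConj a b → IsConj a⁻¹ b⁻¹ := by
    intro a b h
    obtain ⟨g, rfl⟩ := isConj_iff.1 h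
    exact isConj_iff.2 ⟨g, by group⟩
  have hn : ¬ IsConj c c⁻¹ := by
    intro h
    rcases (H.ord3 c hc).resolve_left hc1 with h' | h'
    · exact H.vnc (h'.trans (h.trans (key _ _ h').symm))
    · have := key _ _ h'
      rw [inv_inv] at this
      exact H.vnc (this.trans (h.symm.trans h'.symm))
  have hor : IsConj c s ∨ IsConj c⁻¹ s := by
    rcases (H.ord3 c hc).resolve_left hc1 with h | h <;> rcases (H.ord3 s hs).resolve_left hs1 with h' | h'
    · exact Or.inl (h.symm.trans h')
    · exact Or.inr ((key _ _ h).symm.trans h')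
    · have := key _ _ h; rw [inv_inv] at this
      exact Or.inr (this.symm.trans h')
    · exact Or.inl (h.symm.trans h')
  rcases hor with h | h
  · refine Or.inl ⟨h, fun h' => hn (h.trans h'.symm), fun h' => hn ?_⟩
    have := key _ _ h
    exact h'.trans this.symm
  · refine Or.inr ⟨h, ?_, fun h' => hn (h'.trans h.symm)⟩
    have := key _ _ h
    rwa [inv_inv] at this

lemma Good.uP_facts {z : ℂ} (hz : z ^ 2 + z + (6 * k + 1) = 0)
    (hex : ∃ (Γ : S → ℂ), IsChar Γ ∧
    Γ 1 = (12 * k + 1) * (24 * k + 4) ∧ (∀ s, IsConj v s → Γ s = z) ∧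
    (∀ s, IsConj v⁻¹ s → Γ s = -1 - z) ∧ ∀ s, s ^ 3 ≠ 1 → Γ s = 0)
    {c : S} (hc : c ^ 3 = 1) (hc1 : c ≠ 1) :
    IsChar (fun s => aeval z (uP k w c s)) ∧
    ip (fun s => aeval z (uP k w c s)) (fun s => aeval z (uP k w c s)) = 1 ∧
    aeval z (uP k w c 1) = (12 * k + 1 : ℕ) ∧
    ip (pc (Subgroup.centralizer {w})) (fun s => aeval z (uP k w c s)) = 1 := by
  obtain ⟨Γ, hΓ, h1, hv, hv', h0⟩ := hex
  have a1 : aeval z (uP k w c 1) = (12 * k + 1 : ℂ) := by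
    rw [uP, if_neg hc1, if_pos rfl, aeval_C]; simp
  have key : ∀ a b : S, IsConj a b → IsConj a⁻¹ b⁻¹ := by
    intro a b h
    obtain ⟨g, rfl⟩ := isConj_iff.1 h
    exact isConj_iff.2 ⟨g, by group⟩
  have one_of : ∀ u s : S, u ^ 3 = 1 → u ≠ 1 → IsConj u s → s ≠ 1 ∧ s ^ 3 = 1 := by
    intro u s hu hu1 h
    obtain ⟨g, rfl⟩ := isConj_iff.1 h
    refine ⟨fun h => hu1 ?_, by rw [conj_pow, hu]; simp⟩
    simpa [mul_assoc] using congrArg (fun x => g⁻¹ * x * g) h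
  have hci : c⁻¹ ≠ 1 := by simpa using hc1
  have hci3 : c⁻¹ ^ 3 = 1 := by rw [inv_pow, hc, inv_one]
  have ac : ∀ s, IsConj c s → aeval z (uP k w c s) = z := by
    intro s h
    obtain ⟨g1, g2⟩ := one_of c s hc hc1 h
    rw [uP, if_neg hc1, if_neg g1, if_pos g2, if_pos h, aeval_X]
  have aci : ∀ s, IsConj c⁻¹ s → aeval z (uP k w c s) = -1 - z := by
    intro s h
    obtain ⟨g1, g2⟩ := one_of c⁻¹ s hci3 hci h
    rw [uP, if_neg hc1, if_neg g1, if_pos g2, if_neg]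
    · simp
    · rcases H.c_cases hc hc1 g2 g1 with h' | h'
      · exact absurd h h'.2.1
      · exact h'.2.2
  have a0 : ∀ s, s ^ 3 ≠ 1 → aeval z (uP k w c s) = - Ir k w s := by
    intro s h3
    rw [uP, if_neg hc1, if_neg (fun h => h3 (by rw [h, one_pow])), if_neg h3, aeval_C]; simp
  rcases (H.ord3 c hc).resolve_left hc1 with h | h
  · obtain ⟨r1, r2, r3⟩ := H.psi hΓ hz h1 hv hv' h0 (fun s => aeval z (uP k w c s)) a1
      (fun s hs => ac s (h.symm.trans hs)) (fun s hs => aci s ((key _ _ h).symm.trans hs)) a0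
    exact ⟨r1, r2, by rw [a1]; push_cast; ring, r3⟩
  · have hk := key _ _ h
    rw [inv_inv] at hk
    obtain ⟨r1, r2, r3⟩ := H.psi (Γ := fun s => Γ s⁻¹) (z := -1 - z) hΓ.dual
      (by linear_combination hz) (by simpa using h1)
      (fun s hs => hv' _ (key _ _ hs)) (fun s hs => by
        rw [hv _ (by simpa using key _ _ hs)]; ring) (fun s hs => h0 _ (by simpa using hs))
      (fun s => aeval z (uP k w c s)) a1
      (fun s hs => aci s (hk.symm.trans hs)) (fun s hs => by
        rw [ac s (h.symm.trans hs)]; ring) a0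
    exact ⟨r1, r2, by rw [a1]; push_cast; ring, r3⟩

lemma Good.uP_inv {c : S} (hc : c ^ 3 = 1) (s : S) : uP k w c s⁻¹ = uP k w c⁻¹ s := by
  classical
  by_cases hc1 : c = 1
  · simp [uP, hc1]
  · by_cases hs1 : s = 1
    · simp [uP, hs1, hc1]
    · by_cases hs : s ^ 3 = 1
      · have : IsConj c s⁻¹ ↔ IsConj c⁻¹ s := by
          have := H.c_cases hc hc1 hs hs1
          tauto
        simp [uP, hs1, hc1, hs, this, -isConj_iff]
      · simp [uP, hs1, hc1, hs, H.Ir_inv]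

lemma Good.uP_gal {c : S} (hc : c ^ 3 = 1) (s : S) (z : ℂ) :
    aeval (-1 - z) (uP k w c s) = aeval z (uP k w (c ^ 2) s) := by
  classical
  have hc2 : c ^ 2 = c⁻¹ := by rw [eq_inv_iff_mul_eq_one, ← pow_succ, hc]
  rw [hc2]
  by_cases hc1 : c = 1
  · simp [uP, hc1]
  · by_cases hs1 : s = 1
    · simp [uP, hs1, hc1]
    · by_cases hs : s ^ 3 = 1
      · rcases H.c_cases hc hc1 hs hs1 with h | h
        · simp [uP, hs1, hc1, hs, h.1, h.2.1, -isConj_iff]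
        · simp [uP, hs1, hc1, hs, h.1, h.2.2, -isConj_iff]
      · simp [uP, hs1, hc1, hs]

omit H in
lemma uP_one (z : ℂ) (s : S) : aeval z (uP k w 1 s) = 1 := by simp [uP]

omit H in
lemma rat_two {z : ℂ} {k : ℕ} (hz : z ^ 2 + z + (6 * k + 1) = 0) (j : ℕ) :
    ∃ q : ℚ, ∑ i : Fin 2, ((![z, -1 - z] : Fin 2 → ℂ) i) ^ j = (q : ℂ) := by
  simp only [Fin.sum_univ_two, Matrix.cons_val_zero, Matrix.cons_val_one]
  induction j using Nat.twoStepInduction with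
  | zero => exact ⟨2, by norm_num⟩
  | one => exact ⟨-1, by push_cast; ring⟩
  | more n h1 h2 =>
    obtain ⟨a, ha⟩ := h1
    obtain ⟨b, hb⟩ := h2
    refine ⟨- b - (6 * k + 1) * a, ?_⟩
    push_cast
    rw [← ha, ← hb]
    linear_combination (z ^ n + (-1 - z) ^ n) * hz

omit H in
lemma z_ne {z : ℂ} {k : ℕ} (hz : z ^ 2 + z + (6 * k + 1) = 0) : z ≠ -1 - z := by
  intro h
  have h2 : z = -1 / 2 := by linear_combination h / 2
  rw [h2] at hz
  have : (24 * k + 3 : ℂ) = 0 := by linear_combination 4 * hz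
  have h3 : (24 * k + 3 : ℕ) ≠ 0 := by omega
  exact h3 (by exact_mod_cast this)

lemma Good.uP_ne {z : ℂ} (hz : z ^ 2 + z + (6 * k + 1) = 0) {c : S} (hc : c ^ 3 = 1) (hc1 : c ≠ 1) :
    aeval z (uP k w c c) ≠ aeval z (uP k w c c⁻¹) := by
  classical
  have : ¬ IsConj c c⁻¹ := by
    rcases H.c_cases hc hc1 hc hc1 with h | h
    · exact h.2.2
    · exact absurd (IsConj.refl c) h.2.2
  simp only [uP, if_neg hc1, if_neg (inv_ne_one.2 hc1), hc, inv_pow, inv_one, if_pos, IsConj.refl c, if_true, if_neg this]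
  simpa using z_ne hz

end CaseU2

end RC

end


section
set_option linter.unusedSectionVars false
namespace RC

open Finset Polynomial

section CM

variable {S : Type} [Group S] [Fintype S] [IsSimpleGroup S] {G : Type} [Group G] [Fintype G] {n : ℕ}

lemma alpha_iota {ι : (Fin n → S) →* G} (hι : Function.Injective ι)
    {α : G →* MulAut (Fin n → S)} (hα : ∀ g s, ι (α g s) = g * ι s * g⁻¹) (p s : Fin n → S) :
    α (ι p) s = p * s * p⁻¹ := by
  apply hι
  rw [hα, map_mul, map_mul, map_inv]

lemma stabW {k : ℕ} {v w : S} (H : Good S k v w) (hna : ∃ a b : S, a * b ≠ b * a)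
    {ι : (Fin n → S) →* G} (hι : Function.Injective ι)
    {α : G →* MulAut (Fin n → S)} (hα : ∀ g s, ι (α g s) = g * ι s * g⁻¹) :
    ∃ K0 : Subgroup G, (∀ p, ι p ∈ K0 ↔ ∀ k, p k ∈ Subgroup.centralizer {w}) ∧
      ∀ g, ∃ p, ∃ k ∈ K0, g = ι p * k := by
  let W : Fin n → S := fun _ => w
  let K0 : Subgroup G :=
    { carrier := {g | α g W = W}
      one_mem' := by simp
      mul_mem' := by
        intro a b ha hb
        simp only [Set.mem_ofPred_eq] at *
        rw [map_mul, MulAut.mul_apply, hb, ha]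
      inv_mem' := by
        intro a ha
        simp only [Set.mem_ofPred_eq] at *
        conv_lhs => rw [← ha]
        rw [← MulAut.mul_apply, ← map_mul]; simp }
  have hmem : ∀ g, g ∈ K0 ↔ α g W = W := fun g => Iff.rfl
  refine ⟨K0, fun p => ?_, fun g => ?_⟩
  · rw [hmem, alpha_iota hι hα, funext_iff]
    refine forall_congr' fun j => ?_
    rw [memC]
    simp only [Pi.mul_apply, Pi.inv_apply, W]
    rw [mul_inv_eq_iff_eq_mul]
  · obtain ⟨π, a, ha⟩ := pi_aut hna (α g)
    have hc : ∀ j, ∃ c, c * w * c⁻¹ = α g W j := by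
      intro j
      refine isConj_iff.1 (H.inv _ ?_ ?_)
      · rw [ha, ← map_mul]; simp [W, H.w2]
      · rw [ha]; simpa [W] using H.w1
    choose p hp using hc
    refine ⟨p, (ι p)⁻¹ * g, ?_, by group⟩
    have : α g W = α (ι p) W := by
      rw [alpha_iota hι hα]
      funext j
      rw [← hp]; rfl
    rw [hmem, map_mul, MulAut.mul_apply, this, ← MulAut.mul_apply, ← map_mul]; simp

lemma ip_one_one : ip (1 : S → ℂ) 1 = 1 := by
  rw [ip]
  simp only [Pi.one_apply, mul_one, sum_const, card_univ, nsmul_eq_mul, ← Nat.card_eq_fintype_card]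
  exact inv_mul_cancel₀ card_ne

lemma ip_pc_one (K : Subgroup S) : ip (pc K) 1 = 1 := by
  classical
  rw [ip, pc]
  simp only [Pi.one_apply, mul_one, ind]
  rw [← mul_sum, sum_comm]
  have : ∀ s : S, ∑ g : S, (if s⁻¹ * g * s ∈ K then (1:ℂ) else 0) = Nat.card K := by
    intro s
    rw [← Equiv.sum_comp (MulAut.conj s).toEquiv]
    simp only [MulEquiv.toEquiv_eq_coe, EquivLike.coe_coe, MulAut.conj_apply]
    simp only [show ∀ g : S, s⁻¹ * (s * g * s⁻¹) * s = g by intro g; group]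
    rw [sum_boole, ← Fintype.card_subtype, Nat.card_eq_fintype_card]
  simp only [this, sum_const, card_univ, nsmul_eq_mul]
  rw [← Nat.card_eq_fintype_card (α := S)]
  have h1 : (Nat.card S : ℂ) ≠ 0 := card_ne
  have h2 : (Nat.card K : ℂ) ≠ 0 := card_ne
  field_simp

abbrev Concl (G : Type) [Group G] [Fintype G] : Prop :=
  ∃ χ : G → ℂ, ∃ m : ℕ, IsChar χ ∧ ip χ χ = 1 ∧ (∀ g, ∃ q : ℚ, χ g = q) ∧ χ 1 = m ∧ Even m

variable {k : ℕ} {v w : S} (H : Good S k v w) (hna : ∃ a b : S, a * b ≠ b * a)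
    {ι : (Fin n → S) →* G} (hι : Function.Injective ι)
    {α : G →* MulAut (Fin n → S)} (hα : ∀ g s, ι (α g s) = g * ι s * g⁻¹)
include H hna hι hα

theorem caseU (y : Fin n → S) (hy3 : y ^ 3 = 1) (hy1 : y ≠ 1) (hinv : ∃ h, α h y = y⁻¹) :
    Concl G := by
  classical
  obtain ⟨K0, hK, hG⟩ := stabW H hna hι hα
  obtain ⟨Γ, z, hΓ, hz, h1, h2, h3, h4⟩ := H.gamma
  have hex : ∃ (Γ : S → ℂ), IsChar Γ ∧
    Γ 1 = (12 * k + 1) * (24 * k + 4) ∧ (∀ s, IsConj v s → Γ s = z) ∧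
    (∀ s, IsConj v⁻¹ s → Γ s = -1 - z) ∧ ∀ s, s ^ 3 ≠ 1 → Γ s = 0 := ⟨Γ, hΓ, h1, h2, h3, h4⟩
  have hyk : ∀ j, y j ^ 3 = 1 := fun j => congrFun hy3 j
  have hf := fun j (hj : y j ≠ 1) => H.uP_facts hz hex (hyk j) hj
  have e1 : ∀ j, y j = 1 → (fun s => aeval z (uP k w (y j) s)) = 1 := by
    intro j hj; funext s; rw [hj, uP_one]; rfl
  have hdeg : ∀ j, aeval z (uP k w (y j) 1) = ((if y j = 1 then 1 else 12 * k + 1 : ℕ) : ℂ) := by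
    intro j
    split_ifs with h
    · rw [h, uP_one]; simp
    · exact (hf j h).2.2.1
  refine assemble hna ι α hα (uP k w) (fun φ c s => H.uP_aut φ c s) y z
    (fun j => if y j = 1 then 1 else 12 * k + 1) (fun j => by split_ifs <;> omega)
    ?_ ?_ hdeg (I := Fin 2) ![z, -1 - z] (rat_two hz) ?_ (Subgroup.centralizer {w}) K0 hK hG ?_ (Or.inr ⟨hinv, ?_, ?_⟩)
  · intro j
    by_cases h : y j = 1
    · rw [e1 j h]; exact IsChar.one
    · exact (hf j h).1
  · intro j
    by_cases h : y j = 1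
    · rw [e1 j h]; exact ip_one_one
    · exact (hf j h).2.1
  · intro i
    fin_cases i
    · exact ⟨1, ⟨1, by simp⟩, fun j s => by simp⟩
    · refine ⟨2, ?_, fun j s => ?_⟩
      · obtain ⟨h, hh⟩ := hinv
        refine ⟨h, ?_⟩
        rw [hh, inv_eq_iff_mul_eq_one, ← pow_succ', hy3]
      · exact H.uP_gal (hyk j) s z
  · intro j
    by_cases h : y j = 1
    · rw [e1 j h]; exact ip_pc_one _
    · exact (hf j h).2.2.2
  · intro j s
    rw [H.uP_inv (hyk j)]
  · obtain ⟨j, hj⟩ := Function.ne_iff.1 hy1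
    refine ⟨Pi.mulSingle j (y j), ?_⟩
    have key : ∀ s : S, ∏ i, aeval z (uP k w (y i) ((Pi.mulSingle j s : Fin n → S) i)) =
        aeval z (uP k w (y j) s) * ∏ i ∈ univ.erase j, aeval z (uP k w (y i) 1) := by
      intro s
      rw [← mul_prod_erase univ _ (mem_univ j), Pi.mulSingle_eq_same]
      congr 1
      exact prod_congr rfl fun i hi => by rw [Pi.mulSingle_eq_of_ne (ne_of_mem_erase hi)]
    have key2 : ∏ i, aeval z (uP k w (y i) ((Pi.mulSingle j (y j) : Fin n → S) i)⁻¹) =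
      ∏ i, aeval z (uP k w (y i) ((Pi.mulSingle j (y j)⁻¹ : Fin n → S) i)) := by
      refine prod_congr rfl fun i _ => ?_
      rw [Pi.mulSingle_inv]; rfl
    rw [key2, key, key]
    intro h
    refine H.uP_ne hz (hyk j) hj (mul_right_cancel₀ ?_ h)
    rw [prod_ne_zero_iff]
    intro i _
    rw [hdeg]
    split_ifs
    · simp
    · exact Nat.cast_ne_zero.2 (by omega)

theorem caseD {r : ℕ} (hr : r.Prime) (h5 : 5 ≤ r) (y : Fin n → S) (hyk : ∀ j, y j ≠ 1 → orderOf (y j) = r) (hy1 : y ≠ 1)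
    (hrat : ∀ m : ℕ, m.Coprime r → ∃ h, α h y = y ^ m) (d : ℕ) (hd : 0 < d) (hde : Even d)
    (K : Subgroup S) (K0 : Subgroup G) (hK : ∀ p, ι p ∈ K0 ↔ ∀ k, p k ∈ K)
    (hG : ∀ g, ∃ p, ∃ k ∈ K0, g = ι p * k) {ζ : ℂ} (hζ : IsPrimitiveRoot ζ r)
    (hf : ∀ j, y j ≠ 1 →  IsChar (fun s => aeval ζ (thP k (y j) s)) ∧
    ip (fun s => aeval ζ (thP k (y j) s)) (fun s => aeval ζ (thP k (y j) s)) = 1 ∧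
    aeval ζ (thP k (y j) 1) = (d : ℂ) ∧
    ip (pc K) (fun s => aeval ζ (thP k (y j) s)) = 1) : Concl G := by
  classical
  have e1 : ∀ j, y j = 1 → (fun s => aeval ζ (thP k (y j) s)) = 1 := by
    intro j hj; funext s; rw [hj, thP_one]; rfl
  have : Nonempty (Fin (r - 1)) := ⟨⟨0, by omega⟩⟩
  refine assemble hna ι α hα (thP k) (fun φ c s => thP_aut k φ c s) y ζ
    (fun j => if y j = 1 then 1 else d) (fun j => by split_ifs <;> omega)
    ?_ ?_ ?_ (I := Fin (r - 1)) (fun i => ζ ^ (i.1 + 1)) (rat_powers hr h5 hζ) ?_ K K0 hK hG ?_ (Or.inl ?_)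
  · intro j
    by_cases h : y j = 1
    · rw [e1 j h]; exact IsChar.one
    · exact (hf j h).1
  · intro j
    by_cases h : y j = 1
    · rw [e1 j h]; exact ip_one_one
    · exact (hf j h).2.1
  · intro j
    split_ifs with h
    · rw [h, thP_one]; simp
    · exact (hf j h).2.2.1
  · intro i
    have hco : Nat.Coprime (i.1 + 1) r :=
      (Nat.coprime_of_lt_prime (by omega) (by omega) hr).symm
    obtain ⟨m, hm⟩ := Nat.exists_mul_mod_eq_one_of_coprime hco (by omega)
    have hm' : (i.1 + 1) * m ≡ 1 [MOD r] := by
      rw [Nat.ModEq, hm.2, Nat.mod_eq_of_lt (by omega)]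
    refine ⟨m, hrat m ?_, fun j s => ?_⟩
    · have := Nat.ModEq.gcd_eq hm'
      rw [Nat.gcd_one_left] at this
      exact Nat.Coprime.coprime_mul_left this
    · by_cases h : y j = 1
      · rw [h, one_pow, thP_one, thP_one]
      · exact H.thP_gal hr h5 (hyk j h) hζ hm' s
  · intro j
    by_cases h : y j = 1
    · rw [e1 j h]; exact ip_pc_one _
    · exact (hf j h).2.2.2
  · obtain ⟨j, hj⟩ := Function.ne_iff.1 hy1
    refine ⟨j, ?_⟩
    simp only [Pi.one_apply] at hj
    rw [if_neg hj]; exact hde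

end CM
end RC

end


section
set_option linter.unusedSectionVars false
namespace RC

open Finset Polynomial

section CN1
variable {S : Type} [Group S] [Fintype S] {k : ℕ} {v w : S} (H : Good S k v w)
include H

lemma Good.cvw {q : S} (h1 : q * v = v * q) (h2 : q * w = w * q) : q = 1 := by
  have a1 : orderOf q ∣ 24 * k + 3 := by
    rw [← H.cv]; exact Subgroup.orderOf_dvd_natCard _ (memC.2 h1)
  have a2 : orderOf q ∣ 24 * k + 4 := by
    rw [← H.cw]; exact Subgroup.orderOf_dvd_natCard _ (memC.2 h2)
  have := (Nat.dvd_add_right a1).1 (show orderOf q ∣ 24 * k + 3 + 1 from a2)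
  rw [← orderOf_eq_one_iff]
  exact Nat.dvd_one.1 this

open Classical in
lemma Good.nonsplit_K : ∃ K : Subgroup S, Nat.card K = 12 * k + 2 ∧
    (∀ φ : MulAut S, φ v = v → φ w = w → ∀ g ∈ K, φ g ∈ K) ∧
    ∀ y : S, y ^ 2 ≠ 1 → y ^ 3 ≠ 1 → Nat.card (Subgroup.centralizer {y}) = 12 * k + 2 →
    ∀ χ : S → ℂ, (∀ s g, χ (s * g * s⁻¹) = χ g) → ∑ g with g ∈ K, χ g =
      ∑ g with g ∈ Subgroup.centralizer {y} ∧ g ^ (6 * k + 1) = 1, χ g + (6 * k + 1) * χ w := by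
  classical
  obtain ⟨T, K, hTc, hT, hwT, hTw, hd, hKm, hKc, -, -, hKs⟩ := H.dih
  refine ⟨K, hKc, ?_, ?_⟩
  · intro φ hv hw g hg
    rw [hKm] at hg ⊢
    refine ⟨?_, ?_⟩
    · have := congrArg φ hg.1
      simpa [hw] using this
    · rcases hg.2 with h | h
      · exact Or.inl (by rw [← map_pow, h, map_one])
      · refine Or.inr ?_
        have := congrArg φ h
        simpa [hw, hv] using this
  · intro y h2 h3 hc χ hχ
    rw [hKs χ hχ]
    congr 1
    -- find involution in C(y)
    obtain ⟨t, ht⟩ := exists_prime_orderOf_dvd_card' (G := Subgroup.centralizer {y}) 2 (by rw [hc]; omega)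
    have ht2 : (t.1) * t.1 = 1 := by
      have := pow_orderOf_eq_one t
      rw [ht, pow_two] at this
      exact congrArg Subtype.val this
    have ht1 : t.1 ≠ 1 := by
      intro h
      have : t = 1 := Subtype.ext h
      rw [this, orderOf_one] at ht; omega
    obtain ⟨g, hg⟩ := isConj_iff.1 (H.inv t.1 ht2 ht1)
    have hty := memC.1 t.2
    set y' := g⁻¹ * y * g with hy'
    have hyy : y = g * y' * g⁻¹ := by rw [hy']; group
    have hc' : y' * w = w * y' := by
      have : g * (y' * w) * g⁻¹ = g * (w * y') * g⁻¹ := by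
        calc g * (y' * w) * g⁻¹ = y * (g * w * g⁻¹) := by rw [hy']; group
          _ = (g * w * g⁻¹) * y := by rw [hg]; exact hty.symm
          _ = _ := by rw [hy']; group
      simpa using this
    have hyT : y' ∈ T := by
      by_contra h
      have := hd y' hc' h
      apply h2
      rw [hyy, conj_pow, pow_two, this]; simp
    have hcomm : ∀ a ∈ T, ∀ b ∈ T, a * b = b * a := by
      intro a ha b hb
      have := (IsCyclic.commGroup (α := T)).mul_comm ⟨a, ha⟩ ⟨b, hb⟩
      exact congrArg Subtype.val this
    have hcard : Nat.card (Subgroup.centralizer {y'}) = 12 * k + 2 := by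
      rw [← hc, hyy]
      exact (card_cent_aut (MulAut.conj g) y').symm
    have hTC : T = Subgroup.centralizer {y'} := by
      apply Subgroup.eq_of_le_of_card_ge
      · intro a ha
        exact memC.2 (hcomm a ha _ hyT)
      · rw [hT, hcard]
    refine sum_bij (fun a _ => g * a * g⁻¹) ?_ ?_ ?_ ?_
    · intro a ha
      simp only [mem_filter, mem_univ, true_and] at ha ⊢
      rw [hTC, memC] at ha
      refine ⟨memC.2 ?_, by rw [conj_pow, ha.2]; simp⟩
      rw [hyy, show g * a * g⁻¹ * (g * y' * g⁻¹) = g * (a * y') * g⁻¹ by group, ha.1]; group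
    · intro a _ b _ h
      simpa using h
    · intro b hb
      simp only [mem_filter, mem_univ, true_and] at hb
      refine ⟨g⁻¹ * b * g, ?_, by group⟩
      simp only [mem_filter, mem_univ, true_and]
      have hb1 := memC.1 hb.1
      rw [hTC, memC]
      refine ⟨?_, ?_⟩
      · rw [hy', show g⁻¹ * b * g * (g⁻¹ * y * g) = g⁻¹ * (b * y) * g by group, hb1]; group
      · have := conj_pow (a := g⁻¹) (b := b) (i := 6 * k + 1)
        rw [inv_inv] at this
        rw [this, hb.2]; simp
    · intro a _
      exact (hχ g a).symm

end CN1

section CN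

variable {S : Type} [Group S] [Fintype S] [IsSimpleGroup S] {G : Type} [Group G] [Fintype G] {n : ℕ}
variable {k : ℕ} {v w : S} (H : Good S k v w) (hna : ∃ a b : S, a * b ≠ b * a)
    {ι : (Fin n → S) →* G} (hι : Function.Injective ι)
    {α : G →* MulAut (Fin n → S)} (hα : ∀ g s, ι (α g s) = g * ι s * g⁻¹)
include H hna hι hα

theorem caseSplit {r : ℕ} (hr : r.Prime) (h5 : 5 ≤ r) (y : Fin n → S)
    (hyk : ∀ j, y j ≠ 1 → orderOf (y j) = r) (hy1 : y ≠ 1)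
    (hrat : ∀ m : ℕ, m.Coprime r → ∃ h, α h y = y ^ m)
    (hs : ∀ j, y j ≠ 1 → Nat.card (Subgroup.centralizer {y j}) = 12 * k + 1) : Concl G := by
  obtain ⟨K0, hK, hG⟩ := stabW H hna hι hα
  have hζ := Complex.isPrimitiveRoot_exp r (by omega)
  exact caseD H hna hι hα hr h5 y hyk hy1 hrat (24 * k + 4) (by omega) ⟨12 * k + 2, by ring⟩
    (Subgroup.centralizer {w}) K0 hK hG hζ
    (fun j hj => H.thP_split hr h5 (hyk j hj) hζ (hs j hj))

lemma exists_K0 (K : Subgroup S) (hKa : ∀ φ : MulAut S, φ v = v → φ w = w → ∀ g ∈ K, φ g ∈ K)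
    (hor : ∀ g j, IsConj v (α g (fun _ => v) j)) :
    ∃ K0 : Subgroup G, (∀ p, ι p ∈ K0 ↔ ∀ k, p k ∈ K) ∧ ∀ g, ∃ p, ∃ k ∈ K0, g = ι p * k := by
  let W : Fin n → S := fun _ => w
  let V : Fin n → S := fun _ => v
  let C : Subgroup G :=
    { carrier := {g | α g W = W ∧ α g V = V}
      one_mem' := by simp
      mul_mem' := by
        intro a b ha hb
        simp only [Set.mem_ofPred_eq] at *
        rw [map_mul, MulAut.mul_apply, MulAut.mul_apply, hb.1, hb.2]; exact ha
      inv_mem' := by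
        intro a ha
        simp only [Set.mem_ofPred_eq] at *
        constructor
        · conv_lhs => rw [← ha.1]
          rw [← MulAut.mul_apply, ← map_mul]; simp
        · conv_lhs => rw [← ha.2]
          rw [← MulAut.mul_apply, ← map_mul]; simp }
  have hmem : ∀ g, g ∈ C ↔ α g W = W ∧ α g V = V := fun g => Iff.rfl
  have hCK : ∀ c ∈ C, ∀ p : Fin n → S, (∀ j, p j ∈ K) → ∀ j, α c p j ∈ K := by
    intro c hc p hp j
    obtain ⟨π, a, ha⟩ := pi_aut hna (α c)
    rw [ha]
    refine hKa (a j) ?_ ?_ _ (hp _)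
    · have := congrFun hc.2 j
      rwa [ha] at this
    · have := congrFun hc.1 j
      rwa [ha] at this
  have hcι : ∀ c s, c * ι s = ι (α c s) * c := by
    intro c s; rw [hα]; group
  let K0 : Subgroup G :=
    { carrier := {g | ∃ p, (∀ j, p j ∈ K) ∧ ∃ c ∈ C, g = ι p * c}
      one_mem' := ⟨1, fun _ => K.one_mem, 1, C.one_mem, by simp⟩
      mul_mem' := by
        rintro _ _ ⟨p, hp, c, hc, rfl⟩ ⟨p', hp', c', hc', rfl⟩
        refine ⟨p * α c p', fun j => K.mul_mem (hp j) (hCK c hc p' hp' j), c * c',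
          C.mul_mem hc hc', ?_⟩
        rw [map_mul, mul_assoc, ← mul_assoc c, hcι]; simp only [mul_assoc]
      inv_mem' := by
        rintro _ ⟨p, hp, c, hc, rfl⟩
        refine ⟨α c⁻¹ p⁻¹, hCK _ (C.inv_mem hc) _ (fun j => K.inv_mem (hp j)), c⁻¹, C.inv_mem hc, ?_⟩
        rw [← hcι]; simp }
  have hmem0 : ∀ g, g ∈ K0 ↔ ∃ p, (∀ j, p j ∈ K) ∧ ∃ c ∈ C, g = ι p * c := fun g => Iff.rfl
  refine ⟨K0, fun p => ⟨?_, fun hp => ⟨p, hp, 1, C.one_mem, by simp⟩⟩, fun g => ?_⟩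
  · rintro ⟨p', hp', c, hc, hpc⟩
    have hc2 : c = ι (p'⁻¹ * p) := by rw [map_mul, map_inv, hpc]; group
    have : p'⁻¹ * p = 1 := by
      rw [hc2, hmem, alpha_iota hι hα, alpha_iota hι hα] at hc
      funext j
      refine H.cvw ?_ ?_
      · have := congrFun hc.2 j
        simp only [Pi.mul_apply _ (p'⁻¹ * p)⁻¹, Pi.mul_apply _ V, Pi.inv_apply (p'⁻¹ * p)] at this
        rwa [mul_inv_eq_iff_eq_mul] at this
      · have := congrFun hc.1 j
        simp only [Pi.mul_apply _ (p'⁻¹ * p)⁻¹, Pi.mul_apply _ W, Pi.inv_apply (p'⁻¹ * p)] at this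
        rwa [mul_inv_eq_iff_eq_mul] at this
    rw [inv_mul_eq_one] at this
    rw [← this]; exact hp'
  · obtain ⟨π, a, ha⟩ := pi_aut hna (α g)
    have hc : ∀ j, ∃ c, α g W j = c * w * c⁻¹ ∧ α g V j = c * v * c⁻¹ := by
      intro j
      refine H.torsor _ _ ?_ ?_ (hor g j) ?_
      · rw [ha, ← map_mul]; simp [W, H.w2]
      · rw [ha]; simpa [W] using H.w1
      · rw [ha, ha, ← map_mul, ← map_pow]; simp [W, V, H.wv]
    choose p hp1 hp2 using hc
    refine ⟨p, (ι p)⁻¹ * g, ⟨1, fun _ => K.one_mem, (ι p)⁻¹ * g, ?_, by simp⟩, by group⟩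
    have e1 : α g W = α (ι p) W := by
      rw [alpha_iota hι hα]
      funext j
      rw [hp1]; rfl
    have e2 : α g V = α (ι p) V := by
      rw [alpha_iota hι hα]
      funext j
      rw [hp2]; rfl
    rw [hmem, map_mul, MulAut.mul_apply, MulAut.mul_apply, e1, e2, ← MulAut.mul_apply,
      ← MulAut.mul_apply, ← map_mul]
    simp

theorem caseNonsplit' {r : ℕ} (hr : r.Prime) (h5 : 5 ≤ r) (y : Fin n → S)
    (hyk : ∀ j, y j ≠ 1 → orderOf (y j) = r) (hy1 : y ≠ 1)
    (hrat : ∀ m : ℕ, m.Coprime r → ∃ h, α h y = y ^ m)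
    (hs : ∀ j, y j ≠ 1 → Nat.card (Subgroup.centralizer {y j}) = 12 * k + 2)
    (hor : ∀ g j, IsConj v (α g (fun _ => v) j)) : Concl G := by
  obtain ⟨K, hKc, hKa, hKs⟩ := H.nonsplit_K
  obtain ⟨K0, hK, hG⟩ := exists_K0 H hna hι hα K hKa hor
  have hζ := Complex.isPrimitiveRoot_exp r (by omega)
  exact caseD H hna hι hα hr h5 y hyk hy1 hrat (24 * k + 2) (by omega) ⟨12 * k + 1, by ring⟩
    K K0 hK hG hζ
    (fun j hj => H.thP_nonsplit hr h5 (hyk j hj) hζ (hs j hj) hKc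
      (hKs _ (ord_ne hr h5 (hyk j hj)).2.1 (ord_ne hr h5 (hyk j hj)).2.2 (hs j hj)))

/-- choice of orientation -/
lemma exists_orient (hU : ∀ u : Fin n → S, u ^ 3 = 1 → u ≠ 1 → ∀ h, α h u ≠ u⁻¹) :
    ∃ c : Fin n → MulAut S, ∀ g j, IsConj (c j v) (α g (fun i => c i v) j) := by
  classical
  obtain ⟨δ, hδ⟩ := H.delta
  let e := Fintype.equivFin (Fin n → S)
  let μ : (Fin n → S) → ℕ := fun s => sInf {m | ∃ g, m = (e (α g s)).1}
  have hne : ∀ s, {m | ∃ g, m = (e (α g s)).1}.Nonempty := fun s => ⟨_, 1, rfl⟩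
  have hμ : ∀ h s, μ (α h s) = μ s := by
    intro h s
    refine congrArg sInf ?_
    ext m
    constructor
    · rintro ⟨g, rfl⟩
      exact ⟨g * h, by rw [map_mul]; rfl⟩
    · rintro ⟨g, rfl⟩
      refine ⟨g * h⁻¹, ?_⟩
      rw [← MulAut.mul_apply, ← map_mul, inv_mul_cancel_right]
  have hμ2 : ∀ s t, μ s = μ t → ∃ h, α h s = t := by
    intro s t h
    obtain ⟨g, hg⟩ := Nat.sInf_mem (hne s)
    obtain ⟨g', hg'⟩ := Nat.sInf_mem (hne t)
    have : (e (α g s)).1 = (e (α g' t)).1 := by rw [← hg, ← hg']; exact h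
    have := e.injective (Fin.ext this)
    refine ⟨g'⁻¹ * g, ?_⟩
    rw [map_mul, MulAut.mul_apply, this, ← MulAut.mul_apply, ← map_mul]; simp
  have v3 := H.v3
  have hvs : ∀ j : Fin n, μ (Pi.mulSingle j v) ≠ μ (Pi.mulSingle j v⁻¹) := by
    intro j h
    obtain ⟨h, hh⟩ := hμ2 _ _ h
    refine hU (Pi.mulSingle j v) ?_ ?_ h ?_
    · rw [← Pi.mulSingle_pow, v3, Pi.mulSingle_one]
    · rw [Ne, Pi.mulSingle_eq_one_iff]; exact H.v1
    · rw [hh, Pi.mulSingle_inv]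
  let c : Fin n → MulAut S := fun j => if μ (Pi.mulSingle j v) < μ (Pi.mulSingle j v⁻¹) then 1 else δ
  have hpos : ∀ j, μ (Pi.mulSingle j (c j v)) < μ (Pi.mulSingle j (c j v)⁻¹) := by
    intro j
    simp only [c]
    split_ifs with h
    · exact h
    · rw [hδ, inv_inv]
      have := hvs j
      omega
  refine ⟨c, fun g j => ?_⟩
  obtain ⟨π, a, ha⟩ := pi_aut hna (α g)
  rw [ha]
  set t := a j (c (π j) v) with ht
  have hsing : α g (Pi.mulSingle (π j) (c (π j) v)) = Pi.mulSingle j t := by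
    funext i
    rw [ha]
    by_cases h : i = j
    · subst h; simp [ht]
    · rw [Pi.mulSingle_eq_of_ne h, Pi.mulSingle_eq_of_ne (fun h' => h (π.injective h')), map_one]
  have hsing' : α g (Pi.mulSingle (π j) (c (π j) v)⁻¹) = Pi.mulSingle j t⁻¹ := by
    rw [Pi.mulSingle_inv, map_inv, hsing, Pi.mulSingle_inv]
  have htpos : μ (Pi.mulSingle j t) < μ (Pi.mulSingle j t⁻¹) := by
    rw [← hsing, ← hsing', hμ, hμ]; exact hpos _
  have hcj : ∀ a b : S, IsConj a b → IsConj (c j a) (c j b) := by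
    intro a b h
    obtain ⟨g, rfl⟩ := isConj_iff.1 h
    exact isConj_iff.2 ⟨c j g, by simp⟩
  have hconj : ∀ a b : S, IsConj a b → μ (Pi.mulSingle j a) = μ (Pi.mulSingle j b) := by
    intro a b h
    obtain ⟨q, rfl⟩ := isConj_iff.1 h
    rw [← hμ (ι (Pi.mulSingle j q)), alpha_iota hι hα]
    congr 1
    rw [← Pi.mulSingle_inv, ← Pi.mulSingle_mul, ← Pi.mulSingle_mul]
  have ht3 : ((c j).symm t) ^ 3 = 1 := by
    rw [ht, ← map_pow, ← map_pow, ← map_pow, v3]; simp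
  rcases H.ord3 _ ht3 with h | h | h
  · exfalso
    have : t = 1 := by simpa using h
    rw [this, inv_one] at htpos
    exact lt_irrefl _ htpos
  · have := hcj _ _ h
    simpa using this
  · exfalso
    have h1 := hcj _ _ h
    simp only [map_inv, MulEquiv.apply_symm_apply] at h1
    have h2 : IsConj (c j v) t⁻¹ := by
      obtain ⟨q, hq⟩ := isConj_iff.1 h1
      exact isConj_iff.2 ⟨q, by rw [← hq]; group⟩
    rw [← hconj _ _ h1, ← hconj _ _ h2] at htpos
    have := hpos j
    omega

theorem caseNonsplit {r : ℕ} (hr : r.Prime) (h5 : 5 ≤ r) (y : Fin n → S)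
    (hyk : ∀ j, y j ≠ 1 → orderOf (y j) = r) (hy1 : y ≠ 1)
    (hrat : ∀ m : ℕ, m.Coprime r → ∃ h, α h y = y ^ m)
    (hs : ∀ j, y j ≠ 1 → Nat.card (Subgroup.centralizer {y j}) = 12 * k + 2)
    (hU : ∀ u : Fin n → S, u ^ 3 = 1 → u ≠ 1 → ∀ h, α h u ≠ u⁻¹) : Concl G := by
  obtain ⟨c, hc⟩ := exists_orient H hna hι hα hU
  let e : MulAut (Fin n → S) := MulEquiv.piCongrRight c
  have he : ∀ s j, e s j = c j (s j) := fun s j => rfl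
  have hes : ∀ s j, e.symm s j = (c j).symm (s j) := fun s j => rfl
  refine caseNonsplit' H hna (ι := ι.comp e.toMonoidHom) (α := (MulAut.conj e⁻¹).toMonoidHom.comp α) ?_ ?_ hr h5 (e.symm y) ?_ ?_ ?_ ?_ ?_
  · exact hι.comp e.injective
  · intro g s
    have : ι (e ((e⁻¹ * α g * e⁻¹⁻¹) s)) = g * ι (e s) * g⁻¹ := by
      rw [← hα]; simp
    exact this
  · intro j hj
    rw [hes] at hj ⊢
    rw [orderOf_aut]
    exact hyk j (by simpa using hj)
  · intro h
    exact hy1 (by simpa using h)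
  · intro m hm
    obtain ⟨h, hh⟩ := hrat m hm
    refine ⟨h, ?_⟩
    have : (e⁻¹ * α h * e⁻¹⁻¹) (e.symm y) = (e.symm y) ^ m := by
      rw [← map_pow, ← hh]; simp
    exact this
  · intro j hj
    rw [hes] at hj ⊢
    rw [card_cent_aut]
    exact hs j (by simpa using hj)
  · intro g j
    have h1 := hc g j
    have : IsConj v (e.symm (α g (e (fun _ => v))) j) := by
      rw [hes]
      obtain ⟨q, hq⟩ := isConj_iff.1 h1
      have e2 : (e fun _ => v) = fun i => c i v := rfl
      rw [e2, ← hq]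
      exact isConj_iff.2 ⟨(c j).symm q, by simp⟩
    exact this

theorem main_good (x : Fin n → S) (hx1 : x ≠ 1) (hodd : Odd (orderOf x))
    (hrat : ∀ m : ℕ, m.Coprime (orderOf x) → ∃ h, α h x = x ^ m) : Concl G := by
  classical
  by_cases hU : ∀ u : Fin n → S, u ^ 3 = 1 → u ≠ 1 → ∀ h, α h u ≠ u⁻¹
  swap
  · push Not at hU
    obtain ⟨u, h3, h1, h, hh⟩ := hU
    exact caseU H hna hι hα u h3 h1 ⟨h, hh⟩
  have ho : 0 < orderOf x := orderOf_pos x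
  by_cases hr : ∃ r, r.Prime ∧ 5 ≤ r ∧ r ∣ orderOf x
  · obtain ⟨r, hr, h5, hdv⟩ := hr
    set y := x ^ (orderOf x / r) with hy
    have hyo : orderOf y = r := orderOf_pow_orderOf_div ho.ne' hdv
    have hy1 : y ≠ 1 := by
      intro h; rw [h, orderOf_one] at hyo; omega
    have hyr : ∀ m : ℕ, m.Coprime r → ∃ h, α h y = y ^ m := by
      intro m hm
      have : NeZero (orderOf x) := ⟨ho.ne'⟩
      obtain ⟨u, hu⟩ := ZMod.unitsMap_surjective hdv (ZMod.unitOfCoprime m hm)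
      obtain ⟨h, hh⟩ := hrat (u : ZMod (orderOf x)).val (ZMod.val_coe_unit_coprime u)
      refine ⟨h, ?_⟩
      rw [hy, map_pow, hh, ← pow_mul, mul_comm, pow_mul, ← hy]
      rw [pow_eq_pow_iff_modEq, hyo, ← ZMod.natCast_eq_natCast_iff]
      have := congrArg Units.val hu
      rw [ZMod.unitsMap_val, ZMod.coe_unitOfCoprime] at this
      rw [← this, ZMod.natCast_val]
    have hyk : ∀ j, y j ≠ 1 → orderOf (y j) = r := by
      intro j hj
      have : y j ^ r = 1 := by
        have := congrFun (pow_orderOf_eq_one y) j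
        rwa [hyo] at this
      exact (Nat.dvd_prime hr).1 (orderOf_dvd_of_pow_eq_one this) |>.resolve_left
        (fun h => hj (orderOf_eq_one_iff.1 h))
    have hcyc : ∀ j, y j ≠ 1 → _ := fun j hj =>
      (H.cyc (y j) (ord_ne hr h5 (hyk j hj)).2.1 (ord_ne hr h5 (hyk j hj)).2.2).2
    have hdvd : ∀ j, y j ≠ 1 → r ∣ Nat.card (Subgroup.centralizer {y j}) :=
      fun j hj => r_dvd (hyk j hj)
    have hexcl : ¬ (r ∣ 12 * k + 1 ∧ r ∣ 12 * k + 2) := by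
      rintro ⟨h1, h2⟩
      have := (Nat.dvd_add_right h1).1 (show r ∣ 12 * k + 1 + 1 from h2)
      have := Nat.dvd_one.1 this
      omega
    by_cases hsp : r ∣ 12 * k + 1
    · refine caseSplit H hna hι hα hr h5 y hyk hy1 hyr fun j hj => ?_
      refine (hcyc j hj).resolve_right fun h => hexcl ⟨hsp, ?_⟩
      rw [← h]; exact hdvd j hj
    · refine caseNonsplit H hna hι hα hr h5 y hyk hy1 hyr (fun j hj => ?_) hU
      refine (hcyc j hj).resolve_left fun h => hsp ?_
      rw [← h]; exact hdvd j hj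
  · exfalso
    push Not at hr
    have hpr : ∀ p, p.Prime → p ∣ orderOf x → p = 3 := by
      intro p hp hd
      by_contra h3
      have h2 : p ≠ 2 := by
        rintro rfl
        exact (Nat.not_even_iff_odd.2 hodd) (even_iff_two_dvd.2 hd)
      have := hp.two_le
      have h4 : p ≠ 4 := by rintro rfl; revert hp; norm_num
      exact hr p hp (by omega) hd
    have hx3 : x ^ 3 = 1 := by
      funext j
      change x j ^ 3 = 1
      by_contra h3
      have hjo : orderOf (x j) ∣ orderOf x := orderOf_dvd_of_pow_eq_one (congrFun (pow_orderOf_eq_one x) j)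
      have hx1 : orderOf (x j) ≠ 1 := by
        intro h; rw [orderOf_eq_one_iff] at h; rw [h, one_pow] at h3; exact h3 rfl
      obtain ⟨p, hp, hpd⟩ := Nat.exists_prime_and_dvd hx1
      have hp3 := hpr p hp (hpd.trans hjo)
      have h2 : x j ^ 2 ≠ 1 := by
        intro h
        have h := orderOf_dvd_of_pow_eq_one h
        rw [Nat.dvd_prime Nat.prime_two] at h
        rcases h with h | h
        · exact hx1 h
        · exact (Nat.not_even_iff_odd.2 hodd) (even_iff_two_dvd.2 (h ▸ hjo))
      have hd : p ∣ Nat.card (Subgroup.centralizer {x j}) :=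
        hpd.trans (Subgroup.orderOf_dvd_natCard _ (memC.2 rfl))
      rw [hp3] at hd
      rcases (H.cyc (x j) h2 h3).2 with h | h <;> rw [h] at hd <;> omega
    have hox : orderOf x = 3 := orderOf_eq_prime hx3 hx1
    obtain ⟨h, hh⟩ := hrat 2 (by rw [hox]; norm_num)
    refine hU x hx3 hx1 h ?_
    rw [hh, eq_inv_iff_mul_eq_one, ← pow_succ, hx3]

end CN
end RC

end


section
set_option linter.unusedSectionVars false
namespace RC

open Finset

section PSLbasic

variable {F : Type} [Field F]

/-- element of `SL₂` given by its entries. -/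
def mm (a b c d : F) (h : a * d - b * c = 1) : SL2 F := ⟨!![a, b; c, d], by rw [Matrix.det_fin_two_of, h]⟩

lemma mm_mul (a b c d h a' b' c' d' h') : mm (F := F) a b c d h * mm a' b' c' d' h' =
    mm (a * a' + b * c') (a * b' + b * d') (c * a' + d * c') (c * b' + d * d') (by linear_combination (a' * d' - b' * c') * h + h') := by
  apply Subtype.ext
  change !![a, b; c, d] * !![a', b'; c', d'] = _
  rw [Matrix.mul_fin_two]; rfl

lemma exists_mm (A : SL2 F) : ∃ a b c d h, A = mm a b c d h := by
  refine ⟨A.1 0 0, A.1 0 1, A.1 1 0, A.1 1 1, ?_, ?_⟩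
  · rw [← Matrix.det_fin_two, A.2]
  · apply Subtype.ext
    exact Matrix.eta_fin_two A.1

lemma mm_inj {a b c d h a' b' c' d' h'} : mm (F := F) a b c d h = mm a' b' c' d' h' ↔
    a = a' ∧ b = b' ∧ c = c' ∧ d = d' := by
  constructor
  · intro e
    have e := congrArg Subtype.val e
    change !![a, b; c, d] = !![a', b'; c', d'] at e
    refine ⟨?_, ?_, ?_, ?_⟩
    · simpa using congrFun (congrFun e 0) 0
    · simpa using congrFun (congrFun e 0) 1
    · simpa using congrFun (congrFun e 1) 0
    · simpa using congrFun (congrFun e 1) 1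
  · rintro ⟨rfl, rfl, rfl, rfl⟩; rfl

lemma mm_one : (1 : SL2 F) = mm 1 0 0 1 (by ring) := by
  apply Subtype.ext
  exact Matrix.one_fin_two

lemma mm_center {a b c d : F} {h} : mm a b c d h ∈ Subgroup.center (SL2 F) ↔
    b = 0 ∧ c = 0 ∧ a = d ∧ (a = 1 ∨ a = -1) := by
  rw [Matrix.SpecialLinearGroup.mem_center_iff]
  constructor
  · rintro ⟨r, hr, e⟩
    change _ = !![a, b; c, d] at e
    have e00 := congrFun (congrFun e 0) 0
    have e01 := congrFun (congrFun e 0) 1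
    have e10 := congrFun (congrFun e 1) 0
    have e11 := congrFun (congrFun e 1) 1
    simp at e00 e01 e10 e11 hr
    subst e00 e01 e10 e11
    simpa using hr
  · rintro ⟨rfl, rfl, rfl, hr⟩
    refine ⟨a, ?_, ?_⟩
    · simpa using hr
    · change _ = !![a, 0; 0, a]
      ext i j; fin_cases i <;> fin_cases j <;> simp

/-- element of `PSL₂` given by its entries. -/
def P (a b c d : F) (h : a * d - b * c = 1) : PSL2 F := QuotientGroup.mk (mm a b c d h)

lemma P_mul (a b c d h a' b' c' d' h') : P (F := F) a b c d h * P a' b' c' d' h' =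
    P (a * a' + b * c') (a * b' + b * d') (c * a' + d * c') (c * b' + d * d') (by linear_combination (a' * d' - b' * c') * h + h') := by
  rw [P, P, P, ← mm_mul a b c d h a' b' c' d' h']; rfl

lemma exists_P (x : PSL2 F) : ∃ a b c d h, x = P a b c d h := by
  obtain ⟨A, rfl⟩ := QuotientGroup.mk_surjective x
  obtain ⟨a, b, c, d, h, rfl⟩ := exists_mm A
  exact ⟨a, b, c, d, h, rfl⟩

lemma P_one : (1 : PSL2 F) = P 1 0 0 1 (by ring) := by
  rw [P, ← mm_one]; rfl

lemma mm_inv {a b c d : F} {h} : (mm a b c d h)⁻¹ = mm d (-b) (-c) a (by linear_combination h) := by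
  rw [inv_eq_iff_mul_eq_one, mm_mul, mm_one, mm_inj]
  refine ⟨?_, ?_, ?_, ?_⟩ <;> grind

lemma P_inv {a b c d : F} {h} : (P a b c d h)⁻¹ = P d (-b) (-c) a (by linear_combination h) := by
  rw [P, P, ← mm_inv]; rfl

lemma P_eq {a b c d h a' b' c' d' h'} : P (F := F) a b c d h = P a' b' c' d' h' ↔
    (a = a' ∧ b = b' ∧ c = c' ∧ d = d') ∨ (a = -a' ∧ b = -b' ∧ c = -c' ∧ d = -d') := by
  rw [P, P, QuotientGroup.eq, mm_inv, mm_mul, mm_center]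
  constructor
  · rintro ⟨h1, h2, h3, h4 | h4⟩
    · left
      rw [h4] at h3
      refine ⟨?_, ?_, ?_, ?_⟩ <;> grind
    · right
      rw [h4] at h3
      refine ⟨?_, ?_, ?_, ?_⟩ <;> grind
  · rintro (⟨rfl, rfl, rfl, rfl⟩ | ⟨rfl, rfl, rfl, rfl⟩)
    · exact ⟨by ring, by ring, by ring, Or.inl (by linear_combination h)⟩
    · exact ⟨by ring, by ring, by ring, Or.inr (by linear_combination -h)⟩

lemma P_eq_one {a b c d : F} {h} : P a b c d h = 1 ↔ b = 0 ∧ c = 0 ∧ a = d := by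
  rw [P_one, P_eq]
  constructor
  · rintro (⟨rfl, rfl, rfl, rfl⟩ | ⟨rfl, rfl, rfl, rfl⟩) <;> simp
  · rintro ⟨rfl, rfl, rfl⟩
    have : (a - 1) * (a + 1) = 0 := by linear_combination h
    rcases mul_eq_zero.1 this with e | e
    · left; simp [sub_eq_zero.1 e]
    · right; simp [eq_neg_of_add_eq_zero_left e]

lemma conj_iff {g x y : PSL2 F} : g * x * g⁻¹ = y ↔ g * x = y * g := mul_inv_eq_iff_eq_mul

lemma P_congr {a b c d a' b' c' d' : F} {h} (h1 : a = a') (h2 : b = b') (h3 : c = c') (h4 : d = d') :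
    P a b c d h = P a' b' c' d' (by rw [← h1, ← h2, ← h3, ← h4]; exact h) := by
  subst h1 h2 h3 h4; rfl

/-- the companion element. -/
def Y (t : F) : PSL2 F := P 0 (-1) 1 t (by ring)

/-- normal form -/
lemma exists_Y (hsq : ∀ x : F, x ≠ 0 → ∃ s, s ≠ 0 ∧ (x = s ^ 2 ∨ x = - s ^ 2)) (x : PSL2 F) (hx : x ≠ 1) :
    ∃ t, IsConj (Y t) x := by
  -- first: with lower-left entry nonzero
  have step : ∀ a b c d h, c ≠ 0 → ∃ t, IsConj (Y (F := F) t) (P a b c d h) := by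
    intro a b c d h hc
    obtain ⟨s, hs, e | e⟩ := hsq c hc
    · refine ⟨a + d, isConj_iff.2 ⟨P s⁻¹ (a / s) 0 s (by field_simp; ring), ?_⟩⟩
      subst e
      rw [conj_iff, Y, P_mul, P_mul, P_eq]
      left
      refine ⟨by field_simp; ring, ?_, by field_simp; ring, by field_simp; ring⟩
      field_simp; linear_combination h
    · refine ⟨-(a + d), isConj_iff.2 ⟨P s⁻¹ (-a / s) 0 s (by field_simp; ring), ?_⟩⟩
      subst e
      rw [conj_iff, Y, P_mul, P_mul, P_eq]
      right
      refine ⟨by field_simp; ring, ?_, by field_simp; ring, by field_simp; ring⟩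
      field_simp; linear_combination h
  obtain ⟨a, b, c, d, h, rfl⟩ := exists_P x
  by_cases hc : c = 0
  · by_cases hb : b = 0
    · have had : a ≠ d := fun e => hx (P_eq_one.2 ⟨hb, hc, e⟩)
      obtain ⟨t, ht⟩ := step a 0 (a - d) d (by rw [← h, hb, hc]; ring) (sub_ne_zero.2 had)
      refine ⟨t, ht.trans (isConj_iff.2 ⟨P 1 0 (-1) 1 (by ring), ?_⟩)⟩
      rw [conj_iff, P_mul, P_mul, P_eq]
      left
      subst hb hc
      refine ⟨by ring, by ring, by ring, by ring⟩
    · obtain ⟨t, ht⟩ := step d (-c) (-b) a (by linear_combination h) (neg_ne_zero.2 hb)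
      refine ⟨t, ht.trans (isConj_iff.2 ⟨P 0 (-1) 1 0 (by ring), ?_⟩)⟩
      rw [conj_iff, P_mul, P_mul, P_eq]
      left
      refine ⟨by ring, by ring, by ring, by ring⟩
  · exact step a b c d h hc

/-- trace criterion for squares -/
lemma P_sq {a b c d : F} {h} : P a b c d h * P a b c d h = 1 ↔ P a b c d h = 1 ∨ a + d = 0 := by
  rw [P_mul, P_eq_one, P_eq_one]
  constructor
  · rintro ⟨h1, h2, h3⟩
    by_cases ht : a + d = 0
    · exact Or.inr ht
    · left
      refine ⟨mul_left_cancel₀ ht (by linear_combination h1), mul_left_cancel₀ ht (by linear_combination h2), mul_left_cancel₀ ht (by linear_combination h3)⟩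
  · rintro (⟨rfl, rfl, rfl⟩ | ht)
    · simp
    · refine ⟨by linear_combination b * ht, by linear_combination c * ht, by linear_combination (a - d) * ht⟩

lemma Y_sq {t : F} : Y t ^ 2 = 1 ↔ t = 0 := by
  rw [pow_two, Y, P_sq, P_eq_one]; simp

/-- commuting with a companion element -/
lemma P_comm_Y (h2 : (2 : F) ≠ 0) {a b c d h} {t : F} (ht : t ≠ 0) :
    P a b c d h * Y t = Y t * P a b c d h ↔ b = -c ∧ d = a + c * t := by
  rw [Y, P_mul, P_mul, P_eq]
  constructor
  · rintro (⟨e1, e2, e3, e4⟩ | ⟨e1, e2, e3, e4⟩)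
    · exact ⟨by linear_combination e1, by linear_combination e3⟩
    · exfalso
      have : 2 * t = 0 := by
        linear_combination (- 2 * t) * h + d * e1 - b * e3 - c * e2 + a * e4
      exact (mul_ne_zero h2 ht) this
  · rintro ⟨rfl, rfl⟩
    left
    refine ⟨by ring, by ring, by ring, by ring⟩

lemma P_comm_w {a b c d : F} {h} :
    P a b c d h * Y 0 = Y 0 * P a b c d h ↔ (b = -c ∧ d = a) ∨ (b = c ∧ d = -a) := by
  rw [Y, P_mul, P_mul, P_eq]
  constructor
  · rintro (⟨e1, e2, e3, e4⟩ | ⟨e1, e2, e3, e4⟩)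
    · exact Or.inl ⟨by linear_combination e1, by linear_combination e3⟩
    · exact Or.inr ⟨by linear_combination e1, by linear_combination e3⟩
  · rintro (⟨rfl, rfl⟩ | ⟨rfl, rfl⟩)
    · left
      refine ⟨by ring, by ring, by ring, by ring⟩
    · right
      refine ⟨by ring, by ring, by ring, by ring⟩

end PSLbasic

section Three
variable {F : Type} [Field F] (h3 : (3 : F) = 0)
include h3

lemma two_ne : (2 : F) ≠ 0 := by
  intro h; exact one_ne_zero (α := F) (by linear_combination h3 - h)

lemma P_cube {a b c d : F} {h} : P a b c d h ^ 3 = 1 ↔ (a + d) ^ 2 = 1 := by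
  have e : P a b c d h ^ 3 = P a b c d h * P a b c d h * P a b c d h := by
    rw [pow_succ, pow_two]
  rw [e, P_mul, P_mul, P_eq_one]
  constructor
  · rintro ⟨h1, h2, h4⟩
    by_contra ht
    have ht' : (a + d) ^ 2 - 1 ≠ 0 := sub_ne_zero.2 ht
    have b0 : b = 0 := mul_left_cancel₀ ht' (by linear_combination h1 + b * h)
    have c0 : c = 0 := mul_left_cancel₀ ht' (by linear_combination h2 + c * h)
    have ad : a - d = 0 := mul_left_cancel₀ ht' (by linear_combination h4 + (a - d) * h)
    apply ht
    rw [b0, c0] at h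
    linear_combination 4 * h + (a-d) * ad + h3
  · intro ht
    refine ⟨?_, ?_, ?_⟩
    · linear_combination b * ht - b * h
    · linear_combination c * ht - c * h
    · linear_combination (a - d) * ht - (a - d) * h

lemma Y_cube {t : F} : Y t ^ 3 = 1 ↔ t ^ 2 = 1 := by
  rw [Y, P_cube h3, zero_add]

end Three
end RC

end


section
set_option linter.unusedSectionVars false
namespace RC

open Finset

section PSLexpl
variable {F : Type} [Field F] (h3 : (3 : F) = 0)

/-- the standard unipotent elements -/
def uu (b : F) : PSL2 F := P 1 b 0 1 (by ring)

lemma uu_inv (b : F) : (uu b)⁻¹ = uu (-b) := by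
  rw [uu, P_inv, uu]; simp

lemma Y0_sq : Y (0 : F) * Y 0 = 1 := by
  rw [← pow_two, Y_sq]

lemma Y_ne (t : F) : Y t ≠ 1 := by
  rw [Y, Ne, P_eq_one]; simp

lemma uu_ne {b : F} (hb : b ≠ 0) : uu b ≠ 1 := by
  rw [uu, Ne, P_eq_one]; simp [hb]

lemma Y_w_conj (hsq : ∀ x : F, x ≠ 0 → ∃ s, s ≠ 0 ∧ (x = s ^ 2 ∨ x = - s ^ 2)) (t : PSL2 F) (ht : t * t = 1) (h1 : t ≠ 1) :
    IsConj (Y 0) t := by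
  obtain ⟨s, hs⟩ := exists_Y hsq t h1
  obtain ⟨g, rfl⟩ := isConj_iff.1 hs
  have : Y s ^ 2 = 1 := by
    have e : g * (Y s ^ 2) * g⁻¹ = 1 := by rw [← ht, pow_two]; group
    rwa [conj_eq_one_iff] at e
  rw [Y_sq] at this
  subst this; exact hs

include h3 in
lemma uu_cube (b : F) : uu b ^ 3 = 1 := by
  rw [uu, P_cube h3]; linear_combination h3

include h3 in
lemma v_nc (hm1 : ∀ x : F, x ^ 2 ≠ -1) : ¬ IsConj (uu (1 : F)) (uu 1)⁻¹ := by
  intro h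
  obtain ⟨g, hg⟩ := isConj_iff.1 h
  obtain ⟨a, b, c, d, h, rfl⟩ := exists_P g
  have h2 := two_ne h3
  rw [conj_iff, uu_inv, uu, uu, P_mul, P_mul, P_eq] at hg
  rcases hg with ⟨e1, e2, e4, e5⟩ | ⟨e1, e2, e4, e5⟩
  · apply hm1 a
    grind
  · have c0 : c = 0 := mul_left_cancel₀ h2 (by linear_combination e4)
    have a0 : a = 0 := mul_left_cancel₀ h2 (by linear_combination e1 + c0)
    rw [c0, a0] at h; simp at h

include h3 in
lemma v_ord3 (hsq : ∀ x : F, x ≠ 0 → ∃ s, s ≠ 0 ∧ (x = s ^ 2 ∨ x = - s ^ 2)) (s : PSL2 F) (hs : s ^ 3 = 1) :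
    s = 1 ∨ IsConj (uu 1) s ∨ IsConj (uu (1 : F))⁻¹ s := by
  by_cases h1 : s = 1
  · exact Or.inl h1
  right
  obtain ⟨t, ht⟩ := exists_Y hsq s h1
  have h : Y t ^ 3 = 1 := by
    obtain ⟨g, rfl⟩ := isConj_iff.1 ht
    rwa [conj_pow, conj_eq_one_iff] at hs
  rw [Y_cube h3] at h
  have : (t - 1) * (t + 1) = 0 := by linear_combination h
  rcases mul_eq_zero.1 this with e | e
  · left
    obtain rfl : t = 1 := by linear_combination e
    refine IsConj.trans (isConj_iff.2 ⟨P 1 (-1) 1 0 (by ring), ?_⟩) ht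
    rw [conj_iff, Y, uu, P_mul, P_mul, P_eq]
    right
    refine ⟨?_, ?_, ?_, ?_⟩ <;> grind
  · right
    obtain rfl : t = -1 := by linear_combination e
    refine IsConj.trans (isConj_iff.2 ⟨P 1 1 (-1) 0 (by ring), ?_⟩) ht
    rw [conj_iff, uu_inv, Y, uu, P_mul, P_mul, P_eq]
    left
    refine ⟨?_, ?_, ?_, ?_⟩ <;> grind

include h3 in
lemma comm_uu {b : F} (hb : b ≠ 0) (g : PSL2 F) : g * uu b = uu b * g ↔ ∃ c, g = uu c := by
  have h2 := two_ne h3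
  constructor
  · intro hg
    obtain ⟨x, y, z, t, h, rfl⟩ := exists_P g
    rw [uu, P_mul, P_mul, P_eq] at hg
    rcases hg with ⟨e1, e2, e4, e5⟩ | ⟨e1, e2, e4, e5⟩
    · have z0 : z = 0 := mul_left_cancel₀ hb (by linear_combination -e1)
      have xt : x = t := mul_left_cancel₀ hb (by linear_combination e2)
      subst xt z0
      have : (x - 1) * (x + 1) = 0 := by linear_combination h
      rcases mul_eq_zero.1 this with e | e
      · refine ⟨y, ?_⟩
        rw [uu, P_eq]; left
        exact ⟨by linear_combination e, rfl, rfl, by linear_combination e⟩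
      · refine ⟨-y, ?_⟩
        rw [uu, P_eq]; right
        exact ⟨by linear_combination e, by ring, by ring, by linear_combination e⟩
    · exfalso
      have c0 : z = 0 := mul_left_cancel₀ h2 (by linear_combination e4)
      have a0 : x = 0 := mul_left_cancel₀ h2 (by linear_combination e1 - b * c0)
      rw [c0, a0] at h; simp at h
  · rintro ⟨c, rfl⟩
    rw [uu, uu, P_mul, P_mul, P_eq]
    left
    refine ⟨?_, ?_, ?_, ?_⟩ <;> ring

include h3 in
lemma uu_inj {b c : F} (h : uu b = uu c) : b = c := by
  rw [uu, uu, P_eq] at h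
  rcases h with ⟨_, h, _⟩ | ⟨h, _⟩
  · exact h
  · exfalso; apply two_ne h3; linear_combination h

include h3 in
lemma cv_card : Nat.card (Subgroup.centralizer {uu (1 : F)}) = Nat.card F := by
  symm
  refine Nat.card_congr (Equiv.ofBijective (fun b => ⟨uu b, by
    rw [Subgroup.mem_centralizer_singleton_iff, comm_uu h3 one_ne_zero]; exact ⟨b, rfl⟩⟩) ⟨?_, ?_⟩)
  · intro b c h
    exact uu_inj h3 (Subtype.ext_iff.1 h)
  · rintro ⟨g, hg⟩
    rw [Subgroup.mem_centralizer_singleton_iff, comm_uu h3 one_ne_zero] at hg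
    obtain ⟨c, rfl⟩ := hg
    exact ⟨c, rfl⟩

include h3 in
lemma vw_rel : Y (0 : F) * (uu 1 * Y 0 * (uu 1)⁻¹) = (uu 1 * Y 0 * (uu 1)⁻¹) * Y 0 := by
  rw [uu_inv, uu, uu, Y, P_mul, P_mul, P_mul, P_mul, P_eq]
  right
  refine ⟨?_, ?_, ?_, ?_⟩ <;> grind

include h3 in
lemma wv_rel : (Y (0 : F) * uu 1) ^ 3 = 1 := by
  rw [uu, Y, P_mul, P_cube h3]
  ring

include h3 in
lemma torsor_rel (j u : PSL2 F) (hj : j * j = 1) (hj1 : j ≠ 1) (hu : IsConj (uu 1) u)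
    (hju : (j * u) ^ 3 = 1) : ∃ g, j = g * Y 0 * g⁻¹ ∧ u = g * uu 1 * g⁻¹ := by
  obtain ⟨h, rfl⟩ := isConj_iff.1 hu
  obtain ⟨i, rfl⟩ : ∃ i, j = h * i * h⁻¹ := ⟨h⁻¹ * j * h, by group⟩
  have e1 : i * i = 1 := by
    have : h * (i * i) * h⁻¹ = 1 := by rw [← hj]; group
    rwa [conj_eq_one_iff] at this
  have e2 : i ≠ 1 := by
    rintro rfl; apply hj1; group
  have e4 : (i * uu 1) ^ 3 = 1 := by
    have : h * i * h⁻¹ * (h * uu 1 * h⁻¹) = h * (i * uu 1) * h⁻¹ := by group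
    rwa [this, conj_pow, conj_eq_one_iff] at hju
  have key : ∀ a b d hh, i = P a b 1 d hh → ∃ g', i = g' * Y 0 * g'⁻¹ ∧ uu 1 = g' * uu 1 * g'⁻¹ := by
    rintro a b d hh rfl
    have had := P_sq.1 e1
    have had := had.resolve_left e2
    obtain rfl : d = -a := by linear_combination had
    refine ⟨uu a, ?_, ?_⟩
    · rw [eq_comm, conj_iff, Y, uu, P_mul, P_mul, P_eq]
      left
      refine ⟨?_, ?_, ?_, ?_⟩ <;> grind
    · rw [eq_comm, conj_iff, comm_uu h3 one_ne_zero]; exact ⟨a, rfl⟩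
  have : ∃ g', i = g' * Y 0 * g'⁻¹ ∧ uu 1 = g' * uu 1 * g'⁻¹ := by
    obtain ⟨a, b, c, d, hh, rfl⟩ := exists_P i
    have had := P_sq.1 e1
    have had := had.resolve_left e2
    rw [uu, P_mul, P_cube h3] at e4
    have e5 : (c - 1) * (c + 1) = 0 := by grind
    rcases mul_eq_zero.1 e5 with e | e
    · obtain rfl : c = 1 := by linear_combination e
      exact key _ _ _ _ rfl
    · obtain rfl : c = -1 := by linear_combination e
      refine key (-a) (-b) (-d) (by linear_combination hh) ?_
      rw [P_eq]; right; simp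
  obtain ⟨g', q1, q2⟩ := this
  refine ⟨h * g', ?_, ?_⟩
  · conv_lhs => rw [q1]
    group
  · conv_lhs => rw [q2]
    group

/-- the diagonal automorphism of `SL₂`, as a function -/
def sgnFun (A : SL2 F) : SL2 F := mm (A.1 0 0) (-A.1 0 1) (-A.1 1 0) (A.1 1 1) (by
    rw [neg_mul_neg, ← Matrix.det_fin_two, A.2])

lemma sgnFun_mm {a b c d : F} {h} : sgnFun (mm a b c d h) = mm a (-b) (-c) d (by linear_combination h) := by
  rw [sgnFun, mm_inj]
  exact ⟨rfl, rfl, rfl, rfl⟩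

/-- the diagonal automorphism of `SL₂` -/
def sgnAut (F : Type) [Field F] : SL2 F ≃* SL2 F where
  toFun := sgnFun
  invFun := sgnFun
  left_inv A := by
    obtain ⟨a, b, c, d, h, rfl⟩ := exists_mm A
    rw [sgnFun_mm, sgnFun_mm, mm_inj]; simp
  right_inv A := by
    obtain ⟨a, b, c, d, h, rfl⟩ := exists_mm A
    rw [sgnFun_mm, sgnFun_mm, mm_inj]; simp
  map_mul' A B := by
    obtain ⟨a, b, c, d, h, rfl⟩ := exists_mm A
    obtain ⟨a', b', c', d', h', rfl⟩ := exists_mm B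
    rw [mm_mul, sgnFun_mm, sgnFun_mm, sgnFun_mm, mm_mul, mm_inj]
    refine ⟨?_, ?_, ?_, ?_⟩ <;> ring

lemma delta_ex : ∃ φ : MulAut (PSL2 F), φ (uu 1) = (uu 1)⁻¹ := by
  have hm : (Subgroup.center (SL2 F)).map (sgnAut F : SL2 F →* SL2 F) = Subgroup.center (SL2 F) := by
    ext x
    rw [Subgroup.mem_map]
    constructor
    · rintro ⟨y, hy, rfl⟩
      rw [Subgroup.mem_center_iff] at hy ⊢
      intro g
      obtain ⟨g, rfl⟩ := (sgnAut F).surjective g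
      change sgnAut F g * sgnAut F y = sgnAut F y * sgnAut F g
      rw [← map_mul, ← map_mul, hy]
    · intro hx
      obtain ⟨y, rfl⟩ := (sgnAut F).surjective x
      refine ⟨y, ?_, rfl⟩
      rw [Subgroup.mem_center_iff] at hx ⊢
      intro g
      apply (sgnAut F).injective
      rw [map_mul, map_mul, hx]
  refine ⟨QuotientGroup.congr (Subgroup.center (SL2 F)) (Subgroup.center (SL2 F)) (sgnAut F) hm, ?_⟩
  · rw [uu_inv]
    have : QuotientGroup.congr (Subgroup.center (SL2 F)) (Subgroup.center (SL2 F)) (sgnAut F) hm (uu 1) = QuotientGroup.mk (sgnAut F (mm 1 1 0 1 (by ring))) := rfl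
    rw [this, uu, P]
    congr 1
    change sgnFun _ = _
    rw [sgnFun_mm, mm_inj]
    simp

end PSLexpl
end RC

end


section
set_option linter.unusedSectionVars false
namespace RC

open Finset

section Counting
variable {F : Type} [Field F] [Fintype F] (h3 : (3 : F) = 0)

/-- parametrisation of `SL₂`. -/
noncomputable def slEquiv (F : Type) [Field F] : (F × F × Fˣ) ⊕ (F × Fˣ) → SL2 F :=
  Sum.elim
    (fun p => mm p.1 ((p.1 * p.2.1 - 1) / p.2.2) p.2.2 p.2.1 (by
      rw [div_mul_cancel₀ _ p.2.2.ne_zero]; ring))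
    (fun p => mm p.2 p.1 0 (p.2 : F)⁻¹ (by
      rw [mul_inv_cancel₀ p.2.ne_zero]; ring))

lemma slEquiv_bij (F : Type) [Field F] : Function.Bijective (slEquiv F) := by
  constructor
  · rintro (⟨a, d, c⟩ | ⟨b, a⟩) (⟨a', d', c'⟩ | ⟨b', a'⟩) h
    · simp only [slEquiv, Sum.elim_inl, mm_inj] at h
      obtain ⟨h1, -, h3, h4⟩ := h
      have := Units.ext h3
      subst h1 this h4
      rfl
    · simp only [slEquiv, Sum.elim_inl, Sum.elim_inr, mm_inj] at h
      exact absurd h.2.2.1 c.ne_zero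
    · simp only [slEquiv, Sum.elim_inl, Sum.elim_inr, mm_inj] at h
      exact absurd h.2.2.1.symm c'.ne_zero
    · simp only [slEquiv, Sum.elim_inr, mm_inj] at h
      obtain ⟨h1, h2, -, -⟩ := h
      have := Units.ext h1
      subst h2 this
      rfl
  · intro A
    obtain ⟨a, b, c, d, h, rfl⟩ := exists_mm A
    by_cases hc : c = 0
    · subst hc
      have ha : a ≠ 0 := by rintro rfl; simp at h
      refine ⟨Sum.inr (b, Units.mk0 a ha), ?_⟩
      simp only [slEquiv, Sum.elim_inr, mm_inj]
      refine ⟨rfl, trivial, trivial, ?_⟩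
      exact inv_eq_of_mul_eq_one_right (by rw [Units.val_mk0]; linear_combination h)
    · refine ⟨Sum.inl (a, d, Units.mk0 c hc), ?_⟩
      simp only [slEquiv, Sum.elim_inl, mm_inj]
      refine ⟨trivial, ?_, rfl, trivial⟩
      rw [Units.val_mk0, div_eq_iff hc]; linear_combination h

lemma card_SL : Nat.card (SL2 F) = Fintype.card F * (Fintype.card F - 1) * (Fintype.card F + 1) := by
  classical
  rw [← Nat.card_congr (Equiv.ofBijective _ (slEquiv_bij F)), Nat.card_eq_fintype_card, Fintype.card_sum, Fintype.card_prod, Fintype.card_prod,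
    Fintype.card_units]
  ring

include h3 in
lemma card_center : Nat.card (Subgroup.center (SL2 F)) = 2 := by
  have : (Subgroup.center (SL2 F) : Set (SL2 F)) = {1, mm (-1) 0 0 (-1) (by ring)} := by
    ext A
    obtain ⟨a, b, c, d, h, rfl⟩ := exists_mm A
    rw [SetLike.mem_coe, mm_center, Set.mem_insert_iff, Set.mem_singleton_iff, mm_one, mm_inj, mm_inj]
    constructor
    · rintro ⟨rfl, rfl, rfl, rfl | rfl⟩ <;> simp
    · rintro (⟨rfl, rfl, rfl, rfl⟩ | ⟨rfl, rfl, rfl, rfl⟩) <;> simp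
  have e : Nat.card (Subgroup.center (SL2 F)) = (Subgroup.center (SL2 F) : Set (SL2 F)).ncard := rfl
  rw [e, this, Set.ncard_pair]
  rw [mm_one, Ne, mm_inj]
  rintro ⟨h, -⟩
  apply two_ne h3
  linear_combination h

include h3 in
lemma card_PSL : 2 * Nat.card (PSL2 F) = Fintype.card F * (Fintype.card F - 1) * (Fintype.card F + 1) := by
  rw [← card_SL, ← card_center h3, Subgroup.card_eq_card_quotient_mul_card_subgroup (Subgroup.center (SL2 F)), mul_comm]

include h3 in
lemma pts_split (D e : F) (he : e ≠ 0) (hD : D = e ^ 2) :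
    Nat.card {p : F × F // p.1 ^ 2 - D * p.2 ^ 2 = 1} = Fintype.card F - 1 := by
  classical
  rw [← Fintype.card_units, ← Nat.card_eq_fintype_card]
  symm
  subst hD
  have h2 : (2 : F) = -1 := by linear_combination h3
  refine Nat.card_congr ⟨fun u => ⟨(-(u + (u : F)⁻¹), -(u - (u : F)⁻¹) / e), ?_⟩, fun p => ⟨p.1.1 + e * p.1.2, p.1.1 - e * p.1.2, ?_, ?_⟩, ?_, ?_⟩
  · have := u.ne_zero
    field_simp
    linear_combination h3 * u ^ 2
  · have := p.2; linear_combination this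
  · have := p.2; linear_combination this
  · intro u
    apply Units.ext
    have := u.ne_zero
    change -(u + (u : F)⁻¹) + e * (-(u - (u : F)⁻¹) / e) = u
    field_simp
    linear_combination -h3 * u ^ 2
  · rintro ⟨⟨x, y⟩, h⟩
    have h : x ^ 2 - e ^ 2 * y ^ 2 = 1 := h
    apply Subtype.ext
    have hi : (x + e * y)⁻¹ = x - e * y := inv_eq_of_mul_eq_one_right (by linear_combination h)
    change (-((x + e * y) + (x + e * y)⁻¹), -((x + e * y) - (x + e * y)⁻¹) / e) = (x, y)
    rw [hi, Prod.mk.injEq]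
    constructor
    · linear_combination -x * h3
    · rw [div_eq_iff he]; linear_combination - e * y * h3

lemma pts_circle (hm1 : ∀ x : F, x ^ 2 ≠ -1) :
    Nat.card {p : F × F // p.1 ^ 2 + p.2 ^ 2 = 1} = Fintype.card F + 1 := by
  classical
  have hne : ∀ m : F, m ^ 2 + 1 ≠ 0 := fun m h => hm1 m (by linear_combination h)
  rw [← Fintype.card_option, ← Nat.card_eq_fintype_card]
  symm
  have h2 : (2 : F) ≠ 0 := by
    intro h; apply hm1 1; linear_combination h
  refine Nat.card_congr (Equiv.ofBijective (fun o => o.elim ⟨(1, 0), by simp⟩ (fun m => ⟨((m ^ 2 - 1) / (m ^ 2 + 1), 2 * m / (m ^ 2 + 1)), ?_⟩)) ⟨?_, ?_⟩)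
  · have := hne m
    field_simp; ring
  · rintro (_ | m) (_ | n) h
    · rfl
    · exfalso
      have h := Subtype.ext_iff.1 h
      have h : ((1 : F), (0 : F)) = ((n ^ 2 - 1) / (n ^ 2 + 1), 2 * n / (n ^ 2 + 1)) := h
      rw [Prod.mk.injEq, eq_div_iff (hne n)] at h
      apply h2; linear_combination h.1
    · exfalso
      have h := Subtype.ext_iff.1 h
      have h : ((m ^ 2 - 1) / (m ^ 2 + 1), 2 * m / (m ^ 2 + 1)) = ((1 : F), (0 : F)) := h
      rw [Prod.mk.injEq, div_eq_iff (hne m)] at h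
      apply h2; linear_combination -h.1
    · have h := Subtype.ext_iff.1 h
      have h : ((m ^ 2 - 1) / (m ^ 2 + 1), 2 * m / (m ^ 2 + 1)) = ((n ^ 2 - 1) / (n ^ 2 + 1), 2 * n / (n ^ 2 + 1)) := h
      rw [Prod.mk.injEq, div_eq_div_iff (hne m) (hne n), div_eq_div_iff (hne m) (hne n)] at h
      congr 1
      have e1 : m ^ 2 = n ^ 2 := mul_left_cancel₀ h2 (by linear_combination h.1)
      refine mul_right_cancel₀ (mul_ne_zero h2 (hne n)) ?_
      linear_combination h.2 + 2 * n * e1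
  · rintro ⟨⟨x, y⟩, h⟩
    have h : x ^ 2 + y ^ 2 = 1 := h
    by_cases hx : x = 1
    · refine ⟨none, Subtype.ext ?_⟩
      change ((1 : F), (0 : F)) = _
      subst hx
      have : y ^ 2 = 0 := by linear_combination h
      rw [pow_eq_zero_iff two_ne_zero] at this
      exact Prod.ext rfl this.symm
    · have hx' : 1 - x ≠ 0 := fun h => hx (by linear_combination -h)
      refine ⟨some (y / (1 - x)), Subtype.ext ?_⟩
      have := hne (y / (1 - x))
      change (((y / (1 - x)) ^ 2 - 1) / ((y / (1 - x)) ^ 2 + 1), 2 * (y / (1 - x)) / ((y / (1 - x)) ^ 2 + 1)) = _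
      rw [Prod.mk.injEq, div_eq_iff this, div_eq_iff this]
      constructor
      · field_simp
        linear_combination (1 - x) * h
      · field_simp
        linear_combination -y * h

lemma pts_nonsplit (hm1 : ∀ x : F, x ^ 2 ≠ -1) (D e : F) (he : e ≠ 0) (hD : D = -e ^ 2) :
    Nat.card {p : F × F // p.1 ^ 2 - D * p.2 ^ 2 = 1} = Fintype.card F + 1 := by
  rw [← pts_circle hm1]
  subst hD
  refine Nat.card_congr ⟨fun p => ⟨(p.1.1, e * p.1.2), ?_⟩, fun p => ⟨(p.1.1, p.1.2 / e), ?_⟩, ?_, ?_⟩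
  · have := p.2; linear_combination this
  · have := p.2
    field_simp
    linear_combination this
  · intro p
    apply Subtype.ext
    simp [he]
  · intro p
    apply Subtype.ext
    simp only
    ext
    · rfl
    · simp; field_simp

/-- The torus in `SL₂` -/
def Tor (t : F) : Subgroup (SL2 F) := Subgroup.centralizer {mm 0 (-1) 1 t (by ring)}

lemma mem_Tor {t a b c d : F} {h} : mm a b c d h ∈ Tor t ↔ b = -c ∧ d = a + c * t := by
  rw [Tor, Subgroup.mem_centralizer_singleton_iff, mm_mul, mm_mul, mm_inj]
  constructor
  · rintro ⟨e1, e2, e3, e4⟩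
    exact ⟨by linear_combination e1, by linear_combination e3⟩
  · rintro ⟨rfl, rfl⟩
    refine ⟨by ring, by ring, by ring, by ring⟩

include h3 in
lemma card_Tor (t : F) : Nat.card (Tor t) = Nat.card {p : F × F // p.1 ^ 2 - (t ^ 2 - 1) * p.2 ^ 2 = 1} := by
  symm
  refine Nat.card_congr (Equiv.ofBijective (fun p => ⟨mm (p.1.1 + t * p.1.2) (-p.1.2) p.1.2 (p.1.1 + t * p.1.2 + p.1.2 * t) ?_, ?_⟩) ⟨?_, ?_⟩)
  · have := p.2
    linear_combination this + h3 * (p.1.1 * p.1.2 * t + t ^ 2 * p.1.2 ^ 2)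
  · rw [mem_Tor]; exact ⟨rfl, rfl⟩
  · intro p q h
    have h := Subtype.ext_iff.1 h
    simp only [mm_inj] at h
    apply Subtype.ext
    have h2 := h.2.2.1
    ext
    · linear_combination h.1 - t * h2
    · exact h2
  · rintro ⟨A, hA⟩
    obtain ⟨a, b, c, d, h, rfl⟩ := exists_mm A
    rw [mem_Tor] at hA
    obtain ⟨rfl, rfl⟩ := hA
    refine ⟨⟨(a - t * c, c), ?_⟩, Subtype.ext ?_⟩
    · simp only
      linear_combination h - h3 * a * c * t
    · simp only [mm_inj]
      refine ⟨by ring, trivial, trivial, by ring⟩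

/-- The torus in `PSL₂` -/
def PTor (t : F) : Subgroup (PSL2 F) := (Tor t).map (QuotientGroup.mk' _)

lemma mem_PTor {t a b c d : F} {h} : P a b c d h ∈ PTor t ↔ b = -c ∧ d = a + c * t := by
  rw [PTor, Subgroup.mem_map]
  constructor
  · rintro ⟨A, hA, e⟩
    obtain ⟨a', b', c', d', h', rfl⟩ := exists_mm A
    rw [mem_Tor] at hA
    change P a' b' c' d' h' = _ at e
    rw [P_eq] at e
    obtain ⟨rfl, rfl⟩ := hA
    rcases e with ⟨e1, e2, e3, e4⟩ | ⟨e1, e2, e3, e4⟩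
    · subst e1 e2 e3 e4
      exact ⟨rfl, rfl⟩
    · constructor
      · linear_combination e2 + e3
      · linear_combination e4 - e1 - t * e3
  · intro hh
    exact ⟨mm a b c d h, mem_Tor.2 hh, rfl⟩

include h3 in
lemma card_PTor (t : F) : 2 * Nat.card (PTor t) = Nat.card (Tor t) := by
  set φ : Tor t →* PSL2 F := (QuotientGroup.mk' (Subgroup.center (SL2 F))).comp (Tor t).subtype with hφ
  have hr : φ.range = PTor t := by
    rw [hφ, MonoidHom.range_comp, Subgroup.range_subtype]; rfl
  have hk : Nat.card φ.ker = 2 := by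
    refine Eq.trans ?_ (card_center h3 (F := F))
    have hle : Subgroup.center (SL2 F) ≤ Tor t := Subgroup.center_le_centralizer _
    refine Nat.card_congr ⟨fun x => ⟨x.1.1, ?_⟩, fun x => ⟨⟨x.1, hle x.2⟩, ?_⟩, ?_, ?_⟩
    · have := x.2
      rw [MonoidHom.mem_ker] at this
      exact (QuotientGroup.eq_one_iff _).1 this
    · rw [MonoidHom.mem_ker]
      exact (QuotientGroup.eq_one_iff _).2 x.2
    · intro x; rfl
    · intro x; rfl
  rw [← hr, ← Subgroup.index_ker]
  have := Subgroup.card_mul_index φ.ker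
  rw [hk] at this
  exact this

include h3 in
lemma cyc_PTor (t : F) (ht : t ^ 2 ≠ 1) : IsCyclic (PTor t) := by
  have : Finite (SL2 F) := inferInstance
  -- root of the characteristic polynomial
  obtain ⟨l, hl⟩ : ∃ l : AlgebraicClosure F, l ^ 2 - algebraMap F _ t * l + 1 = 0 := by
    have hq : ∃ l : AlgebraicClosure F, (1 : AlgebraicClosure F) * (l * l) + (- algebraMap F _ t) * l + 1 = 0 := by
      have h2 : (2 : AlgebraicClosure F) ≠ 0 := by
        have := (map_ne_zero (algebraMap F (AlgebraicClosure F))).2 (two_ne h3)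
        rwa [map_ofNat] at this
      have : NeZero (2 : AlgebraicClosure F) := ⟨h2⟩
      obtain ⟨s, hs⟩ := IsAlgClosed.exists_pow_nat_eq (discrim 1 (- algebraMap F (AlgebraicClosure F) t) 1) (n := 2) (by norm_num)
      exact exists_quadratic_eq_zero one_ne_zero ⟨s, by rw [← hs, pow_two]⟩
    obtain ⟨l, hl⟩ := hq
    exact ⟨l, by linear_combination hl⟩
  set ι := algebraMap F (AlgebraicClosure F) with hι
  have hinj : Function.Injective ι := ι.injective
  have hcyc : IsCyclic (Tor t) := by
    refine isCyclic_of_injective_ringHom (R := AlgebraicClosure F)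
      ⟨⟨fun A => ι (A.1.1 0 0) + ι (A.1.1 1 0) * l, ?_⟩, ?_⟩ ?_
    · change ι ((1 : SL2 F).1 0 0) + ι ((1 : SL2 F).1 1 0) * l = 1
      simp
    · rintro ⟨A, hA⟩ ⟨B, hB⟩
      obtain ⟨a, b, c, d, h, rfl⟩ := exists_mm A
      obtain ⟨a', b', c', d', h', rfl⟩ := exists_mm B
      rw [mem_Tor] at hA hB
      obtain ⟨rfl, rfl⟩ := hA
      obtain ⟨rfl, rfl⟩ := hB
      change ι ((mm _ _ _ _ h * mm _ _ _ _ h' : SL2 F).1 0 0) + ι ((mm _ _ _ _ h * mm _ _ _ _ h' : SL2 F).1 1 0) * l = _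
      rw [mm_mul]
      change ι (a * a' + -c * c') + ι (c * a' + (a + c * t) * c') * l = (ι a + ι c * l) * (ι a' + ι c' * l)
      simp only [map_add, map_mul, map_neg]
      linear_combination (-ι c * ι c') * hl
    · rw [injective_iff_map_eq_one]
      rintro ⟨A, hA⟩ e
      obtain ⟨a, b, c, d, h, rfl⟩ := exists_mm A
      rw [mem_Tor] at hA
      obtain ⟨rfl, rfl⟩ := hA
      apply Subtype.ext
      change mm _ _ _ _ h = 1
      change ι a + ι c * l = 1 at e
      rw [mm_one, mm_inj]
      have h' : ι a ^ 2 + ι a * ι c * ι t + ι c ^ 2 = 1 := by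
        rw [← map_one ι, ← h]; simp only [map_sub, map_add, map_mul, map_neg]; ring
      have e' : ι c * (2 * l - ι t) = 0 := by
        linear_combination -h' - (-ι a - 1 + ι c * l - ι c * ι t) * e + (ι c ^ 2) * hl
      rcases mul_eq_zero.1 e' with e' | e'
      · have c0 : c = 0 := by rwa [map_eq_zero] at e'
        subst c0
        have : a = 1 := hinj (by simpa using e)
        subst this; simp
      · exfalso
        apply ht
        apply hinj
        rw [map_pow, map_one]
        have h3' : (3 : AlgebraicClosure F) = 0 := by
          have := congrArg ι h3; rwa [map_ofNat, map_zero] at this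
        linear_combination (2 * l - ι t) * e' - 4 * hl + h3'
  have hr : Function.Surjective (((QuotientGroup.mk' (Subgroup.center (SL2 F))).subgroupMap (Tor t))) :=
    MonoidHom.subgroupMap_surjective _ _
  exact isCyclic_of_surjective _ hr

end Counting
end RC

end


section
set_option linter.unusedSectionVars false
namespace RC

open Finset

section Cents
variable {F : Type} [Field F] [Fintype F] (h3 : (3 : F) = 0)

include h3 in
lemma cent_Y {t : F} (ht : t ≠ 0) : Subgroup.centralizer {Y t} = PTor t := by
  ext g
  obtain ⟨a, b, c, d, h, rfl⟩ := exists_P g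
  rw [Subgroup.mem_centralizer_singleton_iff, P_comm_Y (two_ne h3) ht, mem_PTor]

lemma cent_conj {S : Type} [Group S] (g y : S) :
    Subgroup.centralizer {g * y * g⁻¹} = (Subgroup.centralizer {y}).map (MulAut.conj g).toMonoidHom := by
  ext x
  rw [Subgroup.mem_map, Subgroup.mem_centralizer_singleton_iff]
  constructor
  · intro h
    refine ⟨g⁻¹ * x * g, ?_, ?_⟩
    · rw [Subgroup.mem_centralizer_singleton_iff]
      calc g⁻¹ * x * g * y = g⁻¹ * (x * (g * y * g⁻¹)) * g := by group
        _ = g⁻¹ * ((g * y * g⁻¹) * x) * g := by rw [h]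
        _ = _ := by group
    · change g * (g⁻¹ * x * g) * g⁻¹ = x
      group
  · rintro ⟨z, hz, rfl⟩
    rw [Subgroup.mem_centralizer_singleton_iff] at hz
    change g * z * g⁻¹ * (g * y * g⁻¹) = (g * y * g⁻¹) * (g * z * g⁻¹)
    calc _ = g * (z * y) * g⁻¹ := by group
      _ = g * (y * z) * g⁻¹ := by rw [hz]
      _ = _ := by group

include h3 in
lemma Y_data (hsq : ∀ x : F, x ≠ 0 → ∃ s, s ≠ 0 ∧ (x = s ^ 2 ∨ x = - s ^ 2)) (x : PSL2 F)
    (hx2 : x ^ 2 ≠ 1) (hx3 : x ^ 3 ≠ 1) : ∃ g t, x = g * Y t * g⁻¹ ∧ t ≠ 0 ∧ t ^ 2 ≠ 1 := by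
  have hx : x ≠ 1 := by rintro rfl; simp at hx2
  obtain ⟨t, ht⟩ := exists_Y hsq x hx
  obtain ⟨g, rfl⟩ := isConj_iff.1 ht
  refine ⟨g, t, rfl, ?_, ?_⟩
  · rintro rfl
    apply hx2
    rw [conj_pow, conj_eq_one_iff, Y_sq]
  · intro e
    apply hx3
    rw [conj_pow, conj_eq_one_iff, Y_cube h3, e]

include h3 in
lemma cyc_all (hsq : ∀ x : F, x ≠ 0 → ∃ s, s ≠ 0 ∧ (x = s ^ 2 ∨ x = - s ^ 2)) (hm1 : ∀ x : F, x ^ 2 ≠ -1)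
    {k : ℕ} (hq : Fintype.card F = 24 * k + 3) (x : PSL2 F) (hx2 : x ^ 2 ≠ 1) (hx3 : x ^ 3 ≠ 1) :
    IsCyclic (Subgroup.centralizer {x}) ∧
    (Nat.card (Subgroup.centralizer {x}) = 12 * k + 1 ∨
      Nat.card (Subgroup.centralizer {x}) = 12 * k + 2) := by
  obtain ⟨g, t, rfl, ht, ht2⟩ := Y_data h3 hsq x hx2 hx3
  rw [cent_conj]
  have hD : t ^ 2 - 1 ≠ 0 := sub_ne_zero.2 ht2
  have hcy := cyc_PTor h3 t ht2
  rw [← cent_Y h3 ht] at hcy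
  constructor
  · exact isCyclic_of_surjective _ (MonoidHom.subgroupMap_surjective (MulAut.conj g).toMonoidHom (Subgroup.centralizer {Y t}))
  · have hcard : Nat.card ((Subgroup.centralizer {Y t}).map (MulAut.conj g).toMonoidHom) = Nat.card (PTor t) := by
      rw [cent_Y h3 ht]
      exact (Nat.card_congr ((PTor t).equivMapOfInjective (MulAut.conj g).toMonoidHom (MulAut.conj g).injective).toEquiv).symm
    rw [hcard]
    have h1 := card_PTor h3 t
    rw [card_Tor h3] at h1
    obtain ⟨e, he, hh | hh⟩ := hsq _ hD
    · rw [pts_split h3 _ e he hh, hq] at h1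
      left; omega
    · rw [pts_nonsplit hm1 _ e he hh, hq] at h1
      right; omega

include h3 in
lemma Y_inv_conj (hsq : ∀ x : F, x ≠ 0 → ∃ s, s ≠ 0 ∧ (x = s ^ 2 ∨ x = - s ^ 2)) (t : F) (ht2 : t ^ 2 ≠ 1) :
    ∃ j : PSL2 F, j * Y t * j⁻¹ = (Y t)⁻¹ := by
  have key : ∀ x y : F, x ^ 2 + y ^ 2 - x * y * t = -1 → ∃ j : PSL2 F, j * Y t * j⁻¹ = (Y t)⁻¹ := by
    intro x y h
    refine ⟨P x y (y - x * t) (-x) (by linear_combination -h), ?_⟩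
    rw [conj_iff, Y, P_inv, P_mul, P_mul, P_eq]
    left
    refine ⟨by ring, by ring, by ring, by ring⟩
  obtain ⟨e, he, hh | hh⟩ := hsq _ (sub_ne_zero.2 ht2)
  · refine key (- t / e) (1 / e) ?_
    field_simp
    linear_combination h3 * t ^ 2 - h3 * t ^ 2 -hh + h3 * t ^ 2
  · refine key (1 - t / e) (1 / e) ?_
    field_simp
    linear_combination h3 * (t ^ 2 - e * t) - hh + h3 * e ^ 2

include h3 in
lemma Y_conj_comm (t : F) (ht : t ≠ 0) (ht2 : t ^ 2 ≠ 1) (g : PSL2 F)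
    (hc : (g * Y t * g⁻¹) * Y t = Y t * (g * Y t * g⁻¹)) :
    g * Y t * g⁻¹ = Y t ∨ g * Y t * g⁻¹ = (Y t)⁻¹ := by
  obtain ⟨A, B, C, D, h, e, htr⟩ : ∃ A B C D h, g * Y t * g⁻¹ = P A B C D h ∧ A + D = t := by
    obtain ⟨a, b, c, d, h, rfl⟩ := exists_P g
    rw [Y, P_inv, P_mul, P_mul]
    refine ⟨_, _, _, _, _, rfl, ?_⟩
    linear_combination t * h
  rw [e] at hc ⊢
  rw [P_comm_Y (two_ne h3) ht] at hc
  obtain ⟨rfl, rfl⟩ := hc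
  have hA : A = (C - 1) * t := by linear_combination h3 * A - htr
  have h0 : (C - 1) * (C + 1) * (1 - t ^ 2) = 0 := by
    rw [hA] at h
    linear_combination h - h3 * (C - 1) * C * t ^ 2
  rcases mul_eq_zero.1 h0 with h0 | h0
  · rcases mul_eq_zero.1 h0 with h0 | h0
    · left
      rw [Y, P_eq]; left
      refine ⟨by linear_combination hA + t * h0, by linear_combination -h0, by linear_combination h0, ?_⟩
      linear_combination hA + 2 * t * h0
    · right
      rw [Y, P_inv, P_eq]; left
      refine ⟨by linear_combination hA + t * h0 - h3 * t, by linear_combination -h0, by linear_combination h0, ?_⟩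
      linear_combination hA + 2 * t * h0 - h3 * t
  · exact absurd (by linear_combination -h0) ht2

include h3 in
lemma cinv_all (hsq : ∀ x : F, x ≠ 0 → ∃ s, s ≠ 0 ∧ (x = s ^ 2 ∨ x = - s ^ 2)) 
    (x : PSL2 F) (hx2 : x ^ 2 ≠ 1) (hx3 : x ^ 3 ≠ 1) :
    (∃ j, j * x * j⁻¹ = x⁻¹) ∧
    ∀ g, (g * x * g⁻¹) * x = x * (g * x * g⁻¹) → g * x * g⁻¹ = x ∨ g * x * g⁻¹ = x⁻¹ := by
  obtain ⟨h, t, rfl, ht, ht2⟩ := Y_data h3 hsq x hx2 hx3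
  constructor
  · obtain ⟨j, hj⟩ := Y_inv_conj h3 hsq t ht2
    refine ⟨h * j * h⁻¹, ?_⟩
    calc _ = h * (j * Y t * j⁻¹) * h⁻¹ := by group
      _ = _ := by rw [hj]; group
  · intro g hg
    have := Y_conj_comm h3 t ht ht2 (h⁻¹ * g * h) (by
      calc _ = h⁻¹ * ((g * (h * Y t * h⁻¹) * g⁻¹) * (h * Y t * h⁻¹)) * h := by group
        _ = _ := by rw [hg]; group)
    rcases this with e | e
    · left
      calc _ = h * ((h⁻¹ * g * h) * Y t * (h⁻¹ * g * h)⁻¹) * h⁻¹ := by group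
        _ = _ := by rw [e]
    · right
      calc _ = h * ((h⁻¹ * g * h) * Y t * (h⁻¹ * g * h)⁻¹) * h⁻¹ := by group
        _ = _ := by rw [e]; group

include h3 in
lemma card_PTor0 (hm1 : ∀ x : F, x ^ 2 ≠ -1) : 2 * Nat.card (PTor (0 : F)) = Fintype.card F + 1 := by
  rw [card_PTor h3, card_Tor h3, pts_nonsplit hm1 _ 1 one_ne_zero (by ring)]

include h3 in
lemma cw_card (hm1 : ∀ x : F, x ^ 2 ≠ -1) : Nat.card (Subgroup.centralizer {Y (0 : F)}) = Fintype.card F + 1 := by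
  have hle : PTor (0 : F) ≤ Subgroup.centralizer {Y (0 : F)} := by
    intro g hg
    obtain ⟨a, b, c, d, h, rfl⟩ := exists_P g
    rw [mem_PTor] at hg
    rw [Subgroup.mem_centralizer_singleton_iff, P_comm_w]
    left; simpa using hg
  have h2 := two_ne h3
  have hr : (PTor (0 : F)).relIndex (Subgroup.centralizer {Y (0 : F)}) = 2 := by
    rw [Subgroup.relIndex_eq_two_iff]
    refine ⟨P 1 1 1 (-1) (by linear_combination -h3), ?_, ?_⟩
    · rw [Subgroup.mem_centralizer_singleton_iff, P_comm_w]; right; simp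
    · intro g hg
      obtain ⟨a, b, c, d, h, rfl⟩ := exists_P g
      rw [Subgroup.mem_centralizer_singleton_iff, P_comm_w] at hg
      rw [P_mul, mem_PTor, mem_PTor]
      rcases hg with ⟨rfl, rfl⟩ | ⟨rfl, rfl⟩
      · right
        refine ⟨⟨rfl, by ring⟩, ?_⟩
        rintro ⟨e1, e2⟩
        have hac : d + c = 0 := mul_left_cancel₀ h2 (by linear_combination e1)
        have hac' : d - c = 0 := mul_left_cancel₀ h2 (by linear_combination -e2)
        have d0 : d = 0 := mul_left_cancel₀ h2 (by linear_combination hac + hac')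
        have c0 : c = 0 := by linear_combination hac - d0
        rw [d0, c0] at h; simp at h
      · left
        refine ⟨⟨by ring, by ring⟩, ?_⟩
        rintro ⟨e1, e2⟩
        have a0 : a = 0 := mul_left_cancel₀ h2 (by linear_combination -e2)
        have c0 : b = 0 := mul_left_cancel₀ h2 (by linear_combination e1)
        rw [a0, c0] at h; simp at h
  rw [← card_PTor0 h3 hm1]
  have := Subgroup.card_mul_index ((PTor (0 : F)).subgroupOf (Subgroup.centralizer {Y (0 : F)}))
  rw [← this]
  change _ * (PTor (0 : F)).relIndex (Subgroup.centralizer {Y (0 : F)}) = _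
  rw [hr, Nat.card_congr (Subgroup.subgroupOfEquivOfLe hle).toEquiv, mul_comm]

include h3 in
lemma tw_ex (hm1 : ∀ x : F, x ^ 2 ≠ -1) {k : ℕ} (hq : Fintype.card F = 24 * k + 3) :
    ∃ T : Subgroup (PSL2 F), IsCyclic T ∧ Nat.card T = 12 * k + 2 ∧ Y 0 ∈ T ∧
    (∀ t ∈ T, t * Y 0 = Y 0 * t) ∧ ∀ d, d * Y 0 = Y 0 * d → d ∉ T → d * d = 1 := by
  refine ⟨PTor 0, cyc_PTor h3 0 (by simp), ?_, ?_, ?_, ?_⟩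
  · have := card_PTor0 h3 hm1
    omega
  · rw [Y, mem_PTor]; simp
  · intro g hg
    obtain ⟨a, b, c, d, h, rfl⟩ := exists_P g
    rw [mem_PTor] at hg
    rw [P_comm_w]
    left; simpa using hg
  · intro g hg hn
    obtain ⟨a, b, c, d, h, rfl⟩ := exists_P g
    rw [P_comm_w] at hg
    rw [mem_PTor] at hn
    rw [P_sq]
    rcases hg with hg | hg
    · exact absurd (by simpa using hg) hn
    · right; rw [hg.2]; ring

end Cents
end RC

end


section
set_option linter.unusedSectionVars false
namespace RC

open Finset

section Gam
variable {F : Type} [Field F] [Fintype F] (h3 : (3 : F) = 0)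

lemma neg_one_nonsq {k : ℕ} (hq : Fintype.card F = 24 * k + 3) (x : F) : x ^ 2 ≠ -1 := by
  intro h
  have := (FiniteField.isSquare_neg_one_iff (F := F)).1 ⟨x, by rw [← h, pow_two]⟩
  apply this
  rw [hq]; omega

lemma sq_or {k : ℕ} (hq : Fintype.card F = 24 * k + 3) (x : F) (hx : x ≠ 0) :
    ∃ s, s ≠ 0 ∧ (x = s ^ 2 ∨ x = - s ^ 2) := by
  classical
  have hn : quadraticChar F (-1) = -1 := by
    rw [quadraticChar_neg_one_iff_not_isSquare]
    rintro ⟨y, hy⟩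
    exact neg_one_nonsq hq y (by rw [hy, pow_two])
  rcases quadraticChar_dichotomy hx with h | h
  · obtain ⟨s, hs⟩ := (quadraticChar_one_iff_isSquare hx).1 h
    refine ⟨s, ?_, Or.inl (by rw [hs, pow_two])⟩
    rintro rfl; simp at hs; exact hx hs
  · have h' : quadraticChar F (-x) = 1 := by
      rw [← neg_one_mul, map_mul, hn, h]; rfl
    obtain ⟨s, hs⟩ := (quadraticChar_one_iff_isSquare (neg_ne_zero.2 hx)).1 h'
    refine ⟨s, ?_, Or.inr (by rw [pow_two, ← hs, neg_neg])⟩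
    rintro rfl; simp at hs; exact hx hs

lemma uu_conj_sq (b : F) {s : F} (hs : s ≠ 0) : IsConj (uu b) (uu (s ^ 2 * b)) := by
  refine isConj_iff.2 ⟨P s 0 0 s⁻¹ (by rw [mul_inv_cancel₀ hs]; ring), ?_⟩
  rw [conj_iff, uu, uu, P_mul, P_mul, P_eq]
  left
  refine ⟨by ring, ?_, by ring, by ring⟩
  field_simp; ring

lemma uu_zero : uu (0 : F) = 1 := by rw [uu, P_eq_one]; simp

include h3 in
open Classical in
lemma conj_ind {k : ℕ} (hq : Fintype.card F = 24 * k + 3) (b : F) :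
    (if IsConj (uu 1) (uu b) then (1 : ℂ) else 0) + (if IsConj (uu 1)⁻¹ (uu b) then 1 else 0) = (if b = 0 then 0 else 1) ∧
    (if IsConj (uu 1) (uu b) then (1 : ℂ) else 0) - (if IsConj (uu 1)⁻¹ (uu b) then 1 else 0) = (quadraticChar F b : ℤ) := by
  have hm1 := neg_one_nonsq hq
  have hv := v_nc h3 hm1
  by_cases hb : b = 0
  · subst hb
    have e1 : ¬ IsConj (uu (1 : F)) (uu 0) := by
      rw [uu_zero, isConj_one_left]; exact uu_ne one_ne_zero
    have e2 : ¬ IsConj (uu (1 : F))⁻¹ (uu 0) := by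
      rw [uu_zero, isConj_one_left, inv_eq_one]; exact uu_ne one_ne_zero
    rw [if_neg e1, if_neg e2]
    simp
  · obtain ⟨s, hs, e | e⟩ := sq_or hq b hb
    · have c1 : IsConj (uu 1) (uu b) := by
        have := uu_conj_sq (1 : F) hs
        rwa [mul_one, ← e] at this
      have c2 : ¬ IsConj (uu 1)⁻¹ (uu b) := fun h => hv (c1.trans h.symm)
      have c3 : quadraticChar F b = 1 := (quadraticChar_one_iff_isSquare hb).2 ⟨s, by rw [e, pow_two]⟩
      rw [if_pos c1, if_neg c2, if_neg hb, c3]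
      simp
    · have c1 : IsConj (uu 1)⁻¹ (uu b) := by
        have := uu_conj_sq (-1 : F) hs
        rwa [← uu_inv, show s ^ 2 * -1 = b by rw [e]; ring] at this
      have c2 : ¬ IsConj (uu 1) (uu b) := fun h => hv (h.trans c1.symm)
      have c3 : quadraticChar F b = -1 := by
        rw [quadraticChar_neg_one_iff_not_isSquare]
        rintro ⟨y, hy⟩
        apply hm1 (y / s)
        rw [div_pow, pow_two, ← hy, e]
        field_simp
      rw [if_neg c2, if_pos c1, if_neg hb, c3]
      simp

lemma uu_add (b c : F) : uu (b + c) = uu b * uu c := by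
  rw [uu, uu, uu, P_mul, P_eq]
  left
  refine ⟨by ring, by ring, by ring, by ring⟩

include h3 in
lemma gamma_ex {k : ℕ} (hq : Fintype.card F = 24 * k + 3) [Fintype (PSL2 F)]
    (hcard : Nat.card (PSL2 F) = (24 * k + 3) * ((12 * k + 1) * (24 * k + 4))) :
    ∃ (Γ : PSL2 F → ℂ) (z : ℂ), IsChar Γ ∧ z ^ 2 + z + (6 * k + 1) = 0 ∧
    Γ 1 = (12 * k + 1) * (24 * k + 4) ∧ (∀ s, IsConj (uu 1) s → Γ s = z) ∧
    (∀ s, IsConj (uu 1)⁻¹ s → Γ s = -1 - z) ∧ ∀ s, s ^ 3 ≠ 1 → Γ s = 0 := by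
  classical
  set ψ := AddChar.FiniteField.primitiveChar_to_Complex F with hψ
  have hprim : ψ.IsPrimitive := AddChar.FiniteField.primitiveChar_to_Complex_isPrimitive F
  set U := Subgroup.centralizer {uu (1 : F)} with hU
  have hUm : ∀ g, g ∈ U ↔ ∃ c, g = uu c := fun g => by
    rw [hU, Subgroup.mem_centralizer_singleton_iff, comm_uu h3 one_ne_zero]
  have hUc : Nat.card U = 24 * k + 3 := by rw [hU, cv_card h3, Nat.card_eq_fintype_card, hq]
  have hq0 : ((24 * k + 3 : ℕ) : ℂ) ≠ 0 := by exact_mod_cast (by omega : 24 * k + 3 ≠ 0)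
  set f : PSL2 F → ℂ := fun g => ∑ b, if g = uu b then ψ b else 0 with hf
  have hfu : ∀ b, f (uu b) = ψ b := by
    intro b
    simp only [hf]
    rw [Finset.sum_eq_single b]
    · simp
    · intro c _ hc
      rw [if_neg]
      intro h; exact hc (uu_inj h3 h).symm
    · simp
  have hf0 : ∀ g, g ∉ U → f g = 0 := by
    intro g hg
    refine Finset.sum_eq_zero fun b _ => ?_
    rw [if_neg]
    intro h; exact hg ((hUm g).2 ⟨b, h⟩)
  set Γ : PSL2 F → ℂ := ind (Nat.card U) (fun g => if g ∈ U then f g else 0) with hΓ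
  have hΓc : IsChar Γ := by
    apply isChar_ind_sub
    intro a ha b hb
    obtain ⟨a, rfl⟩ := (hUm a).1 ha
    obtain ⟨b, rfl⟩ := (hUm b).1 hb
    rw [← uu_add, hfu, hfu, hfu, AddChar.map_add_eq_mul]
  have hΓe : ∀ g, Γ g = ((24 * k + 3 : ℕ) : ℂ)⁻¹ * ∑ b, ψ b * #{s : PSL2 F | s⁻¹ * g * s = uu b} := by
    intro g
    rw [hΓ, ind, hUc]
    congr 1
    have : ∀ s : PSL2 F, (if s⁻¹ * g * s ∈ U then f (s⁻¹ * g * s) else 0) = ∑ b, if s⁻¹ * g * s = uu b then ψ b else 0 := by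
      intro s
      split_ifs with h
      · rfl
      · exact (hf0 _ h).symm
    simp only [this]
    rw [Finset.sum_comm]
    refine Finset.sum_congr rfl fun b _ => ?_
    rw [← Finset.sum_filter, Finset.sum_const, nsmul_eq_mul, mul_comm]
  have hcent : ∀ y : PSL2 F, Nat.card (Subgroup.centralizer {y}) = 24 * k + 3 →
      Γ y = ∑ b, ψ b * (if IsConj y (uu b) then 1 else 0) := by
    intro y hy
    rw [hΓe, Finset.mul_sum]
    refine Finset.sum_congr rfl fun b _ => ?_
    split_ifs with h
    · have hcc : #{s : PSL2 F | s⁻¹ * y * s = uu b} = 24 * k + 3 := by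
        rw [← hy, ← card_conj_eq' h]
        congr!
      rw [hcc]
      field_simp
    · have : #{s : PSL2 F | s⁻¹ * y * s = uu b} = 0 := by
        rw [Finset.card_eq_zero, Finset.filter_eq_empty_iff]
        intro s _ hs
        exact h (isConj_iff.2 ⟨s⁻¹, by rw [inv_inv, hs]⟩)
      rw [this]; simp
  have hv := hcent (uu 1) hUc
  have hvi := hcent (uu 1)⁻¹ (by
    rw [← hUc, hU]
    congr 2
    ext g
    rw [Subgroup.mem_centralizer_singleton_iff, Subgroup.mem_centralizer_singleton_iff, uu_inv,
      comm_uu h3 one_ne_zero, comm_uu h3 (neg_ne_zero.2 one_ne_zero)])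
  have hψ0 : ∑ b, ψ b = 0 := by
    apply AddChar.sum_eq_zero_of_ne_one
    have := hprim one_ne_zero
    rwa [AddChar.mulShift_one] at this
  have hsum : Γ (uu 1) + Γ (uu 1)⁻¹ = -1 := by
    rw [hv, hvi, ← Finset.sum_add_distrib]
    have h0 : ∀ b : F, (ψ b * (if IsConj (uu 1) (uu b) then 1 else 0) + ψ b * (if IsConj (uu 1)⁻¹ (uu b) then 1 else 0)) = ψ b * (if b = 0 then 0 else 1) := by
      intro b
      rw [← mul_add]
      congr 1
      convert (conj_ind h3 hq b).1
    simp only [h0]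
    have : ∀ b : F, ψ b * (if b = 0 then 0 else 1) = ψ b - if b = 0 then 1 else 0 := by
      intro b
      split_ifs with h
      · subst h; simp
      · simp
    simp only [this]
    rw [Finset.sum_sub_distrib, hψ0]
    simp
  set χ : MulChar F ℂ := (quadraticChar F).ringHomComp (Int.castRingHom ℂ) with hχ
  have hdiff : Γ (uu 1) - Γ (uu 1)⁻¹ = gaussSum χ ψ := by
    rw [hv, hvi, ← Finset.sum_sub_distrib]
    rw [gaussSum]
    refine Finset.sum_congr rfl fun b _ => ?_
    rw [← mul_sub, mul_comm]
    congr 1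
    rw [hχ, MulChar.ringHomComp_apply, eq_intCast]
    convert (conj_ind h3 hq b).2
  have hn : quadraticChar F (-1) = -1 := by
    rw [quadraticChar_neg_one_iff_not_isSquare]
    rintro ⟨y, hy⟩
    exact neg_one_nonsq hq y (by rw [hy, pow_two])
  have hgs : gaussSum χ ψ ^ 2 = -(24 * k + 3) := by
    rw [gaussSum_sq _ ((quadraticChar_isQuadratic F).comp _) hprim, MulChar.ringHomComp_apply, hn, hq]
    · rw [eq_intCast]; push_cast; ring
    · rw [MulChar.ringHomComp_ne_one_iff]
      · intro h
        have h' := hn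
        rw [h, MulChar.one_apply (by simp)] at h'
        exact absurd h' (by norm_num)
      · exact Int.cast_injective
  refine ⟨Γ, Γ (uu 1), hΓc, ?_, ?_, ?_, ?_, ?_⟩
  · rw [← hdiff] at hgs
    have : Γ (uu 1)⁻¹ = -1 - Γ (uu 1) := by linear_combination hsum
    rw [this] at hgs
    linear_combination hgs / 4
  · rw [hΓe, Finset.sum_eq_single 0]
    · have : #{s : PSL2 F | s⁻¹ * 1 * s = uu 0} = Nat.card (PSL2 F) := by
        rw [Nat.card_eq_fintype_card, Finset.filter_true_of_mem, Finset.card_univ]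
        intro s _; rw [uu_zero]; group
      rw [this, hcard, AddChar.map_zero_eq_one]
      push_cast at hq0 ⊢
      field_simp
    · intro b _ hb
      have : #{s : PSL2 F | s⁻¹ * 1 * s = uu b} = 0 := by
        rw [Finset.card_eq_zero, Finset.filter_eq_empty_iff]
        intro s _ hs
        apply uu_ne hb
        rw [← hs]; group
      rw [this]; simp
    · simp
  · intro s hs
    obtain ⟨g, rfl⟩ := isConj_iff.1 hs
    exact ind_conj _ _ _ _
  · intro s hs
    obtain ⟨g, rfl⟩ := isConj_iff.1 hs
    rw [hΓ, ind_conj, ← hΓ]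
    linear_combination hsum
  · intro s hs
    rw [hΓe, Finset.sum_eq_zero, mul_zero]
    intro b _
    have : #{x : PSL2 F | x⁻¹ * s * x = uu b} = 0 := by
      rw [Finset.card_eq_zero, Finset.filter_eq_empty_iff]
      intro x _ hx
      apply hs
      have e := uu_cube h3 b
      rw [← hx] at e
      have e' : (x⁻¹ * s * x⁻¹⁻¹) ^ 3 = 1 := by rw [inv_inv, e]
      rwa [conj_pow, conj_eq_one_iff] at e'
    rw [this]; simp

include h3 in
theorem good_PSL {k : ℕ} (hq : Fintype.card F = 24 * k + 3) : Good (PSL2 F) k (uu 1) (Y 0) := by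
  have hm1 := neg_one_nonsq hq
  have hsq := sq_or hq
  have hcard : Nat.card (PSL2 F) = (24 * k + 3) * ((12 * k + 1) * (24 * k + 4)) := by
    have := card_PSL h3 (F := F)
    rw [hq, show 24 * k + 3 - 1 = 2 * (12 * k + 1) by omega] at this
    have h : 2 * Nat.card (PSL2 F) = 2 * ((24 * k + 3) * ((12 * k + 1) * (24 * k + 4))) := by
      rw [this]; ring
    exact Nat.eq_of_mul_eq_mul_left (by norm_num) h
  have : Fintype (PSL2 F) := Fintype.ofFinite _
  exact {
    card := hcard
    w2 := Y0_sq
    w1 := Y_ne 0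
    inv := Y_w_conj hsq
    cw := by rw [cw_card h3 hm1, hq]
    tw := tw_ex h3 hm1 hq
    cyc := cyc_all h3 hsq hm1 hq
    cinv := cinv_all h3 hsq
    v3 := uu_cube h3 1
    v1 := uu_ne one_ne_zero
    vnc := v_nc h3 hm1
    ord3 := v_ord3 h3 hsq
    cv := by rw [cv_card h3, Nat.card_eq_fintype_card, hq]
    vw := vw_rel h3
    wv := wv_rel h3
    torsor := torsor_rel h3
    delta := delta_ex
    gamma := gamma_ex h3 hq hcard }

end Gam
end RC

end


section
set_option linter.unusedSectionVars false
namespace RC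

lemma pow_three_mod {f : ℕ} (hf : Odd f) : ∃ k, 3 ^ f = 24 * k + 3 := by
  obtain ⟨j, rfl⟩ := hf
  induction j with
  | zero => exact ⟨0, by norm_num⟩
  | succ j ih =>
    obtain ⟨k, hk⟩ := ih
    refine ⟨9 * k + 1, ?_⟩
    rw [show 2 * (j + 1) + 1 = (2 * j + 1) + 2 by ring, pow_add, hk]
    ring

lemma nonab_PSL {F : Type} [Field F] [Fintype F] (h3 : (3 : F) = 0) :
    ∃ a b : PSL2 F, a * b ≠ b * a := by
  refine ⟨Y 0, uu 1, fun h => ?_⟩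
  obtain ⟨c, hc⟩ := (comm_uu h3 one_ne_zero (Y 0)).1 h
  rw [uu, Y, P_eq] at hc
  simp at hc

theorem final {G : Type} [Group G] [Finite G]
    (L M : Subgroup G) [L.Normal] [M.Normal]
    (f n : ℕ) (hf : Odd f) (hf3 : 3 ≤ f)
    (hiso : Nonempty (↥(M.map (QuotientGroup.mk' L)) ≃*
      (Fin n → PSL2 (GaloisField 3 f))))
    (x : G) (hxM : x ∈ M)
    (hx1 : (QuotientGroup.mk x : G ⧸ L) ≠ 1)
    (hxodd : Odd (orderOf (QuotientGroup.mk x : G ⧸ L)))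
    (hxrat : IsRationalElement (QuotientGroup.mk x : G ⧸ L)) :
    ∃ V : FDRep ℂ G, CategoryTheory.Simple V ∧
      (∀ g : G, ∃ q : ℚ, V.character g = (q : ℂ)) ∧
      Even (Module.finrank ℂ V) := by
  classical
  obtain ⟨e⟩ := hiso
  have hc : Nat.card (GaloisField 3 f) = 3 ^ f := GaloisField.card 3 f (by omega)
  haveI : Finite (GaloisField 3 f) := Nat.finite_of_card_ne_zero (by rw [hc]; positivity)
  letI : Fintype (GaloisField 3 f) := Fintype.ofFinite _
  obtain ⟨k, hk⟩ := pow_three_mod hf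
  have hq : Fintype.card (GaloisField 3 f) = 24 * k + 3 := by
    rw [← Nat.card_eq_fintype_card, hc, hk]
  have h3 : (3 : GaloisField 3 f) = 0 := by
    have := CharP.cast_eq_zero (GaloisField 3 f) 3
    exact_mod_cast this
  haveI : IsSimpleGroup (PSL2 (GaloisField 3 f)) := by
    refine Matrix.ProjectiveSpecialLinearGroup.rank_two_simple ?_
    rw [hc]
    calc 4 ≤ 3 ^ 3 := by norm_num
      _ ≤ 3 ^ f := Nat.pow_le_pow_right (by norm_num) hf3
  letI : Fintype (PSL2 (GaloisField 3 f)) := Fintype.ofFinite _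
  letI : Fintype G := Fintype.ofFinite _
  letI : Fintype (G ⧸ L) := Fintype.ofFinite _
  haveI hN : (M.map (QuotientGroup.mk' L)).Normal :=
    Subgroup.Normal.map inferInstance _ (QuotientGroup.mk'_surjective L)
  set N := M.map (QuotientGroup.mk' L) with hNd
  let ι : (Fin n → PSL2 (GaloisField 3 f)) →* G ⧸ L := N.subtype.comp e.symm.toMonoidHom
  let α : G ⧸ L →* MulAut (Fin n → PSL2 (GaloisField 3 f)) :=
    (MulAut.congr e).toMonoidHom.comp MulAut.conjNormal
  have hι : Function.Injective ι := N.subtype_injective.comp e.symm.injective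
  have hα : ∀ g s, ι (α g s) = g * ι s * g⁻¹ := by
    intro g s
    simp [ι, α, MulAut.congr]
  let X : N := ⟨QuotientGroup.mk x, ⟨x, hxM, rfl⟩⟩
  have hιX : ι (e X) = QuotientGroup.mk x := by simp [ι, X]
  have hord : orderOf (e X) = orderOf (QuotientGroup.mk x : G ⧸ L) := by
    rw [← hιX, orderOf_injective ι hι]
  have hC : Concl (G ⧸ L) := by
    refine main_good (good_PSL h3 hq) (nonab_PSL h3) hι hα (e X) ?_ ?_ ?_
    · intro h
      rw [h, map_one] at hιX
      exact hx1 hιX.symm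
    · rw [hord]; exact hxodd
    · intro m hm
      rw [hord] at hm
      have hz : Subgroup.zpowers ((QuotientGroup.mk x : G ⧸ L) ^ m) =
          Subgroup.zpowers (QuotientGroup.mk x : G ⧸ L) := by
        apply Subgroup.eq_of_le_of_card_ge
        · rw [Subgroup.zpowers_le]
          exact Subgroup.npow_mem_zpowers _ _
        · rw [Nat.card_zpowers, Nat.card_zpowers, Nat.Coprime.orderOf_pow hm.symm]
      obtain ⟨h, hh⟩ := isConj_iff.1 (hxrat _ hz)
      refine ⟨h, hι ?_⟩
      rw [hα, map_pow, hιX, hh]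
  obtain ⟨χ, m, h1, h2, h4, h5, h6⟩ := hC
  refine fdrep_of (fun g => χ (QuotientGroup.mk' L g)) (h1.comp _) ?_ (fun g => h4 _) m ?_ h6
  · rw [ip_comp_surj _ (QuotientGroup.mk'_surjective L), h2]
  · simp only [map_one]; exact h5

end RC

end

/-- If `L < M` are normal subgroups of the finite group `G` with `M/L` a direct product of
copies of `PSL₂(3^f)` (`f ≥ 3` odd), and `M/L` contains a non-trivial element of odd order
which is rational in `G/L`, then `G` has a rational irreducible character of even degree. -/
theorem rational_char_of_chief_factor_psl {G : Type} [Group G] [Finite G]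
    (L M : Subgroup G) [L.Normal] [M.Normal] (hLM : L < M)
    (f n : ℕ) (hf : Odd f) (hf3 : 3 ≤ f) (hn : 0 < n)
    (hiso : Nonempty (↥(M.map (QuotientGroup.mk' L)) ≃*
      (Fin n → PSL2 (GaloisField 3 f))))
    (x : G) (hxM : x ∈ M)
    (hx1 : (QuotientGroup.mk x : G ⧸ L) ≠ 1)
    (hxodd : Odd (orderOf (QuotientGroup.mk x : G ⧸ L)))
    (hxrat : IsRationalElement (QuotientGroup.mk x : G ⧸ L)) :
    ∃ V : FDRep ℂ G, Simple V ∧ (∀ g : G, ∃ q : ℚ, V.character g = (q : ℂ)) ∧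
      Even (Module.finrank ℂ V) := by
  exact RC.final L M f n hf hf3 hiso x hxM hx1 hxodd hxrat
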